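/- Let n ≥ 1 and δ > (n-1)/2. Let p(·) : ℝ^n → (0,1] be globally log-Hölder continuous and assume p_- := essinf p ≥ 2n/(n+1+2δ). Then there exists a constant C > 0 such that for every Schwartz function f on ℝ^n, ‖B^δ_*(f)‖_{WL^{p(·)}} ≤ C ‖M(f,Φ)‖_{L^{p(·)}}; that is, the maximal Bochner–Riesz means of order δ is bounded from the variable Hardy space H^{p(·)}(ℝ^n) to the weak variable Lebesgue space WL^{p(·)}(ℝ^n). -/

import Mathlib

noncomputable section

open MeasureTheory Real Set
open scoped ENNReal NNReal

abbrev En (n : ℕ) : Type := EuclideanSpace ℝ (Fin n)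

/-- The Bochner–Riesz kernel of order `δ`: the Fourier transform of `ξ ↦ ((1-|ξ|²)⁺)^δ`. -/
def brKernel (n : ℕ) (δ : ℝ) (x : En n) : ℂ :=
  ∫ ξ : En n, (((max (1 - ‖ξ‖ ^ 2) 0) ^ δ : ℝ) : ℂ) *
    Complex.exp (-(2 * Real.pi) * Complex.I * ((∑ i, x i * ξ i : ℝ) : ℂ))

/-- The dilated kernel `φ_ε(x) = ε^{-n} φ(x/ε)`. -/
def brKernelDil (n : ℕ) (δ ε : ℝ) (x : En n) : ℂ :=
  (ε ^ n)⁻¹ • brKernel n δ (ε⁻¹ • x)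

/-- The Bochner–Riesz means `B^δ_{1/ε} f = f * φ_ε`. -/
def brMeans (n : ℕ) (δ ε : ℝ) (f : En n → ℂ) (x : En n) : ℂ :=
  ∫ y, f y * brKernelDil n δ ε (x - y)

/-- The maximal Bochner–Riesz means `B^δ_* f`. -/
def brMax (n : ℕ) (δ : ℝ) (f : En n → ℂ) (x : En n) : ℝ≥0∞ :=
  ⨆ (ε : ℝ) (_ : 0 < ε), (‖brMeans n δ ε f x‖₊ : ℝ≥0∞)

/-- The radial maximal function `M(f,Φ)(x) = sup_{t>0} |(Φ_t * f)(x)|`. -/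
def radMax (n : ℕ) (Φ : En n → ℂ) (f : En n → ℂ) (x : En n) : ℝ≥0∞ :=
  ⨆ (t : ℝ) (_ : 0 < t), (‖∫ y, (t ^ n)⁻¹ • Φ (t⁻¹ • (x - y)) * f y‖₊ : ℝ≥0∞)

/-- The variable Lebesgue norm `‖g‖_{L^{p(·)}}` of a nonnegative function. -/
def vlQ (n : ℕ) (p : En n → ℝ) (g : En n → ℝ≥0∞) : ℝ≥0∞ :=
  sInf {lam : ℝ≥0∞ | 0 < lam ∧ lam < ⊤ ∧ (∫⁻ x, (g x / lam) ^ (p x)) ≤ 1}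

/-- The weak variable Lebesgue quasinorm `‖g‖_{WL^{p(·)}}`. -/
def vlWQ (n : ℕ) (p : En n → ℝ) (g : En n → ℝ≥0∞) : ℝ≥0∞ :=
  ⨆ (β : ℝ≥0) (_ : 0 < β),
    (β : ℝ≥0∞) * vlQ n p ({x | (β : ℝ≥0∞) < g x}.indicator 1)

/-- `p(·)` is globally log-Hölder continuous. -/
def GlobalLogHolder (n : ℕ) (p : En n → ℝ) : Prop :=
  ∃ (C₀ pinf : ℝ), 0 < C₀ ∧
    (∀ x y : En n, x ≠ y →
      |p x - p y| ≤ C₀ / Real.log (Real.exp 1 + 1 / ‖x - y‖)) ∧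
    (∀ x : En n, |p x - pinf| ≤ C₀ / Real.log (Real.exp 1 + ‖x‖))


/-- the holomorphic integrand -/
def brF (a l : ℝ) (z : ℂ) : ℂ := (1 - z ^ 2) ^ (a : ℂ) * Complex.exp (-(l * z * Complex.I))

lemma brF_rect (a l : ℝ) (ha : 0 < a) :
    (((∫ x in (-1:ℝ)..1, brF a l (x + (-1:ℝ) * Complex.I)) - ∫ x in (-1:ℝ)..1, brF a l (x + (0:ℝ) * Complex.I)) +
            Complex.I • ∫ y in (-1:ℝ)..0, brF a l ((1:ℝ) + y * Complex.I)) -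
          Complex.I • ∫ y in (-1:ℝ)..0, brF a l ((-1:ℝ) + y * Complex.I) = 0 := by
  have h := Complex.integral_boundary_rect_eq_zero_of_continuousOn_of_differentiableOn (brF a l)
    (⟨-1, -1⟩ : ℂ) (⟨1, 0⟩ : ℂ) ?_ ?_
  · exact h
  · intro z hz
    rw [Complex.mem_reProdIm] at hz
    simp only at hz
    rw [uIcc_of_le (by norm_num), uIcc_of_le (by norm_num)] at hz
    apply ContinuousAt.continuousWithinAt
    unfold brF
    apply ContinuousAt.mul
    · apply ContinuousAt.comp (f := fun z : ℂ => 1 - z ^ 2) (g := fun z : ℂ => z ^ (a : ℂ))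
      · apply Complex.continuousAt_cpow_const_of_re_pos
        · left
          simp [pow_two]
          nlinarith [hz.1.1, hz.1.2, mul_self_nonneg z.im]
        · simpa using ha
      · fun_prop
    · fun_prop
  · intro z hz
    rw [Complex.mem_reProdIm] at hz
    simp only at hz
    norm_num at hz
    apply DifferentiableAt.differentiableWithinAt
    unfold brF
    apply DifferentiableAt.mul
    · apply DifferentiableAt.cpow_const
      · fun_prop
      · left
        simp [pow_two]
        nlinarith [hz.1.1, hz.1.2, mul_self_nonneg z.im]
    · fun_prop

lemma norm_brF (a l : ℝ) (z : ℂ) : ‖brF a l z‖ = ‖1 - z ^ 2‖ ^ a * Real.exp (l * z.im) := by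
  unfold brF
  rw [norm_mul, Complex.norm_cpow_real, Complex.norm_exp]
  congr 2
  simp

lemma brF_side (a l : ℝ) (ha : 0 < a) (hl : 0 < l) (e : ℝ) (he : e = 1 ∨ e = -1) :
    ‖∫ y in (-1:ℝ)..0, brF a l ((e:ℝ) + y * Complex.I)‖ ≤ 3 ^ a * Real.Gamma (a + 1) * (1 / l) ^ (a + 1) := by
  have e2 : e * e = 1 := by rcases he with h | h <;> rw [h] <;> norm_num
  have key : ∀ y : ℝ, y ∈ Ioc (0:ℝ) 1 → ‖brF a l ((e:ℝ) + ((-y : ℝ) : ℂ) * Complex.I)‖ ≤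
      3 ^ a * (y ^ a * Real.exp (-(l * y))) := by
    intro y hy
    rw [norm_brF]
    have h1 : ‖1 - ((e:ℂ) + ((-y : ℝ) : ℂ) * Complex.I) ^ 2‖ ≤ 3 * y := by
      have : 1 - ((e:ℂ) + ((-y : ℝ) : ℂ) * Complex.I) ^ 2 = ((y ^ 2 : ℝ) : ℂ) + ((2 * e * y : ℝ) : ℂ) * Complex.I := by
        have e2' : (e : ℂ) * e = 1 := by exact_mod_cast e2
        push_cast
        linear_combination (-1 : ℂ) * e2' - (y:ℂ)^2 * Complex.I_sq
      rw [this]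
      refine (norm_add_le _ _).trans ?_
      rw [norm_mul, Complex.norm_I, mul_one, Complex.norm_real, Complex.norm_real]
      simp only [Real.norm_eq_abs]
      have : |2 * e * y| = 2 * y := by
        rcases he with h | h <;> rw [h] <;> simp [abs_of_pos hy.1]
      rw [this, abs_of_nonneg (by positivity)]
      nlinarith [hy.1, hy.2]
    have h2 := Real.rpow_le_rpow (norm_nonneg _) h1 ha.le
    rw [Real.mul_rpow (by norm_num) hy.1.le] at h2
    have h3 : l * ((e:ℂ) + ((-y : ℝ) : ℂ) * Complex.I).im = -(l * y) := by simp
    rw [h3, ← mul_assoc]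
    gcongr
  have h0 : ∫ y in (-1:ℝ)..0, brF a l ((e:ℝ) + y * Complex.I) =
      ∫ y in (0:ℝ)..1, brF a l ((e:ℝ) + ((-y : ℝ) : ℂ) * Complex.I) := by
    have := intervalIntegral.integral_comp_neg (a := 0) (b := 1) (fun y : ℝ => brF a l ((e:ℝ) + y * Complex.I))
    rw [this]; simp
  rw [h0, intervalIntegral.integral_of_le (by norm_num)]
  have hIntg : IntegrableOn (fun y : ℝ => 3 ^ a * (y ^ a * Real.exp (-(l * y)))) (Ioi 0) := by
    have := (integrableOn_rpow_mul_exp_neg_mul_rpow (p := 1) (s := a) (b := l) (by linarith) one_pos hl).const_mul (3 ^ a)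
    simpa [IntegrableOn] using this
  refine (norm_integral_le_of_norm_le (hIntg.mono_set Ioc_subset_Ioi_self) ?_).trans ?_
  · filter_upwards [ae_restrict_mem measurableSet_Ioc] with y hy using key y hy
  refine (setIntegral_mono_set hIntg ?_ (LE.le.eventuallyLE Ioc_subset_Ioi_self)).trans ?_
  · filter_upwards [ae_restrict_mem measurableSet_Ioi] with y hy
    have : 0 < y := hy
    simp only [Pi.zero_apply]; positivity
  rw [integral_const_mul]
  have := Real.integral_rpow_mul_exp_neg_mul_Ioi (a := a + 1) (r := l) (by linarith) hl
  simp only [add_sub_cancel_right] at this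
  rw [this]
  apply le_of_eq; ring

lemma brF_bottom (a l : ℝ) (ha : 0 < a) :
    ‖∫ x in (-1:ℝ)..1, brF a l (x + (-1:ℝ) * Complex.I)‖ ≤ 2 * 3 ^ a * Real.exp (-l) := by
  have := intervalIntegral.norm_integral_le_of_norm_le_const (a := -1) (b := 1)
    (f := fun x : ℝ => brF a l (x + (-1:ℝ) * Complex.I)) (C := 3 ^ a * Real.exp (-l)) ?_
  · refine this.trans (le_of_eq ?_); norm_num; ring
  · intro x hx
    rw [uIoc_of_le (by norm_num)] at hx
    rw [norm_brF]
    have h3 : l * ((x:ℂ) + ((-1:ℝ):ℂ) * Complex.I).im = -l := by simp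
    rw [h3]
    have h1 : ‖1 - ((x:ℂ) + ((-1:ℝ):ℂ) * Complex.I) ^ 2‖ ≤ 3 := by
      refine (norm_sub_le _ _).trans ?_
      rw [norm_pow, ← Complex.normSq_eq_norm_sq, Complex.normSq_apply]
      simp
      nlinarith [hx.1, hx.2]
    gcongr

lemma exp_neg_le (b : ℝ) (hb : 0 < b) : ∃ C : ℝ, 0 < C ∧ ∀ l : ℝ, 0 < l → Real.exp (-l) ≤ C * (1 / l) ^ b := by
  refine ⟨b ^ b, by positivity, fun l hl => ?_⟩
  have h := Real.add_one_le_exp (l / b - 1)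
  have h2 : (l / b) ^ b ≤ (Real.exp (l / b - 1)) ^ b :=
    Real.rpow_le_rpow (by positivity) (by linarith) hb.le
  rw [← Real.exp_mul] at h2
  have h3 : Real.exp ((l / b - 1) * b) ≤ Real.exp l := by
    apply Real.exp_le_exp.mpr
    have : (l / b - 1) * b = l - b := by field_simp
    rw [this]; linarith
  have h4 : (l / b) ^ b ≤ Real.exp l := h2.trans h3
  rw [Real.div_rpow hl.le hb.le] at h4
  rw [Real.div_rpow (by norm_num) hl.le, Real.one_rpow, Real.exp_neg]
  have hlb : 0 < l ^ b := by positivity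
  have hbb : 0 < b ^ b := by positivity
  rw [div_le_iff₀ hbb] at h4
  rw [mul_one_div, inv_eq_one_div, div_le_div_iff₀ (Real.exp_pos _) hlb]
  linarith

/-- one dimensional decay -/
lemma oneDim_decay (a : ℝ) (ha : 0 < a) : ∃ C : ℝ, 0 < C ∧ ∀ l : ℝ, 0 ≤ l →
    ‖∫ s in (-1:ℝ)..1, (((1 - s ^ 2) ^ a : ℝ) : ℂ) * Complex.exp (-(l * s * Complex.I))‖ ≤
      C * (1 + l) ^ (-(a + 1)) := by
  obtain ⟨C1, hC1, hexp⟩ := exp_neg_le (a + 1) (by linarith)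
  set D : ℝ := 2 * 3 ^ a * C1 + 2 * (3 ^ a * Real.Gamma (a + 1)) with hD
  have hG : 0 < Real.Gamma (a + 1) := Real.Gamma_pos_of_pos (by linarith)
  have hDpos : 0 < D := by positivity
  refine ⟨(D + 2) * 2 ^ (a + 1), by positivity, fun l hl => ?_⟩
  have heq : ∫ s in (-1:ℝ)..1, (((1 - s ^ 2) ^ a : ℝ) : ℂ) * Complex.exp (-(l * s * Complex.I)) =
      ∫ x in (-1:ℝ)..1, brF a l (x + (0:ℝ) * Complex.I) := by
    apply intervalIntegral.integral_congr
    intro s hs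
    rw [uIcc_of_le (by norm_num)] at hs
    simp only [brF, Complex.ofReal_zero, zero_mul, add_zero]
    rw [Complex.ofReal_cpow (by nlinarith [hs.1, hs.2])]
    push_cast; rfl
  have hbd : ‖∫ s in (-1:ℝ)..1, (((1 - s ^ 2) ^ a : ℝ) : ℂ) * Complex.exp (-(l * s * Complex.I))‖ ≤ 2 := by
    have := intervalIntegral.norm_integral_le_of_norm_le_const (a := -1) (b := 1)
      (f := fun s : ℝ => (((1 - s ^ 2) ^ a : ℝ) : ℂ) * Complex.exp (-(l * s * Complex.I))) (C := 1) ?_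
    · refine this.trans (le_of_eq ?_); norm_num
    · intro s hs
      rw [uIoc_of_le (by norm_num)] at hs
      have h0 : 0 ≤ 1 - s ^ 2 := by nlinarith [hs.1, hs.2]
      rw [norm_mul, Complex.norm_exp, Complex.norm_real, Real.norm_eq_abs,
        abs_of_nonneg (Real.rpow_nonneg h0 _)]
      have : (-((l:ℂ) * s * Complex.I)).re = 0 := by simp
      rw [this, Real.exp_zero, mul_one]
      exact Real.rpow_le_one h0 (by nlinarith [sq_nonneg s]) ha.le
  rcases le_or_gt l 1 with h1 | h1
  · refine hbd.trans ?_
    have : (2:ℝ) ^ (-(a+1)) ≤ (1 + l) ^ (-(a+1)) :=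
      Real.rpow_le_rpow_of_nonpos (by linarith) (by linarith) (by linarith)
    have h5 : (2:ℝ) ^ (a+1) * 2 ^ (-(a+1)) = 1 := by
      rw [← Real.rpow_add (by norm_num)]; simp
    calc (2:ℝ) ≤ (D + 2) * (2 ^ (a+1) * 2 ^ (-(a+1))) := by rw [h5]; linarith
      _ = (D + 2) * 2 ^ (a+1) * 2 ^ (-(a+1)) := by ring
      _ ≤ _ := by gcongr
  · have hlpos : 0 < l := by linarith
    have hr := brF_rect a l ha
    have hb := brF_bottom a l ha
    have hs1 := brF_side a l ha hlpos 1 (Or.inl rfl)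
    have hs2 := brF_side a l ha hlpos (-1) (Or.inr rfl)
    rw [heq]
    set J := ∫ x in (-1:ℝ)..1, brF a l (x + (0:ℝ) * Complex.I)
    set J1 := ∫ x in (-1:ℝ)..1, brF a l (x + (-1:ℝ) * Complex.I)
    set J2 := ∫ y in (-1:ℝ)..0, brF a l ((1:ℝ) + y * Complex.I)
    set J3 := ∫ y in (-1:ℝ)..0, brF a l ((-1:ℝ) + y * Complex.I)
    have hJ : J = J1 + Complex.I • J2 - Complex.I • J3 := by linear_combination -hr
    have h6 : ‖J‖ ≤ ‖J1‖ + ‖J2‖ + ‖J3‖ := by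
      rw [hJ]
      refine (norm_sub_le _ _).trans ?_
      have := norm_add_le J1 (Complex.I • J2)
      rw [norm_smul, Complex.norm_I, one_mul] at this ⊢
      linarith
    have h7 : ‖J‖ ≤ D * (1 / l) ^ (a + 1) := by
      have he := hexp l hlpos
      have : 2 * 3 ^ a * Real.exp (-l) ≤ 2 * 3 ^ a * (C1 * (1 / l) ^ (a + 1)) := by gcongr
      rw [hD]; nlinarith
    refine h7.trans ?_
    have h8 : (1 / l) ^ (a + 1) ≤ 2 ^ (a + 1) * (1 + l) ^ (-(a + 1)) := by
      rw [Real.rpow_neg (by linarith), ← div_eq_mul_inv, ← Real.div_rpow (by norm_num) (by linarith)]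
      apply Real.rpow_le_rpow (by positivity) _ (by linarith)
      rw [div_le_div_iff₀ hlpos (by linarith)]; linarith
    calc D * (1 / l) ^ (a + 1) ≤ (D + 2) * (2 ^ (a + 1) * (1 + l) ^ (-(a + 1))) := by
          gcongr; linarith
      _ = _ := by ring


lemma br_inner_scale (m : ℕ) (δ s : ℝ) (hδ : 0 < δ) (hs : s ∈ Icc (-1:ℝ) 1) :
    ∫ η : Fin m → ℝ, (max (1 - s ^ 2 - ∑ i, η i ^ 2) 0) ^ δ =
      (1 - s ^ 2) ^ (δ + m / 2) * ∫ η : Fin m → ℝ, (max (1 - ∑ i, η i ^ 2) 0) ^ δ := by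
  have h0 : 0 ≤ 1 - s ^ 2 := by nlinarith [hs.1, hs.2]
  rcases h0.eq_or_lt with h | h
  · have h1 : ∀ η : Fin m → ℝ, (max (1 - s ^ 2 - ∑ i, η i ^ 2) 0) ^ δ = 0 := by
      intro η
      rw [← h, max_eq_right, Real.zero_rpow hδ.ne']
      have : 0 ≤ ∑ i, η i ^ 2 := Finset.sum_nonneg fun i _ => sq_nonneg _
      linarith
    simp only [h1, integral_zero]
    rw [← h, Real.zero_rpow (by positivity), zero_mul]
  · set R := Real.sqrt (1 - s ^ 2) with hR
    have hRpos : 0 < R := Real.sqrt_pos.mpr h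
    have hR2 : R ^ 2 = 1 - s ^ 2 := Real.sq_sqrt h0
    have := Measure.integral_comp_smul (volume : Measure (Fin m → ℝ))
      (fun η : Fin m → ℝ => (max (1 - s ^ 2 - ∑ i, η i ^ 2) 0) ^ δ) R
    rw [Module.finrank_fintype_fun_eq_card, Fintype.card_fin, abs_of_pos (by positivity), smul_eq_mul] at this
    have h2 : ∀ η : Fin m → ℝ, (max (1 - s ^ 2 - ∑ i, (R • η) i ^ 2) 0) ^ δ =
        (1 - s ^ 2) ^ δ * (max (1 - ∑ i, η i ^ 2) 0) ^ δ := by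
      intro η
      rw [← Real.mul_rpow h0 (le_max_right _ _)]
      congr 1
      rw [mul_max_of_nonneg _ _ h0, mul_zero]
      congr 1
      simp only [Pi.smul_apply, smul_eq_mul, mul_pow, ← Finset.mul_sum, hR2]
      ring
    simp only [h2, integral_const_mul] at this
    have h3 : (1 - s ^ 2) ^ (δ + m / 2) = (1 - s ^ 2) ^ δ * R ^ m := by
      rw [Real.rpow_add h]
      congr 1
      rw [← hR2, ← Real.rpow_natCast R 2, ← Real.rpow_mul hRpos.le, ← Real.rpow_natCast]
      congr 1; push_cast; ring
    rw [h3]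
    field_simp at this
    linarith

lemma br_mult_integrable (n : ℕ) (δ : ℝ) (hδ : 0 < δ) :
    Integrable (fun ξ : En n => (((max (1 - ‖ξ‖ ^ 2) 0) ^ δ : ℝ) : ℂ)) := by
  apply Continuous.integrable_of_hasCompactSupport
  · apply Complex.continuous_ofReal.comp
    apply Continuous.rpow_const (by fun_prop)
    intro x; right; exact hδ.le
  · apply HasCompactSupport.intro (isCompact_closedBall (0 : En n) 1)
    intro x hx
    rw [mem_closedBall_zero_iff, not_le] at hx
    rw [max_eq_right (by nlinarith), Real.zero_rpow hδ.ne']; simp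

lemma br_rot (m : ℕ) (δ : ℝ) (x : En (m+1)) :
    brKernel (m+1) δ x = ∫ ξ : En (m+1), (((max (1 - ‖ξ‖ ^ 2) 0) ^ δ : ℝ) : ℂ) *
      Complex.exp (-((2 * π * ‖x‖ : ℝ) * (ξ 0 : ℝ) * Complex.I)) := by
  set e0 : En (m+1) := EuclideanSpace.single 0 1 with he0
  have hnorm : ‖x‖ = ‖‖x‖ • e0‖ := by rw [norm_smul, he0]; simp
  set R := (ℝ ∙ (x - ‖x‖ • e0))ᗮ.reflection with hR
  have hRx : R x = ‖x‖ • e0 := Submodule.reflection_sub hnorm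
  have hmp : MeasurePreserving R (volume : Measure (En (m+1))) volume := R.measurePreserving
  have := hmp.integral_comp R.toHomeomorph.measurableEmbedding (fun ξ : En (m+1) =>
     (((max (1 - ‖ξ‖ ^ 2) 0) ^ δ : ℝ) : ℂ) *
    Complex.exp (-(2 * Real.pi) * Complex.I * ((∑ i, x i * ξ i : ℝ) : ℂ)))
  unfold brKernel
  rw [← this]
  congr 1
  ext ξ
  rw [LinearIsometryEquiv.norm_map]
  congr 2
  have h1 : ∑ i, x i * (R ξ) i = inner ℝ x (R ξ) := by
    simp [PiLp.inner_apply, mul_comm]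
  have h2 : inner ℝ x (R ξ) = inner ℝ (R x) ξ := by
    rw [← LinearIsometryEquiv.inner_map_map R x (R ξ)]
    congr 1
    rw [hR, Submodule.reflection_reflection]
  rw [h1, h2, hRx, inner_smul_left, he0, EuclideanSpace.inner_single_left]
  simp
  ring

lemma brKernel_decay (n : ℕ) (hn : 1 ≤ n) (δ : ℝ) (hδ : 0 < δ) :
    ∃ C : ℝ, 0 < C ∧ ∀ x : En n, ‖brKernel n δ x‖ ≤ C * (1 + ‖x‖) ^ (-(((n:ℝ) + 1) / 2 + δ)) := by
  obtain ⟨m, rfl⟩ : ∃ m, n = m + 1 := ⟨n - 1, by omega⟩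
  set a : ℝ := δ + m / 2 with ha
  have hapos : 0 < a := by positivity
  obtain ⟨C, hC, hdec⟩ := oneDim_decay a hapos
  set c0 : ℝ := ∫ η : Fin m → ℝ, (max (1 - ∑ i, η i ^ 2) 0) ^ δ with hc0
  refine ⟨(|c0| + 1) * C, by positivity, fun x => ?_⟩
  set l : ℝ := 2 * π * ‖x‖ with hl
  have hlx : ‖x‖ ≤ l := by
    have := Real.pi_gt_three
    have := norm_nonneg x
    nlinarith
  rw [br_rot]
  -- change of variables
  set e := (MeasurableEquiv.toLp 2 (Fin (m+1) → ℝ)).symm.trans (MeasurableEquiv.piFinSuccAbove (fun _ => ℝ) 0) with he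
  have hmp : MeasurePreserving e (volume : Measure (En (m+1))) (volume : Measure (ℝ × (Fin m → ℝ))) :=
    (EuclideanSpace.volume_preserving_symm_measurableEquiv_toLp (Fin (m+1))).trans
      (volume_preserving_piFinSuccAbove (fun _ => ℝ) 0)
  set F : ℝ × (Fin m → ℝ) → ℂ := fun q => (((max (1 - q.1 ^ 2 - ∑ i, q.2 i ^ 2) 0) ^ δ : ℝ) : ℂ) *
      Complex.exp (-(l * q.1 * Complex.I)) with hF
  have hFe : ∀ ξ : En (m+1), F (e ξ) = (((max (1 - ‖ξ‖ ^ 2) 0) ^ δ : ℝ) : ℂ) *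
      Complex.exp (-(l * (ξ 0 : ℝ) * Complex.I)) := by
    intro ξ
    have h1 : (e ξ).1 = ξ 0 := rfl
    have h2 : ∀ i, (e ξ).2 i = ξ (Fin.succ i) := fun i => rfl
    simp only [hF, h1, h2]
    congr 4
    rw [EuclideanSpace.real_norm_sq_eq, Fin.sum_univ_succ]; ring
  have hFint : Integrable F := by
    rw [← hmp.integrable_comp_emb e.measurableEmbedding]
    have : (F ∘ e) = fun ξ : En (m+1) => (((max (1 - ‖ξ‖ ^ 2) 0) ^ δ : ℝ) : ℂ) *
      Complex.exp (-(l * (ξ 0 : ℝ) * Complex.I)) := funext hFe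
    rw [this]
    apply (br_mult_integrable (m+1) δ hδ).mul_bdd (c := 1)
    · fun_prop
    · filter_upwards with ξ
      rw [Complex.norm_exp]; simp
  have h3 : ∫ ξ : En (m+1), (((max (1 - ‖ξ‖ ^ 2) 0) ^ δ : ℝ) : ℂ) *
      Complex.exp (-(l * (ξ 0 : ℝ) * Complex.I)) = ∫ q, F q := by
    rw [← hmp.integral_comp e.measurableEmbedding]
    simp only [hFe]
  rw [h3]
  rw [show (volume : Measure (ℝ × (Fin m → ℝ))) = volume.prod volume from rfl] at hFint ⊢
  rw [integral_prod _ hFint]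
  have h4 : ∀ s : ℝ, ∫ η, F (s, η) = ((∫ η : Fin m → ℝ, (max (1 - s ^ 2 - ∑ i, η i ^ 2) 0) ^ δ : ℝ) : ℂ) *
      Complex.exp (-(l * s * Complex.I)) := by
    intro s
    simp only [hF]
    rw [integral_mul_const, integral_complex_ofReal]
  simp only [h4]
  rw [← setIntegral_eq_integral_of_forall_compl_eq_zero (s := Ioc (-1:ℝ) 1)]
  · rw [← intervalIntegral.integral_of_le (by norm_num)]
    have h5 : ∫ s in (-1:ℝ)..1, ((∫ η : Fin m → ℝ, (max (1 - s ^ 2 - ∑ i, η i ^ 2) 0) ^ δ : ℝ) : ℂ) *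
      Complex.exp (-(l * s * Complex.I)) = c0 * ∫ s in (-1:ℝ)..1, (((1 - s ^ 2) ^ a : ℝ) : ℂ) * Complex.exp (-(l * s * Complex.I)) := by
      rw [← intervalIntegral.integral_const_mul]
      apply intervalIntegral.integral_congr
      intro s hs
      rw [uIcc_of_le (by norm_num)] at hs
      simp only
      rw [br_inner_scale m δ s hδ hs, ← ha, ← hc0]
      push_cast; ring
    rw [h5, norm_mul, Complex.norm_real, Real.norm_eq_abs]
    have h6 := hdec l (by positivity)
    have h7 : (1 + l) ^ (-(a + 1)) ≤ (1 + ‖x‖) ^ (-(a + 1)) :=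
      Real.rpow_le_rpow_of_nonpos (by positivity) (by linarith) (by linarith)
    have h8 : -(((((m + 1 : ℕ):ℝ)) + 1) / 2 + δ) = -(a + 1) := by rw [ha]; push_cast; ring
    rw [h8]
    calc _ ≤ |c0| * (C * (1 + l) ^ (-(a + 1))) := by gcongr
      _ ≤ (|c0| + 1) * (C * (1 + ‖x‖) ^ (-(a + 1))) := by gcongr; linarith
      _ = _ := by ring
  · intro s hs
    have : ∀ η : Fin m → ℝ, (max (1 - s ^ 2 - ∑ i, η i ^ 2) 0) ^ δ = 0 := by
      intro η
      have h9 : 0 ≤ ∑ i, η i ^ 2 := Finset.sum_nonneg fun i _ => sq_nonneg _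
      rw [max_eq_right, Real.zero_rpow hδ.ne']
      simp only [mem_Ioc, not_and_or, not_lt, not_le] at hs
      rcases hs with hs | hs <;> nlinarith
    simp [this]


lemma geom_tsum_int (β : ℝ≥0∞) (hβ : β ≠ 0) (hβ' : β ≠ ⊤) (p₀ e : ℝ) (hp₀ : 0 < p₀) (he : p₀ ≤ e)
    (a : ℝ≥0∞) :
    ∑' k : ℤ, (if β * 2 ^ k < a then (β * 2 ^ k) ^ e else 0) ≤ (1 - (2:ℝ≥0∞) ^ (-p₀))⁻¹ * a ^ e := by
  have he0 : 0 < e := lt_of_lt_of_le hp₀ he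
  have hc0 : (1 - (2:ℝ≥0∞) ^ (-p₀))⁻¹ ≠ 0 := by
    simp
  rcases eq_or_ne a ⊤ with rfl | ha
  · rw [ENNReal.top_rpow_of_pos he0, ENNReal.mul_top hc0]; exact le_top
  rcases eq_or_ne a 0 with rfl | ha0
  · simp
  have h1 : a / β ≠ 0 := ENNReal.div_ne_zero.2 ⟨ha0, hβ'⟩
  have h2 : a / β ≠ ⊤ := ENNReal.div_ne_top ha hβ
  obtain ⟨m, hm1, hm2⟩ := ENNReal.exists_mem_Ioc_zpow h1 h2 ENNReal.one_lt_two ENNReal.ofNat_ne_top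
  have hk : ∀ k : ℤ, β * 2 ^ k < a → k ≤ m := by
    intro k hk
    by_contra hcon
    push Not at hcon
    have : (2:ℝ≥0∞) ^ (m+1) ≤ 2 ^ k := ENNReal.zpow_le_of_le ENNReal.one_lt_two.le hcon
    have h3 : a / β ≤ 2 ^ k := hm2.trans this
    rw [ENNReal.div_le_iff hβ hβ'] at h3
    rw [mul_comm] at h3
    exact absurd hk (not_lt.2 h3)
  have hma : β * 2 ^ m ≤ a := by
    have := hm1.le
    rw [ENNReal.le_div_iff_mul_le (Or.inl hβ) (Or.inl hβ')] at this
    rwa [mul_comm]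
  have hinj : Function.Injective (fun j : ℕ => m - (j:ℤ)) := by
    intro i j hij
    simpa using hij
  rw [← hinj.tsum_eq]
  · calc ∑' c : ℕ, (if β * 2 ^ (m - (c:ℤ)) < a then (β * 2 ^ (m - (c:ℤ))) ^ e else 0)
        ≤ ∑' c : ℕ, ((2:ℝ≥0∞) ^ (-p₀)) ^ c * a ^ e := by
          refine ENNReal.tsum_le_tsum fun c => ?_
          split_ifs
          · rw [ENNReal.zpow_sub (by norm_num) (by norm_num), ← mul_assoc, ENNReal.mul_rpow_of_nonneg _ _ he0.le,
              mul_comm]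
            refine mul_le_mul' ?_ (ENNReal.rpow_le_rpow hma he0.le)
            rw [ENNReal.inv_rpow, zpow_natCast, ← ENNReal.rpow_natCast, ← ENNReal.rpow_mul, ← ENNReal.rpow_natCast, ← ENNReal.rpow_mul,
              ← ENNReal.rpow_neg]
            apply ENNReal.rpow_le_rpow_of_exponent_le (by norm_num)
            have : (0:ℝ) ≤ c := by positivity
            nlinarith
          · exact zero_le
      _ = _ := by
          rw [ENNReal.tsum_mul_right, ENNReal.tsum_geometric]
  · intro k hk'
    simp only [Function.mem_support, ne_eq, ite_eq_right_iff, not_forall] at hk'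
    obtain ⟨h, -⟩ := hk'
    have := hk k h
    exact ⟨(m - k).toNat, by simp; omega⟩

/-- Hardy-Littlewood maximal function -/
def hlM {n : ℕ} (g : En n → ℝ≥0∞) (x : En n) : ℝ≥0∞ :=
  ⨆ (R : ℝ) (_ : 0 < R), (∫⁻ y in Metric.closedBall x R, g y) / volume (Metric.closedBall x R)

lemma le_hlM {n : ℕ} (g : En n → ℝ≥0∞) (x : En n) (R : ℝ) (hR : 0 < R) :
    (∫⁻ y in Metric.closedBall x R, g y) / volume (Metric.closedBall x R) ≤ hlM g x :=
  le_iSup₂_of_le R hR le_rfl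

lemma vol_cb_pos {n : ℕ} (x : En n) {R : ℝ} (hR : 0 < R) : volume (Metric.closedBall x R) ≠ 0 :=
  (Metric.measure_closedBall_pos volume x hR).ne'

lemma vol_cb_fin {n : ℕ} (x : En n) (R : ℝ) : volume (Metric.closedBall x R) ≠ ⊤ :=
  measure_closedBall_lt_top.ne

lemma vol_cb {n : ℕ} (x : En n) {R : ℝ} (hR : 0 ≤ R) : volume (Metric.closedBall x R) =
    ENNReal.ofReal (R ^ n) * volume (Metric.closedBall (0 : En n) 1) := by
  rw [Measure.addHaar_closedBall' _ _ hR]; simp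

lemma hlM_weak {n : ℕ} (hn : 1 ≤ n) (g : En n → ℝ≥0∞) (l : ℝ≥0∞) :
    l * volume {x | l < hlM g x} ≤ 5 ^ n * ∫⁻ y, g y := by
  rcases eq_or_ne l 0 with rfl | hl0
  · simp
  rcases eq_or_ne l ⊤ with rfl | hlt
  · simp
  rcases eq_or_ne (∫⁻ y, g y) ⊤ with hI | hI
  · rw [hI, ENNReal.mul_top (by positivity)]; exact le_top
  set S := {x | l < hlM g x}
  have hS : ∀ x : S, ∃ R : ℝ, 0 < R ∧ l * volume (Metric.closedBall (x:En n) R) ≤ ∫⁻ y in Metric.closedBall (x:En n) R, g y := by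
    rintro ⟨x, hx⟩
    have hx' : l < ⨆ (R : ℝ) (_ : 0 < R), (∫⁻ y in Metric.closedBall x R, g y) / volume (Metric.closedBall x R) := hx
    simp only [lt_iSup_iff] at hx'
    obtain ⟨R, hR, h⟩ := hx'
    refine ⟨R, hR, ?_⟩
    rw [← ENNReal.le_div_iff_mul_le (Or.inl (vol_cb_pos x hR)) (Or.inl (vol_cb_fin x R))]
    exact h.le
  choose R hR0 hR using hS
  set V := volume (Metric.closedBall (0 : En n) 1) with hV
  have hV0 : V ≠ 0 := vol_cb_pos 0 one_pos
  have hVt : V ≠ ⊤ := vol_cb_fin 0 1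
  set B := (∫⁻ y, g y) / l / V
  have hB : B ≠ ⊤ := ENNReal.div_ne_top (ENNReal.div_ne_top hI hl0) hV0
  have hRb : ∀ a ∈ (univ : Set S), R a ≤ max 1 B.toReal := by
    intro a _
    by_cases h1 : R a ≤ 1
    · exact h1.trans (le_max_left _ _)
    push Not at h1
    refine le_trans ?_ (le_max_right _ _)
    have h2 : R a ≤ R a ^ n := le_self_pow₀ h1.le (by omega)
    refine h2.trans ?_
    rw [← ENNReal.ofReal_le_iff_le_toReal hB]
    rw [ENNReal.le_div_iff_mul_le (Or.inl hV0) (Or.inl hVt), ENNReal.le_div_iff_mul_le (Or.inl hl0) (Or.inl hlt), mul_comm]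
    rw [← vol_cb a.1 (hR0 a).le]
    exact (hR a).trans (setLIntegral_le_lintegral _ _)
  obtain ⟨u, -, hu1, hu2⟩ := Vitali.exists_disjoint_subfamily_covering_enlargement_closedBall
    (univ : Set S) (fun a => (a:En n)) R _ hRb 5 (by norm_num)
  have huc : u.Countable := hu1.countable_of_nonempty_interior (fun i _ => by
    refine ⟨i, ?_⟩
    exact interior_mono Metric.ball_subset_closedBall (by rw [Metric.isOpen_ball.interior_eq]; exact Metric.mem_ball_self (hR0 i)))
  have hcov : S ⊆ ⋃ b ∈ u, Metric.closedBall (b:En n) (5 * R b) := by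
    intro x hx
    obtain ⟨b, hb, hsub⟩ := hu2 ⟨x, hx⟩ trivial
    exact mem_biUnion hb (hsub (Metric.mem_closedBall_self (hR0 _).le))
  calc l * volume S ≤ l * ∑' b : u, volume (Metric.closedBall ((b:S):En n) (5 * R b)) := by
        gcongr
        exact (measure_mono hcov).trans (measure_biUnion_le _ huc _)
    _ = 5 ^ n * ∑' b : u, l * volume (Metric.closedBall ((b:S):En n) (R b)) := by
        rw [← ENNReal.tsum_mul_left, ← ENNReal.tsum_mul_left]
        congr 1; ext b
        rw [vol_cb _ (by have := hR0 b; positivity), vol_cb _ (hR0 b).le, mul_pow, ENNReal.ofReal_mul (by positivity),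
          ENNReal.ofReal_pow (by norm_num)]
        simp only [ENNReal.ofReal_ofNat]
        ring
    _ ≤ 5 ^ n * ∑' b : u, ∫⁻ y in Metric.closedBall ((b:S):En n) (R b), g y := by
        gcongr with b
        exact hR b
    _ = 5 ^ n * ∫⁻ y in ⋃ b ∈ u, Metric.closedBall ((b:S):En n) (R b), g y := by
        rw [lintegral_biUnion huc (fun i _ => Metric.isClosed_closedBall.measurableSet) hu1]
    _ ≤ _ := by
        gcongr
        exact Measure.restrict_le_self

lemma hlM_add_le {n : ℕ} (g h : En n → ℝ≥0∞) (hg : Measurable g) (x : En n) :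
    hlM (fun y => g y + h y) x ≤ hlM g x + hlM h x := by
  refine iSup₂_le fun R hR => ?_
  rw [lintegral_add_left hg, ENNReal.add_div]
  exact add_le_add (le_hlM g x R hR) (le_hlM h x R hR)

lemma hlM_mono {n : ℕ} {g h : En n → ℝ≥0∞} (hgh : ∀ y, g y ≤ h y) (x : En n) : hlM g x ≤ hlM h x := by
  refine iSup₂_le fun R hR => le_trans ?_ (le_hlM h x R hR)
  gcongr; exact hgh _

lemma hlM_const_le {n : ℕ} (c : ℝ≥0∞) (x : En n) : hlM (fun _ => c) x ≤ c := by
  refine iSup₂_le fun R hR => ?_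
  rw [lintegral_const, Measure.restrict_apply_univ, mul_div_assoc, ENNReal.div_self (vol_cb_pos x hR) (vol_cb_fin x R), mul_one]

lemma hlM_weak' {n : ℕ} (hn : 1 ≤ n) (g : En n → ℝ≥0∞) (hg : Measurable g) (l : ℝ≥0∞) :
    l * volume {x | 2 * l < hlM g x} ≤ 5 ^ n * ∫⁻ y, (if l < g y then g y else 0) := by
  rcases eq_or_ne l ⊤ with rfl | hlt
  · simp
  refine le_trans ?_ (hlM_weak hn _ l)
  refine mul_le_mul' le_rfl (measure_mono fun x hx => ?_)
  have h1 : Measurable (fun y => if l < g y then g y else 0) := Measurable.ite (measurableSet_lt measurable_const hg) hg measurable_const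
  have h2 : hlM g x ≤ hlM (fun y => (if l < g y then g y else 0)) x + hlM (fun _ => l) x := 
    le_trans (hlM_mono (h := fun y => (if l < g y then g y else 0) + l) (fun y => by
      split_ifs with h
      · exact le_self_add
      · simpa using h) _) (hlM_add_le _ _ h1 _)
  have h3 := lt_of_lt_of_le hx (h2.trans (add_le_add_right (hlM_const_le l _) _))
  rw [two_mul] at h3
  exact lt_of_add_lt_add_right h3

lemma hlM_L2 {n : ℕ} (hn : 1 ≤ n) (g : En n → ℝ≥0∞) (hg : Measurable g) :
    ∫⁻ x, (hlM g x) ^ 2 ≤ 32 * 5 ^ n * ∫⁻ x, (g x) ^ 2 := by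
  set T : ℤ → Set (En n) := fun k => toMeasurable volume {x | 2 * (2:ℝ≥0∞) ^ k < hlM g x}
  have hz : ∀ k : ℤ, ((2:ℝ≥0∞) ^ k) ≠ 0 ∧ ((2:ℝ≥0∞) ^ k) ≠ ⊤ := fun k =>
    ⟨(ENNReal.zpow_pos (by norm_num) (by norm_num) k).ne', (ENNReal.zpow_lt_top (by norm_num) (by norm_num) k).ne⟩
  have hpt : ∀ x, (hlM g x) ^ 2 ≤ ∑' k : ℤ, (T k).indicator (fun _ => 16 * ((2:ℝ≥0∞) ^ k * 2 ^ k)) x := by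
    intro x
    have key : ∀ k : ℤ, 2 * (2:ℝ≥0∞) ^ k < hlM g x → 16 * ((2:ℝ≥0∞) ^ k * 2 ^ k) ≤ ∑' k : ℤ, (T k).indicator (fun _ => 16 * ((2:ℝ≥0∞) ^ k * 2 ^ k)) x := by
      intro k hk
      refine le_trans ?_ (ENNReal.le_tsum k)
      rw [indicator_of_mem]
      exact subset_toMeasurable _ _ hk
    rcases eq_or_ne (hlM g x) 0 with h0 | h0
    · simp [h0]
    rcases eq_or_ne (hlM g x) ⊤ with ht | ht
    · rw [ht] at key ⊢
      refine le_trans le_top (top_le_iff.2 ?_).ge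
      refine ENNReal.eq_top_of_forall_nnreal_le fun r => ?_
      obtain ⟨m, hm⟩ := pow_unbounded_of_one_lt r (show (1:ℝ≥0) < 2 by norm_num)
      have hm' : (r:ℝ≥0∞) ≤ 2 ^ m := by exact_mod_cast hm.le
      refine (hm'.trans ?_).trans (key m (lt_top_iff_ne_top.2 (ENNReal.mul_ne_top (by norm_num) (hz m).2)))
      rw [zpow_natCast]
      calc (2:ℝ≥0∞) ^ m = 1 * (1 * 2 ^ m) := by simp
        _ ≤ _ := by
          gcongr
          · norm_num
          · exact one_le_pow₀ (by norm_num)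
    · obtain ⟨m, hm1, hm2⟩ := ENNReal.exists_mem_Ioc_zpow h0 ht ENNReal.one_lt_two ENNReal.ofNat_ne_top
      refine le_trans ?_ (key (m - 1) ?_)
      · calc (hlM g x) ^ 2 ≤ (2 ^ (m+1)) ^ 2 := by gcongr
          _ = _ := by
            rw [show m + 1 = (m - 1) + 2 by ring, ENNReal.zpow_add (by norm_num) (by norm_num)]
            rw [show (2:ℝ≥0∞) ^ (2:ℤ) = 4 by rw [show (2:ℤ) = ((2:ℕ):ℤ) by rfl, zpow_natCast]; norm_num]
            ring
      · rw [show (2:ℝ≥0∞) * 2 ^ (m-1) = 2 ^ m by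
          conv_rhs => rw [show m = (m - 1) + 1 by ring, ENNReal.zpow_add (by norm_num) (by norm_num), zpow_one]
          rw [mul_comm]]
        exact hm1
  calc ∫⁻ x, (hlM g x) ^ 2 ≤ ∫⁻ x, ∑' k : ℤ, (T k).indicator (fun _ => 16 * ((2:ℝ≥0∞) ^ k * 2 ^ k)) x := lintegral_mono hpt
    _ = ∑' k : ℤ, 16 * ((2:ℝ≥0∞) ^ k * 2 ^ k) * volume {x | 2 * (2:ℝ≥0∞) ^ k < hlM g x} := by
      rw [lintegral_tsum]
      · congr 1; ext k
        rw [lintegral_indicator_const (measurableSet_toMeasurable _ _), measure_toMeasurable]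
      · intro k
        exact (measurable_const.indicator (measurableSet_toMeasurable _ _)).aemeasurable
    _ ≤ ∑' k : ℤ, 16 * 2 ^ k * (5 ^ n * ∫⁻ y, (if (2:ℝ≥0∞) ^ k < g y then g y else 0)) := by
      refine ENNReal.tsum_le_tsum fun k => ?_
      rw [← mul_assoc, mul_assoc (16 * _)]
      refine mul_le_mul' le_rfl ?_
      exact hlM_weak' hn g hg _
    _ = 16 * 5 ^ n * ∫⁻ y, ∑' k : ℤ, (if (2:ℝ≥0∞) ^ k < g y then 2 ^ k else 0) * g y := by
      rw [lintegral_tsum, ← ENNReal.tsum_mul_left]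
      · congr 1; ext k
        rw [show (fun y => (if (2:ℝ≥0∞) ^ k < g y then (2:ℝ≥0∞) ^ k else 0) * g y) = fun y => 2 ^ k * (if (2:ℝ≥0∞) ^ k < g y then g y else 0) by
          ext y; split_ifs <;> simp]
        rw [lintegral_const_mul' _ _ (hz k).2]
        ring
      · intro k
        exact ((Measurable.ite (measurableSet_lt measurable_const hg) measurable_const measurable_const).mul hg).aemeasurable
    _ ≤ 16 * 5 ^ n * ∫⁻ y, 2 * (g y) ^ 2 := by
      gcongr with y
      rw [ENNReal.tsum_mul_right, pow_two, ← mul_assoc]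
      gcongr
      have := geom_tsum_int 1 one_ne_zero ENNReal.one_ne_top 1 1 one_pos le_rfl (g y)
      simp only [one_mul, ENNReal.rpow_one] at this
      refine this.trans (le_of_eq ?_)
      rw [ENNReal.rpow_neg_one, ENNReal.one_sub_inv_two, inv_inv]
    _ = _ := by
      rw [lintegral_const_mul' _ _ (by norm_num)]
      ring


/-- working form of global log-Holder continuity -/
def LH (n : ℕ) (s : En n → ℝ) (C si : ℝ) : Prop :=
  0 < C ∧ (∀ x y : En n, |s x - s y| ≤ C / Real.log (Real.exp 1 + 1 / ‖x - y‖)) ∧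
    (∀ x : En n, |s x - si| ≤ C / Real.log (Real.exp 1 + ‖x‖))

lemma one_le_log_e_add {a : ℝ} (ha : 0 ≤ a) : 1 ≤ Real.log (Real.exp 1 + a) := by
  rw [Real.le_log_iff_exp_le (by positivity)]; linarith

/-- the power `(1+|x|)^{-N}` -/
def hN {n : ℕ} (N : ℝ) (x : En n) : ℝ≥0∞ := ENNReal.ofReal ((1 + ‖x‖) ^ (-N))

lemma hN_meas {n : ℕ} (N : ℝ) : Measurable (hN N : En n → ℝ≥0∞) := by
  unfold hN; fun_prop

lemma lemL {n : ℕ} (N C : ℝ) (hN0 : 0 ≤ N) (hC : 0 < C) (x : En n) (a b : ℝ) (ha : 1 ≤ a)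
    (hb : 1 ≤ b) (hab : |a - b| ≤ C / Real.log (Real.exp 1 + ‖x‖)) (v : ℝ≥0∞) (hv : v ≤ 1) :
    v ^ a ≤ ENNReal.ofReal (Real.exp (N * C)) * v ^ b + hN N x := by
  have hvt : v ≠ ⊤ := ne_top_of_le_ne_top ENNReal.one_ne_top hv
  obtain ⟨w, rfl⟩ : ∃ w : ℝ≥0, v = w := ⟨v.toNNReal, (ENNReal.coe_toNNReal hvt).symm⟩
  have hw1 : (w:ℝ) ≤ 1 := by exact_mod_cast hv
  rw [hN]
  have e1 : (w : ℝ≥0∞) = ENNReal.ofReal (w:ℝ) := by simp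
  rw [e1, ENNReal.ofReal_rpow_of_nonneg (NNReal.coe_nonneg w) (by linarith), ENNReal.ofReal_rpow_of_nonneg (NNReal.coe_nonneg w) (by linarith),
    ← ENNReal.ofReal_mul (by positivity)]
  by_cases hcase : (w:ℝ) ≤ (1 + ‖x‖) ^ (-N)
  · refine le_trans ?_ le_add_self
    apply ENNReal.ofReal_le_ofReal
    refine le_trans ?_ hcase
    conv_rhs => rw [← Real.rpow_one (w:ℝ)]
    exact Real.rpow_le_rpow_of_exponent_ge' w.2 hw1 (by norm_num) ha
  · refine le_trans ?_ le_self_add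
    apply ENNReal.ofReal_le_ofReal
    push Not at hcase
    have hx0 : 0 < (1 + ‖x‖) ^ (-N) := by positivity
    have hw0 : 0 < (w:ℝ) := hx0.trans hcase
    have hl1 := one_le_log_e_add (norm_nonneg x)
    have : (w:ℝ) ^ a = w ^ (a - b) * w ^ b := by rw [← Real.rpow_add hw0]; ring_nf
    rw [this]
    gcongr
    calc (w:ℝ) ^ (a-b) ≤ w ^ (-|a-b|) := Real.rpow_le_rpow_of_exponent_ge hw0 hw1 (neg_abs_le _)
      _ ≤ w ^ (-(C / Real.log (Real.exp 1 + ‖x‖))) := Real.rpow_le_rpow_of_exponent_ge hw0 hw1 (by linarith)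
      _ ≤ ((1 + ‖x‖) ^ (-N)) ^ (-(C / Real.log (Real.exp 1 + ‖x‖))) := by
        apply Real.rpow_le_rpow_of_nonpos hx0 hcase.le
        have : 0 ≤ C / Real.log (Real.exp 1 + ‖x‖) := by positivity
        linarith
      _ = (1 + ‖x‖) ^ (N * C / Real.log (Real.exp 1 + ‖x‖)) := by
        rw [← Real.rpow_mul (by positivity)]; ring_nf
      _ ≤ (Real.exp 1 + ‖x‖) ^ (N * C / Real.log (Real.exp 1 + ‖x‖)) := by
        have : 1 ≤ Real.exp 1 := Real.one_le_exp (by norm_num)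
        gcongr
      _ = _ := by
        rw [Real.rpow_def_of_pos (by positivity)]
        congr 1
        field_simp

lemma avg_jensen {n : ℕ} (g : En n → ℝ≥0∞) (hg : Measurable g) (x : En n) (R : ℝ) (hR : 0 < R)
    (τ : ℝ) (hτ : 1 ≤ τ) :
    ((∫⁻ y in Metric.closedBall x R, g y) / volume (Metric.closedBall x R)) ^ τ ≤
      (∫⁻ y in Metric.closedBall x R, (g y) ^ τ) / volume (Metric.closedBall x R) := by
  set B := Metric.closedBall x R
  have hB0 := vol_cb_pos x hR
  have hBt := vol_cb_fin x R
  set μ := (volume B)⁻¹ • (volume.restrict B)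
  have : IsProbabilityMeasure μ := ⟨by
    simp only [μ, Measure.smul_apply, Measure.restrict_apply_univ, smul_eq_mul]
    exact ENNReal.inv_mul_cancel hB0 hBt⟩
  have := eLpNorm'_le_eLpNorm'_of_exponent_le (p := 1) (q := τ) (by norm_num) hτ μ (f := g) hg.aestronglyMeasurable
  simp only [eLpNorm', enorm_eq_self, ENNReal.rpow_one, μ, lintegral_smul_measure, smul_eq_mul, one_div, inv_one] at this
  rw [ENNReal.le_rpow_inv_iff (by linarith)] at this
  rw [ENNReal.div_eq_inv_mul, ENNReal.div_eq_inv_mul]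
  exact this

/-- large part -/
lemma diening_large {n : ℕ} (s : En n → ℝ) (hsm : Measurable s) (C si : ℝ) (hs : LH n s C si)
    (hs1 : ∀ x, 1 ≤ s x) :
    ∃ K : ℝ≥0, ∀ g : En n → ℝ≥0∞, Measurable g → (∀ y, g y = 0 ∨ 1 < g y) →
      (∫⁻ y, (g y) ^ (2 * s y)) ≤ 1 → ∀ (x : En n) (R : ℝ), 0 < R →
      ((∫⁻ y in Metric.closedBall x R, g y) / volume (Metric.closedBall x R)) ^ (s x) ≤
      K * hlM (fun y => (g y) ^ (s y)) x := by
  set V := volume (Metric.closedBall (0 : En n) 1) with hV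
  have hV0 : V ≠ 0 := vol_cb_pos 0 one_pos
  have hVt : V ≠ ⊤ := vol_cb_fin 0 1
  set W : ℝ≥0∞ := max 1 V⁻¹ with hW
  have hWt : W ≠ ⊤ := by simp [hW, hV0]
  have hW1 : 1 ≤ W := le_max_left _ _
  set KK : ℝ≥0∞ := W ^ C * (ENNReal.ofReal (Real.exp C)) ^ n with hKK
  have hKKt : KK ≠ ⊤ := ENNReal.mul_ne_top (ENNReal.rpow_ne_top_of_nonneg hs.1.le hWt) (by simp)
  have hKK1 : 1 ≤ KK := by
    have h1 : 1 ≤ W ^ C := ENNReal.one_le_rpow hW1 hs.1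
    have h2 : 1 ≤ (ENNReal.ofReal (Real.exp C)) ^ n := one_le_pow₀ (by simp [hs.1.le])
    calc (1:ℝ≥0∞) = 1 * 1 := by simp
      _ ≤ _ := mul_le_mul' h1 h2
  refine ⟨KK.toNNReal, fun g hg hg1 hgi x R hR => ?_⟩
  rw [ENNReal.coe_toNNReal hKKt]
  set B := Metric.closedBall x R with hBdef
  have hB0 := vol_cb_pos x hR
  have hBt := vol_cb_fin x R
  set a := (∫⁻ y in B, g y) / volume B with ha
  set ω := C / Real.log (Real.exp 1 + 1 / R) with hω
  have hlog1 : 1 ≤ Real.log (Real.exp 1 + 1 / R) := one_le_log_e_add (by positivity)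
  have hω0 : 0 ≤ ω := by have := hs.1; positivity
  have hωC : ω ≤ C := div_le_self hs.1.le hlog1
  set τ := max 1 (s x - ω) with hτ
  have hτ1 : 1 ≤ τ := le_max_left _ _
  have hτx : τ ≤ s x := max_le (hs1 x) (by linarith)
  have hτω : s x - τ ≤ ω := by have : s x - ω ≤ τ := le_max_right _ _; linarith
  have hτy : ∀ y ∈ B, τ ≤ s y := by
    intro y hy
    refine max_le (hs1 y) ?_
    rcases eq_or_ne x y with rfl | hxy
    · linarith
    have h1 := hs.2.1 x y
    have h2 : C / Real.log (Real.exp 1 + 1 / ‖x - y‖) ≤ ω := by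
      have h3 : 0 < ‖x - y‖ := norm_pos_iff.2 (sub_ne_zero.2 hxy)
      have h4 : ‖x - y‖ ≤ R := by rw [hBdef, Metric.mem_closedBall, dist_comm, dist_eq_norm] at hy; exact hy
      apply div_le_div_of_nonneg_left hs.1.le (by linarith)
      apply Real.log_le_log (by positivity)
      gcongr
    have := (abs_le.1 (h1.trans h2)).2
    linarith
  set I := (∫⁻ y in B, (g y) ^ (s y)) / volume B with hI
  have hIM : I ≤ hlM (fun y => (g y) ^ (s y)) x := le_hlM _ x R hR
  have haI : a ^ τ ≤ I := by
    refine (avg_jensen g hg x R hR τ hτ1).trans ?_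
    rw [hI]
    gcongr ?_ / _
    refine setLIntegral_mono (hg.pow hsm) fun y hy => ?_
    rcases hg1 y with h | h
    · rw [h, ENNReal.zero_rpow_of_pos (by linarith)]; exact zero_le
    · exact ENNReal.rpow_le_rpow_of_exponent_le h.le (hτy y hy)
  rcases le_total a 1 with ha1 | ha1
  · calc a ^ s x ≤ a ^ τ := ENNReal.rpow_le_rpow_of_exponent_ge ha1 hτx
      _ ≤ 1 * I := by rw [one_mul]; exact haI
      _ ≤ _ := mul_le_mul' hKK1 hIM
  · have hIB : I ≤ (volume B)⁻¹ := by
      rw [hI, ENNReal.div_eq_inv_mul]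
      conv_rhs => rw [← mul_one (volume B)⁻¹]
      gcongr
      refine le_trans ?_ hgi
      refine (setLIntegral_le_lintegral _ _).trans (lintegral_mono fun y => ?_)
      rcases hg1 y with h | h
      · simp only [h]; rw [ENNReal.zero_rpow_of_pos (by linarith [hs1 y])]; exact zero_le
      · exact ENNReal.rpow_le_rpow_of_exponent_le h.le (by linarith [hs1 y])
    have haB : a ≤ (volume B)⁻¹ := by
      calc a = a ^ (1:ℝ) := by simp
        _ ≤ a ^ τ := ENNReal.rpow_le_rpow_of_exponent_le ha1 hτ1
        _ ≤ _ := haI.trans hIB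
    have haB2 : a ≤ W * (ENNReal.ofReal (Real.exp 1 + 1 / R)) ^ n := by
      refine haB.trans ?_
      rw [hBdef, vol_cb x hR.le, ENNReal.mul_inv (Or.inr hVt) (Or.inr hV0), mul_comm]
      refine mul_le_mul' (le_max_right _ _) ?_
      rw [← ENNReal.ofReal_inv_of_pos (by positivity), ← ENNReal.ofReal_pow (by positivity)]
      apply ENNReal.ofReal_le_ofReal
      rw [← inv_pow]
      gcongr
      rw [one_div]
      linarith [Real.exp_pos 1]
    have hat : a ≠ ⊤ := ne_top_of_le_ne_top (ENNReal.mul_ne_top hWt (by simp)) haB2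
    have haω : a ^ ω ≤ KK := by
      calc a ^ ω ≤ (W * (ENNReal.ofReal (Real.exp 1 + 1 / R)) ^ n) ^ ω := by gcongr
        _ = W ^ ω * ((ENNReal.ofReal (Real.exp 1 + 1 / R)) ^ ω) ^ n := by
          rw [ENNReal.mul_rpow_of_nonneg _ _ hω0]
          congr 1
          rw [← ENNReal.rpow_natCast, ← ENNReal.rpow_mul, mul_comm, ENNReal.rpow_mul, ENNReal.rpow_natCast]
        _ ≤ _ := by
          rw [hKK]
          gcongr ?_ * ?_ ^ n
          · exact ENNReal.rpow_le_rpow_of_exponent_le hW1 hωC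
          · rw [ENNReal.ofReal_rpow_of_pos (by positivity)]
            apply ENNReal.ofReal_le_ofReal
            rw [Real.rpow_def_of_pos (by positivity), hω]
            rw [mul_div_cancel₀ _ (by linarith)]
    calc a ^ s x = a ^ (s x - τ) * a ^ τ := by
          rw [← ENNReal.rpow_add _ _ (by positivity) hat]; congr 1; ring
      _ ≤ a ^ ω * a ^ τ := by
          gcongr ?_ * _
          exact ENNReal.rpow_le_rpow_of_exponent_le ha1 hτω
      _ ≤ KK * I := mul_le_mul' haω haI
      _ ≤ _ := mul_le_mul' le_rfl hIM

/-- small part -/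
lemma diening_small {n : ℕ} (N : ℝ) (hN0 : 0 ≤ N) (s : En n → ℝ) (C si : ℝ) (hs : LH n s C si)
    (hs1 : ∀ x, 1 ≤ s x) (hsi : 1 ≤ si) (g : En n → ℝ≥0∞) (hg : Measurable g) (hg1 : ∀ y, g y ≤ 1)
    (x : En n) (R : ℝ) (hR : 0 < R) :
      ((∫⁻ y in Metric.closedBall x R, g y) / volume (Metric.closedBall x R)) ^ (s x) ≤
      ENNReal.ofReal (Real.exp (N * C)) * hlM (fun y => ENNReal.ofReal (Real.exp (N * C)) * (g y) ^ (s y) + hN N y) x + hN N x := by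
  have hb : (∫⁻ y in Metric.closedBall x R, g y) / volume (Metric.closedBall x R) ≤ 1 :=
    (le_hlM g x R hR).trans ((hlM_mono hg1 x).trans (hlM_const_le 1 x))
  refine (lemL N C hN0 hs.1 x (s x) si (hs1 x) hsi (hs.2.2 x) _ hb).trans ?_
  gcongr
  refine (avg_jensen g hg x R hR si hsi).trans (le_trans ?_ (le_hlM _ x R hR))
  gcongr with y
  refine lemL N C hN0 hs.1 y si (s y) hsi (hs1 y) ?_ _ (hg1 y)
  rw [abs_sub_comm]; exact hs.2.2 y

lemma ennreal_add_sq_le (a b : ℝ≥0∞) : (a + b) ^ 2 ≤ 2 * (a ^ 2 + b ^ 2) := by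
  have := ENNReal.rpow_add_le_mul_rpow_add_rpow a b (p := 2) (by norm_num)
  norm_num at this
  exact this

lemma diening {n : ℕ} (hn : 1 ≤ n) (s : En n → ℝ) (hsm : Measurable s) (C si S : ℝ) (hs : LH n s C si)
    (hs1 : ∀ x, 1 ≤ s x) (hsS : ∀ x, s x ≤ S) (hsi : 1 ≤ si) :
    ∃ K : ℝ≥0, ∀ g : En n → ℝ≥0∞, Measurable g → (∫⁻ y, (g y) ^ (2 * s y)) ≤ 1 →
      ∫⁻ x, (hlM g x) ^ (2 * s x) ≤ K := by
  obtain ⟨K, hK⟩ := diening_large s hsm C si hs hs1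
  set N : ℝ := (n:ℝ) with hNdef
  have hN0 : 0 ≤ N := by positivity
  set E : ℝ≥0∞ := ENNReal.ofReal (Real.exp (N * C)) with hE
  have hE1 : 1 ≤ E := by
    rw [hE, ENNReal.one_le_ofReal]; apply Real.one_le_exp; have := hs.1; positivity
  have hEt : E ≠ ⊤ := ENNReal.ofReal_ne_top
  set H : ℝ≥0∞ := ∫⁻ x : En n, (hN N x) ^ 2 with hH
  have hHt : H ≠ ⊤ := by
    have := finite_integral_one_add_norm (E := En n) (μ := volume) (r := 2 * N) (by
      have : (1:ℝ) ≤ N := by rw [hNdef]; exact_mod_cast hn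
      rw [finrank_euclideanSpace_fin]; show N < 2 * N; linarith)
    refine ne_top_of_le_ne_top this.ne (lintegral_mono fun x => ?_)
    rw [hN, ← ENNReal.ofReal_pow (by positivity), ← Real.rpow_natCast, ← Real.rpow_mul (by positivity)]
    apply le_of_eq; congr 2; push_cast; ring
  set L : ℝ≥0∞ := 2 ^ S * (K + E + 1) with hL
  have hLt : L ≠ ⊤ := by
    refine ENNReal.mul_ne_top (ENNReal.rpow_ne_top_of_nonneg ((hs1 0).trans (hsS 0) |>.trans' (by norm_num)) (by norm_num)) ?_
    simp [hEt]
  set T : ℝ≥0∞ := L ^ 2 * (2 * ((32 * 5 ^ n) * (2 * (E ^ 2 + H)) + H)) with hT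
  have hTt : T ≠ ⊤ := by
    refine ENNReal.mul_ne_top (ENNReal.pow_ne_top hLt) (ENNReal.mul_ne_top (by norm_num) ?_)
    refine ENNReal.add_ne_top.2 ⟨ENNReal.mul_ne_top (ENNReal.mul_ne_top (by norm_num) (by simp)) (ENNReal.mul_ne_top (by norm_num) ?_), hHt⟩
    exact ENNReal.add_ne_top.2 ⟨ENNReal.pow_ne_top hEt, hHt⟩
  refine ⟨T.toNNReal, fun g hg hgi => ?_⟩
  rw [ENNReal.coe_toNNReal hTt]
  set G' : En n → ℝ≥0∞ := fun y => E * (g y) ^ (s y) + hN N y with hG'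
  have hGm : Measurable (fun y => (g y) ^ (s y)) := hg.pow hsm
  have hG'm : Measurable G' := (hGm.const_mul _).add (hN_meas N)
  have hpt : ∀ x, (hlM g x) ^ (s x) ≤ L * (hlM G' x + hN N x) := by
    intro x
    have hsx0 : 0 < s x := by linarith [hs1 x]
    rw [← ENNReal.le_rpow_inv_iff hsx0]
    refine iSup₂_le fun R hR => ?_
    rw [ENNReal.le_rpow_inv_iff hsx0]
    set g1 : En n → ℝ≥0∞ := fun y => if 1 < g y then g y else 0 with hg1
    set g2 : En n → ℝ≥0∞ := fun y => if 1 < g y then 0 else g y with hg2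
    have hset : MeasurableSet {y | 1 < g y} := measurableSet_lt measurable_const hg
    have hg1m : Measurable g1 := Measurable.ite hset hg measurable_const
    have hg2m : Measurable g2 := Measurable.ite hset measurable_const hg
    have hsum : ∀ y, g y = g1 y + g2 y := by
      intro y; simp only [hg1, hg2]; split_ifs <;> simp
    have hg1le : ∀ y, g1 y ≤ g y := fun y => by rw [hsum y]; exact le_self_add
    have hg2le : ∀ y, g2 y ≤ g y := fun y => by rw [hsum y]; exact le_add_self
    have hs0 : ∀ y, 0 ≤ s y := fun y => by linarith [hs1 y]
    have A1 := hK g1 hg1m (fun y => by simp only [hg1]; split_ifs with h; exacts [Or.inr h, Or.inl rfl])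
      (le_trans (lintegral_mono fun y => ENNReal.rpow_le_rpow (hg1le y) (by linarith [hs0 y])) hgi) x R hR
    have A2 := diening_small N hN0 s C si hs hs1 hsi g2 hg2m (fun y => by
      simp only [hg2]; split_ifs with h; exacts [zero_le, not_lt.1 h]) x R hR
    have B1 : hlM (fun y => (g1 y) ^ (s y)) x ≤ hlM G' x := hlM_mono (fun y => by
      simp only [hG']
      refine le_trans ?_ le_self_add
      rw [← one_mul (g1 y ^ s y)]
      exact mul_le_mul' hE1 (ENNReal.rpow_le_rpow (hg1le y) (hs0 y))) x
    have B2 : hlM (fun y => E * (g2 y) ^ (s y) + hN N y) x ≤ hlM G' x := hlM_mono (fun y => by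
      simp only [hG']
      gcongr
      · exact hs0 y
      · exact hg2le y) x
    have C1 : (∫⁻ y in Metric.closedBall x R, g y) / volume (Metric.closedBall x R) =
      (∫⁻ y in Metric.closedBall x R, g1 y) / volume (Metric.closedBall x R) + (∫⁻ y in Metric.closedBall x R, g2 y) / volume (Metric.closedBall x R) := by
      rw [← ENNReal.add_div, ← lintegral_add_left hg1m]
      simp_rw [← hsum]
    rw [C1]
    refine (ENNReal.rpow_add_le_mul_rpow_add_rpow _ _ (hs1 x)).trans ?_
    rw [hL, mul_assoc]
    refine mul_le_mul' (ENNReal.rpow_le_rpow_of_exponent_le (by norm_num) (by linarith [hsS x])) ?_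
    calc _ ≤ K * hlM G' x + (E * hlM G' x + hN N x) :=
          add_le_add (A1.trans (mul_le_mul' le_rfl B1)) (A2.trans (add_le_add (mul_le_mul' le_rfl B2) le_rfl))
      _ ≤ K * hlM G' x + (E * hlM G' x + hN N x) + (hlM G' x + (K + E) * hN N x) := le_self_add
      _ = _ := by ring
  have hG'2 : ∫⁻ x, (G' x) ^ 2 ≤ 2 * (E ^ 2 + H) := by
    calc ∫⁻ x, (G' x) ^ 2 ≤ ∫⁻ x, 2 * (E ^ 2 * (g x) ^ (2 * s x) + (hN N x) ^ 2) := by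
          refine lintegral_mono fun x => (ennreal_add_sq_le _ _).trans (le_of_eq ?_)
          rw [mul_pow, mul_comm 2 (s x), ENNReal.rpow_mul]
          norm_num
      _ = 2 * (E ^ 2 * (∫⁻ x, (g x) ^ (2 * s x)) + H) := by
          rw [lintegral_const_mul' _ _ (by norm_num), lintegral_add_right _ ((hN_meas N).pow_const 2), lintegral_const_mul' _ _ (ENNReal.pow_ne_top hEt)]
      _ ≤ 2 * (E ^ 2 * 1 + H) := by gcongr
      _ = _ := by rw [mul_one]
  calc ∫⁻ x, (hlM g x) ^ (2 * s x) ≤ ∫⁻ x, L ^ 2 * (2 * ((hlM G' x) ^ 2 + (hN N x) ^ 2)) := by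
        refine lintegral_mono fun x => ?_
        calc (hlM g x) ^ (2 * s x) = ((hlM g x) ^ (s x)) ^ 2 := by
              rw [mul_comm, ENNReal.rpow_mul]; norm_num
          _ ≤ (L * (hlM G' x + hN N x)) ^ 2 := by gcongr; exact hpt x
          _ = L ^ 2 * (hlM G' x + hN N x) ^ 2 := by ring
          _ ≤ _ := by gcongr; exact ennreal_add_sq_le _ _
    _ = L ^ 2 * (2 * ((∫⁻ x, (hlM G' x) ^ 2) + H)) := by
        rw [lintegral_const_mul' _ _ (ENNReal.pow_ne_top hLt), lintegral_const_mul' _ _ (by norm_num), lintegral_add_right _ ((hN_meas N).pow_const 2)]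
    _ ≤ T := by
        rw [hT]
        gcongr
        exact (hlM_L2 hn G' hG'm).trans (mul_le_mul' le_rfl hG'2)


lemma vol_b {n : ℕ} (hn : 1 ≤ n) (x : En n) (R : ℝ) : volume (Metric.ball x R) = volume (Metric.closedBall x R) := by
  have : Nontrivial (En n) := by
    have : Nonempty (Fin n) := ⟨⟨0, hn⟩⟩
    infer_instance
  exact (Measure.addHaar_closedBall_eq_addHaar_ball volume x R).symm

lemma infDist_bdd {n : ℕ} (hn : 1 ≤ n) (Ω : Set (En n)) (hfin : volume Ω ≠ ⊤) (y : En n) :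
    Metric.infDist y Ωᶜ ≤ max 1 (volume Ω / volume (Metric.closedBall (0 : En n) 1)).toReal := by
  set V := volume (Metric.closedBall (0 : En n) 1) with hV
  have hV0 : V ≠ 0 := vol_cb_pos 0 one_pos
  have hVt : V ≠ ⊤ := vol_cb_fin 0 1
  by_cases h1 : Metric.infDist y Ωᶜ ≤ 1
  · exact h1.trans (le_max_left _ _)
  push Not at h1
  refine le_trans ?_ (le_max_right _ _)
  have h2 := le_self_pow₀ h1.le (show n ≠ 0 by omega)
  refine h2.trans ?_
  rw [← ENNReal.ofReal_le_iff_le_toReal (ENNReal.div_ne_top hfin hV0)]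
  rw [ENNReal.le_div_iff_mul_le (Or.inl hV0) (Or.inl hVt), ← vol_cb y (by positivity), ← vol_b hn]
  exact measure_mono Metric.ball_infDist_compl_subset

lemma vitali_weight {n : ℕ} (hn : 1 ≤ n) (Ω : Set (En n)) (hΩ : IsOpen Ω) (hne : Ωᶜ.Nonempty)
    (hfin : volume Ω ≠ ⊤) (R : ℝ) (hR : 1 ≤ R) (w u : En n → ℝ≥0∞) (C : ℝ≥0∞)
    (h : ∀ y ∈ Ω, ∫⁻ x in Metric.closedBall y (5 * (R * Metric.infDist y Ωᶜ)), w x ≤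
      C * ∫⁻ x in Metric.ball y (Metric.infDist y Ωᶜ), u x) :
    ∫⁻ x in {x | ∃ y ∈ Ω, dist x y ≤ R * Metric.infDist y Ωᶜ}, w x ≤ C * ∫⁻ x in Ω, u x := by
  set d : En n → ℝ := fun y => Metric.infDist y Ωᶜ with hd
  have hdpos : ∀ y ∈ Ω, 0 < d y := fun y hy =>
    (hΩ.isClosed_compl.notMem_iff_infDist_pos hne).1 (by simpa using hy)
  have hRb : ∀ a ∈ Ω, R * d a ≤ R * max 1 (volume Ω / volume (Metric.closedBall (0 : En n) 1)).toReal := by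
    intro a _
    have := infDist_bdd hn Ω hfin a
    gcongr
  obtain ⟨u', hu0, hu1, hu2⟩ := Vitali.exists_disjoint_subfamily_covering_enlargement_closedBall
    Ω (fun a => a) (fun a => R * d a) _ hRb 5 (by norm_num)
  have huc : u'.Countable := hu1.countable_of_nonempty_interior (fun i hi => by
    refine ⟨i, ?_⟩
    exact interior_mono Metric.ball_subset_closedBall (by
      rw [Metric.isOpen_ball.interior_eq]; exact Metric.mem_ball_self (by have := hdpos i (hu0 hi); positivity)))
  have hsub : ∀ a ∈ Ω, Metric.ball a (d a) ⊆ Metric.closedBall a (R * d a) := fun a ha =>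
    Metric.ball_subset_closedBall.trans (Metric.closedBall_subset_closedBall (le_mul_of_one_le_left (hdpos a ha).le hR))
  have hcov : {x | ∃ y ∈ Ω, dist x y ≤ R * d y} ⊆ ⋃ b ∈ u', Metric.closedBall b (5 * (R * d b)) := by
    rintro x ⟨y, hy, hxy⟩
    obtain ⟨b, hb, hsub⟩ := hu2 y hy
    exact mem_biUnion hb (hsub hxy)
  calc ∫⁻ x in {x | ∃ y ∈ Ω, dist x y ≤ R * d y}, w x 
      ≤ ∫⁻ x in ⋃ b ∈ u', Metric.closedBall b (5 * (R * d b)), w x := lintegral_mono_set hcov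
    _ ≤ ∑' b : u', ∫⁻ x in Metric.closedBall (b:En n) (5 * (R * d b)), w x := by
        have := huc.to_subtype
        rw [biUnion_eq_iUnion]
        exact lintegral_iUnion_le _ _
    _ ≤ ∑' b : u', C * ∫⁻ x in Metric.ball (b:En n) (d b), u x :=
        ENNReal.tsum_le_tsum fun b => h b (hu0 b.2)
    _ = C * ∫⁻ x in ⋃ b ∈ u', Metric.ball b (d b), u x := by
        rw [ENNReal.tsum_mul_left, lintegral_biUnion huc (fun i _ => Metric.isOpen_ball.measurableSet)]
        intro i hi j hj hij
        exact (hu1 hi hj hij).mono (hsub i (hu0 hi)) (hsub j (hu0 hj))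
    _ ≤ _ := by
        gcongr
        exact iUnion₂_subset fun b _ => Metric.ball_infDist_compl_subset

/-- the decaying kernel -/
def Kk (n : ℕ) (a ε : ℝ) (z : En n) : ℝ≥0∞ := ENNReal.ofReal ((ε ^ n)⁻¹ * (1 + ‖z‖ / ε) ^ (-a))

lemma Kk_meas (n : ℕ) (a ε : ℝ) : Measurable (Kk n a ε) := by unfold Kk; fun_prop

lemma lintegral_comp_smul' {n : ℕ} (f : En n → ℝ≥0∞) (hf : Measurable f) (r : ℝ) (hr : 0 < r) :
    ∫⁻ z, f (r • z) = ENNReal.ofReal |(r ^ n)⁻¹| * ∫⁻ z, f z := by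
  have := Measure.map_addHaar_smul (volume : Measure (En n)) hr.ne'
  rw [finrank_euclideanSpace_fin] at this
  rw [← smul_eq_mul, ← lintegral_smul_measure, ← this, lintegral_map hf (measurable_const_smul r)]

lemma Kk_int {n : ℕ} (a : ℝ) (ε : ℝ) (hε : 0 < ε) :
    ∫⁻ z : En n, Kk n a ε z = ∫⁻ z : En n, Kk n a 1 z := by
  have := lintegral_comp_smul' (fun z => Kk n a 1 z) (Kk_meas n a 1) (ε⁻¹) (by positivity)
  have h2 : ∀ z : En n, Kk n a ε z = ENNReal.ofReal ((ε ^ n)⁻¹) * Kk n a 1 (ε⁻¹ • z) := by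
    intro z
    rw [Kk, Kk, ← ENNReal.ofReal_mul (by positivity), norm_smul]
    simp [abs_of_pos hε, div_eq_inv_mul]
  simp_rw [h2]
  rw [lintegral_const_mul' _ _ ENNReal.ofReal_ne_top, this, ← mul_assoc, ← ENNReal.ofReal_mul (by positivity)]
  have : ((ε ^ n)⁻¹ * |(ε⁻¹ ^ n)⁻¹|) = 1 := by
    rw [abs_of_pos (by positivity), inv_pow, inv_inv]; field_simp
  rw [this]; simp

lemma Kk_int_fin {n : ℕ} (a : ℝ) (ha : (n:ℝ) < a) : ∫⁻ z : En n, Kk n a 1 z ≠ ⊤ := by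
  have := finite_integral_one_add_norm (E := En n) (μ := volume) (r := a) (by rw [finrank_euclideanSpace_fin]; exact ha)
  simpa [Kk] using this.ne

/-- far kernel: d^{-n} (ρ/|z|)^a on |z| ≥ ρ -/
def Lk (n : ℕ) (a d ρ : ℝ) (z : En n) : ℝ≥0∞ :=
  if ρ ≤ ‖z‖ then ENNReal.ofReal ((d ^ n)⁻¹ * (ρ / ‖z‖) ^ a) else 0

lemma Lk_le {n : ℕ} (a d R : ℝ) (hd : 0 < d) (hR : 1 ≤ R) (ha : (n:ℝ) < a) (z : En n) :
    Lk n a d (R * d) z ≤ ENNReal.ofReal (2 ^ a * R ^ n) * Kk n a (R * d) z := by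
  unfold Lk
  split_ifs with h
  · rw [Kk, ← ENNReal.ofReal_mul (by positivity)]
    apply ENNReal.ofReal_le_ofReal
    have hρ : 0 < R * d := by positivity
    have hz : 0 < ‖z‖ := hρ.trans_le h
    have ha0 : 0 < a := lt_of_le_of_lt (by positivity) ha
    have h1 : (R * d / ‖z‖) ^ a ≤ 2 ^ a * (1 + ‖z‖ / (R * d)) ^ (-a) := by
      rw [Real.rpow_neg (by positivity), ← div_eq_mul_inv, ← Real.div_rpow (by norm_num) (by positivity)]
      apply Real.rpow_le_rpow (by positivity) _ ha0.le
      rw [div_le_div_iff₀ hz (by positivity)]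
      field_simp
      linarith
    calc (d ^ n)⁻¹ * (R * d / ‖z‖) ^ a ≤ (d ^ n)⁻¹ * (2 ^ a * (1 + ‖z‖ / (R * d)) ^ (-a)) := by gcongr
      _ = _ := by
        rw [mul_pow]; field_simp
  · exact zero_le

lemma Lk_int {n : ℕ} (a d R : ℝ) (hd : 0 < d) (hR : 1 ≤ R) (ha : (n:ℝ) < a) :
    ∫⁻ z : En n, Lk n a d (R * d) z ≤ ENNReal.ofReal (2 ^ a * R ^ n) * ∫⁻ z : En n, Kk n a 1 z := by
  rw [← Kk_int a (R * d) (by positivity), ← lintegral_const_mul' _ _ ENNReal.ofReal_ne_top]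
  exact lintegral_mono fun z => Lk_le a d R hd hR ha z

/-- K_ε ≤ far kernel -/
lemma Kk_le_Lk {n : ℕ} (a d ε R : ℝ) (hε : 0 < ε) (hεd : ε ≤ d) (hR : 1 ≤ R) (ha : (n:ℝ) < a) (z : En n)
    (hz : R * d ≤ ‖z‖) : ENNReal.ofReal (R ^ a) * Kk n a ε z ≤ Lk n a d (R * d) z := by
  have hd : 0 < d := hε.trans_le hεd
  have hz0 : 0 < ‖z‖ := lt_of_lt_of_le (by positivity) hz
  rw [Lk, if_pos hz, Kk, ← ENNReal.ofReal_mul (by positivity)]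
  apply ENNReal.ofReal_le_ofReal
  have ha0 : 0 < a := lt_of_le_of_lt (by positivity) ha
  rw [mul_div_assoc, Real.mul_rpow (by positivity) (by positivity)]
  have key : (ε ^ n)⁻¹ * (1 + ‖z‖ / ε) ^ (-a) ≤ (d ^ n)⁻¹ * (d / ‖z‖) ^ a := by
    calc (ε ^ n)⁻¹ * (1 + ‖z‖ / ε) ^ (-a) ≤ (ε ^ n)⁻¹ * (‖z‖ / ε) ^ (-a) := by
          gcongr ?_ * ?_
          exact Real.rpow_le_rpow_of_nonpos (by positivity) (by linarith) (by linarith)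
      _ = ε ^ (a - n) * ‖z‖ ^ (-a) := by
          rw [Real.div_rpow (by positivity) (by positivity), Real.rpow_sub hε, Real.rpow_natCast, Real.rpow_neg hε.le]
          field_simp
      _ ≤ d ^ (a - n) * ‖z‖ ^ (-a) := by
          gcongr
      _ = _ := by
          rw [Real.div_rpow (by positivity) (by positivity), Real.rpow_sub hd, Real.rpow_natCast, Real.rpow_neg hz0.le]
          field_simp
  calc R ^ a * ((ε ^ n)⁻¹ * (1 + ‖z‖ / ε) ^ (-a)) ≤ R ^ a * ((d ^ n)⁻¹ * (d / ‖z‖) ^ a) := by gcongr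
    _ = _ := by ring


/-- level sets -/
def lev {n : ℕ} (A : En n → ℝ≥0∞) (β : ℝ) (k : ℕ) : Set (En n) := {x | ENNReal.ofReal β * 2 ^ (k:ℤ) < A x}

/-- distance to complement of level set -/
def dlev {n : ℕ} (A : En n → ℝ≥0∞) (β : ℝ) (k : ℕ) (y : En n) : ℝ := Metric.infDist y (lev A β k)ᶜ

/-- dilation -/
def Rk (a : ℝ) (k : ℕ) : ℝ := ((2:ℝ) ^ k) ^ (1 / a)

lemma Rk_ge (a : ℝ) (ha : 0 < a) (k : ℕ) : 1 ≤ Rk a k := 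
  Real.one_le_rpow (one_le_pow₀ (by norm_num)) (by positivity)

lemma Rk_pow (a : ℝ) (ha : 0 < a) (k : ℕ) : Rk a k ^ a = 2 ^ k := by
  rw [Rk, ← Real.rpow_mul (by positivity), one_div_mul_cancel ha.ne', Real.rpow_one]

lemma weak_abstract {n : ℕ} (hn : 1 ≤ n) (a : ℝ) (ha : (n:ℝ) < a) (A : En n → ℝ≥0∞) (hA : LowerSemicontinuous A)
    (β : ℝ) (hβ : 0 < β) (hne : ∀ k, (lev A β k)ᶜ.Nonempty) (hfin : ∀ k, volume (lev A β k) ≠ ⊤)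
    (F : ℝ → En n → ℝ≥0∞) (hFt : ∀ ε y, F ε y ≠ ⊤)
    (hFA : ∀ ε, 0 < ε → ∀ x y, dist x y ≤ ε → F ε y ≤ A x)
    (w : En n → ℝ≥0∞) (hw : Measurable w) (u : ℕ → En n → ℝ≥0∞) (hu : ∀ k, Measurable (u k)) (Ca Cb : ℝ≥0∞)
    (hCb : Cb ≠ ⊤)
    (h1 : ∀ k, ∀ y ∈ lev A β k, ∫⁻ x in Metric.closedBall y (5 * (Rk a k * dlev A β k y)), w x ≤
      Ca * ∫⁻ x in Metric.ball y (dlev A β k y), u k x)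
    (h2 : ∀ k, ∀ y ∈ lev A β k, ∫⁻ x, Lk n a (dlev A β k y) (Rk a k * dlev A β k y) (x - y) * w x ≤ Cb * u k y) :
    ∫⁻ x in {x | ((∫⁻ z : En n, Kk n a 1 z) + 2) * ENNReal.ofReal β < ⨆ (ε : ℝ) (_ : 0 < ε), ∫⁻ y, F ε y * Kk n a ε (x - y)}, w x
      ≤ (Ca + Cb) * ∑' k : ℕ, ∫⁻ y in lev A β k, u k y := by
  have ha0 : 0 < a := lt_of_le_of_lt (by positivity) ha
  have hopen : ∀ k, IsOpen (lev A β k) := fun k => hA.isOpen_preimage _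
  have hdpos : ∀ k, ∀ y ∈ lev A β k, 0 < dlev A β k y := fun k y hy =>
    ((hopen k).isClosed_compl.notMem_iff_infDist_pos (hne k)).1 (by simpa using hy)
  set CK := ∫⁻ z : En n, Kk n a 1 z with hCK
  have hCKt : CK ≠ ⊤ := Kk_int_fin a ha
  set LL : ℕ → En n → En n → ℝ≥0∞ := fun k x y => Lk n a (dlev A β k y) (Rk a k * dlev A β k y) (x - y) with hLL
  have hdm : ∀ k, Measurable (dlev A β k) := fun k => (Metric.continuous_infDist_pt _).measurable
  have hLm : ∀ k, Measurable (Function.uncurry (LL k)) := by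
    intro k
    simp only [hLL, Lk, Function.uncurry_def]
    have m1 : Measurable (fun q : En n × En n => dlev A β k q.2) := (hdm k).comp measurable_snd
    have m2 : Measurable (fun q : En n × En n => ‖q.1 - q.2‖) := (measurable_fst.sub measurable_snd).norm
    refine Measurable.ite (measurableSet_le (m1.const_mul _) m2) ?_ measurable_const
    exact (((m1.pow_const n).inv).mul (((m1.const_mul _).div m2).pow_const a)).ennreal_ofReal
  set J : En n → ℝ≥0∞ := fun x => ∑' k : ℕ, ∫⁻ y in lev A β k, LL k x y with hJ
  have hJm' : ∀ k, Measurable fun x => ∫⁻ y in lev A β k, LL k x y := fun k => (hLm k).lintegral_prod_right'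
  have hJm : Measurable J := Measurable.tsum hJm'
  set Nk : ℕ → Set (En n) := fun k => {x | ∃ y ∈ lev A β k, dist x y ≤ Rk a k * dlev A β k y} with hNk
  -- main inclusion
  have hincl : {x | (CK + 2) * ENNReal.ofReal β < ⨆ (ε : ℝ) (_ : 0 < ε), ∫⁻ y, F ε y * Kk n a ε (x - y)} ⊆
      (⋃ k, Nk k) ∪ {x | 1 ≤ J x} := by
    intro x hx
    by_cases hxN : x ∈ ⋃ k, Nk k
    · exact Or.inl hxN
    right
    have hxN' : ∀ k, ∀ y ∈ lev A β k, Rk a k * dlev A β k y ≤ ‖x - y‖ := by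
      intro k y hy
      by_contra hcon
      apply hxN
      rw [mem_iUnion]
      refine ⟨k, y, hy, ?_⟩
      rw [dist_eq_norm]; linarith
    simp only [mem_ofPred_eq, lt_iSup_iff] at hx
    obtain ⟨ε, hε, hx⟩ := hx
    have hpt : ∀ y, F ε y * Kk n a ε (x - y) ≤ ENNReal.ofReal β * Kk n a ε (x - y) +
        (2 * ENNReal.ofReal β) * ∑' k : ℕ, (lev A β k).indicator (LL k x) y := by
      intro y
      by_cases hF : F ε y ≤ ENNReal.ofReal β
      · exact (mul_le_mul' hF le_rfl).trans le_self_add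
      push Not at hF
      refine le_trans ?_ le_add_self
      have hβ0 : ENNReal.ofReal β ≠ 0 := by simpa using hβ
      have hq1 : 1 < F ε y / ENNReal.ofReal β := by
        rw [ENNReal.lt_div_iff_mul_lt (Or.inl hβ0) (Or.inl ENNReal.ofReal_ne_top)]; simpa using hF
      obtain ⟨m, hm1, hm2⟩ := ENNReal.exists_mem_Ioc_zpow (x := F ε y / ENNReal.ofReal β) (y := 2) (zero_lt_one.trans hq1).ne'
        (ENNReal.div_ne_top (hFt ε y) hβ0) ENNReal.one_lt_two ENNReal.ofNat_ne_top
      have hm0 : 0 ≤ m := by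
        by_contra hcon
        have : m + 1 ≤ 0 := by omega
        have h3 : (2:ℝ≥0∞) ^ (m+1) ≤ 2 ^ (0:ℤ) := ENNReal.zpow_le_of_le ENNReal.one_lt_two.le this
        rw [zpow_zero] at h3
        exact absurd (hq1.trans_le (hm2.trans h3)) (lt_irrefl _)
      obtain ⟨k, rfl⟩ := Int.eq_ofNat_of_zero_le hm0
      have hFk : ENNReal.ofReal β * 2 ^ (k:ℤ) < F ε y := by
        rw [ENNReal.lt_div_iff_mul_lt (Or.inl hβ0) (Or.inl ENNReal.ofReal_ne_top)] at hm1
        rwa [mul_comm]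
      have hFk2 : F ε y ≤ 2 * ENNReal.ofReal β * 2 ^ k := by
        rw [ENNReal.div_le_iff hβ0 ENNReal.ofReal_ne_top] at hm2
        refine hm2.trans (le_of_eq ?_)
        rw [ENNReal.zpow_add (by norm_num) (by norm_num), zpow_one, zpow_natCast]
        ring
      have hyk : y ∈ lev A β k := hFk.trans_le (hFA ε hε y y (by simp [hε.le]))
      have hεd : ε ≤ dlev A β k y := by
        rw [dlev, Metric.le_infDist (hne k)]
        intro z hz
        by_contra hcon
        push Not at hcon
        exact hz (hFk.trans_le (hFA ε hε z y (by rw [dist_comm]; exact hcon.le)))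
      have hkl := Kk_le_Lk a (dlev A β k y) ε (Rk a k) hε hεd (Rk_ge a ha0 k) ha (x - y) (hxN' k y hyk)
      rw [Rk_pow a ha0] at hkl
      calc F ε y * Kk n a ε (x - y) ≤ (2 * ENNReal.ofReal β * 2 ^ k) * Kk n a ε (x - y) := by gcongr
        _ = 2 * ENNReal.ofReal β * (ENNReal.ofReal (2 ^ k) * Kk n a ε (x - y)) := by
            rw [ENNReal.ofReal_pow (by norm_num)]; simp only [ENNReal.ofReal_ofNat]; ring
        _ ≤ 2 * ENNReal.ofReal β * (lev A β k).indicator (LL k x) y := by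
            rw [indicator_of_mem hyk]; gcongr
        _ ≤ _ := by
            gcongr
            exact ENNReal.le_tsum (f := fun k => (lev A β k).indicator (LL k x) y) k
    have hLx : ∀ k, Measurable (LL k x) := fun k => (hLm k).of_uncurry_left
    have hIntg : ∫⁻ y, F ε y * Kk n a ε (x - y) ≤ ENNReal.ofReal β * CK + 2 * ENNReal.ofReal β * J x := by
      refine (lintegral_mono hpt).trans (le_of_eq ?_)
      have hKm : Measurable (fun y => ENNReal.ofReal β * Kk n a ε (x - y)) :=
        ((Kk_meas n a ε).comp (measurable_const.sub measurable_id)).const_mul _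
      rw [lintegral_add_left hKm,
        lintegral_const_mul' _ _ ENNReal.ofReal_ne_top, lintegral_const_mul' _ _ (ENNReal.mul_ne_top (by norm_num) ENNReal.ofReal_ne_top),
        lintegral_tsum (fun k => ((hLx k).indicator (hopen k).measurableSet).aemeasurable)]
      congr 2
      · rw [hCK, ← Kk_int a ε hε]
        exact lintegral_sub_left_eq_self (fun z => Kk n a ε z) x
      · simp only [hJ]
        congr 1; ext k
        rw [lintegral_indicator (hopen k).measurableSet]
    by_contra hcon
    simp only [mem_ofPred_eq, not_le] at hcon
    have h3 : ENNReal.ofReal β * CK + 2 * ENNReal.ofReal β * J x ≤ (CK + 2) * ENNReal.ofReal β := by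
      calc ENNReal.ofReal β * CK + 2 * ENNReal.ofReal β * J x ≤ ENNReal.ofReal β * CK + 2 * ENNReal.ofReal β * 1 := by gcongr
        _ = _ := by ring
    exact absurd (hx.trans_le (hIntg.trans h3)) (lt_irrefl _)
  have hpart1 : ∫⁻ x in ⋃ k, Nk k, w x ≤ Ca * ∑' k : ℕ, ∫⁻ y in lev A β k, u k y := by
    rw [← ENNReal.tsum_mul_left]
    refine (lintegral_iUnion_le _ _).trans (ENNReal.tsum_le_tsum fun k => ?_)
    exact vitali_weight hn (lev A β k) (hopen k) (hne k) (hfin k) (Rk a k) (Rk_ge a ha0 k) w (u k) Ca (h1 k)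
  have hpart2 : ∫⁻ x in {x | 1 ≤ J x}, w x ≤ Cb * ∑' k : ℕ, ∫⁻ y in lev A β k, u k y := by
    have hms : MeasurableSet {x | 1 ≤ J x} := measurableSet_le measurable_const hJm
    calc ∫⁻ x in {x | 1 ≤ J x}, w x ≤ ∫⁻ x in {x | 1 ≤ J x}, J x * w x := by
          refine setLIntegral_mono (hJm.mul hw) fun x hx => ?_
          calc w x = 1 * w x := by simp
            _ ≤ _ := mul_le_mul' hx le_rfl
      _ ≤ ∫⁻ x, J x * w x := setLIntegral_le_lintegral _ _
      _ = ∫⁻ x, ∑' k : ℕ, (∫⁻ y in lev A β k, LL k x y) * w x := by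
          simp only [hJ, ENNReal.tsum_mul_right]
      _ = ∑' k : ℕ, ∫⁻ x, (∫⁻ y in lev A β k, LL k x y) * w x := lintegral_tsum fun k => ((hJm' k).mul hw).aemeasurable
      _ = ∑' k : ℕ, ∫⁻ x, ∫⁻ y in lev A β k, LL k x y * w x := by
          congr 1; ext k
          refine lintegral_congr fun x => ?_
          rw [lintegral_mul_const _ (hLm k).of_uncurry_left]
      _ = ∑' k : ℕ, ∫⁻ y in lev A β k, ∫⁻ x, LL k x y * w x := by
          congr 1; ext k
          rw [lintegral_lintegral_swap]
          exact ((hLm k).mul (hw.comp measurable_fst)).aemeasurable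
      _ ≤ ∑' k : ℕ, ∫⁻ y in lev A β k, Cb * u k y := by
          refine ENNReal.tsum_le_tsum fun k => ?_
          exact setLIntegral_mono ((hu k).const_mul _) fun y hy => h2 k y hy
      _ = _ := by
          rw [← ENNReal.tsum_mul_left]
          congr 1; ext k
          rw [lintegral_const_mul' _ _ hCb]
  calc _ ≤ ∫⁻ x in (⋃ k, Nk k) ∪ {x | 1 ≤ J x}, w x := lintegral_mono_set hincl
    _ ≤ (∫⁻ x in ⋃ k, Nk k, w x) + ∫⁻ x in {x | 1 ≤ J x}, w x := lintegral_union_le _ _ _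
    _ ≤ _ := by rw [add_mul]; exact add_le_add hpart1 hpart2


lemma LH_sub {n : ℕ} (p : En n → ℝ) (C pinf : ℝ) (hp : LH n p C pinf) (κ : ℝ) (hκ : 0 < κ)
    (β : ℝ) (hβ : 1 ≤ β) (x y : En n) (hxy : x ≠ y) (h : β ^ (κ / 2) ≤ 1 / ‖x - y‖) :
    β ^ (p x) ≤ Real.exp (2 * C / κ) * β ^ (p y) := by
  have hβ0 : 0 < β := by linarith
  have hr : 0 < ‖x - y‖ := norm_pos_iff.2 (sub_ne_zero.2 hxy)
  have hl1 : 1 ≤ Real.log (Real.exp 1 + 1 / ‖x - y‖) := one_le_log_e_add (by positivity)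
  have hlog : κ / 2 * Real.log β ≤ Real.log (Real.exp 1 + 1 / ‖x - y‖) := by
    rw [← Real.log_rpow hβ0]
    apply Real.log_le_log (by positivity)
    linarith [Real.exp_pos 1]
  have hlβ : 0 ≤ Real.log β := Real.log_nonneg hβ
  have hd := (abs_le.1 (hp.2.1 x y)).2
  have e : β ^ (p x) = β ^ (p x - p y) * β ^ (p y) := by rw [← Real.rpow_add hβ0]; ring_nf
  rw [e]
  gcongr
  rw [Real.rpow_def_of_pos hβ0]
  apply Real.exp_le_exp.2
  calc Real.log β * (p x - p y) ≤ Real.log β * (C / Real.log (Real.exp 1 + 1 / ‖x - y‖)) := by gcongr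
    _ = C * (Real.log β / Real.log (Real.exp 1 + 1 / ‖x - y‖)) := by ring
    _ ≤ C * (2 / κ) := by
      have := hp.1
      refine mul_le_mul_of_nonneg_left ?_ this.le
      rw [div_le_div_iff₀ (by linarith) hκ]
      linarith
    _ = _ := by ring

lemma LH1 {n : ℕ} (p : En n → ℝ) (C pinf : ℝ) (hp : LH n p C pinf) (hp0 : ∀ x, 0 < p x ∧ p x ≤ 1) (κ : ℝ) (hκ : 0 < κ)
    (D : ℝ) (hD : 1 ≤ D) (β : ℝ) (hβ : 1 ≤ β) (x y : En n) (h : ‖x - y‖ * β ^ κ ≤ D) :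
    β ^ (p x) ≤ (Real.exp (2 * C / κ) + D ^ (2 / κ)) * β ^ (p y) := by
  have hβ0 : 0 < β := by linarith
  have hD2 : 1 ≤ D ^ (2 / κ) := Real.one_le_rpow hD (by positivity)
  have he : 0 < Real.exp (2 * C / κ) := Real.exp_pos _
  have hpos : 0 < β ^ (p y) := by positivity
  rcases eq_or_ne x y with rfl | hxy
  · nlinarith
  have hr : 0 < ‖x - y‖ := norm_pos_iff.2 (sub_ne_zero.2 hxy)
  by_cases hc : D ≤ β ^ (κ / 2)
  · refine (LH_sub p C pinf hp κ hκ β hβ x y hxy ?_).trans ?_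
    · rw [le_div_iff₀ hr]
      have : β ^ κ = β ^ (κ / 2) * β ^ (κ / 2) := by rw [← Real.rpow_add hβ0]; ring_nf
      rw [this] at h
      have hb : 0 < β ^ (κ / 2) := by positivity
      by_contra hcon
      push Not at hcon
      nlinarith
    · gcongr; linarith
  · push Not at hc
    have e : β ^ (p x) = β ^ (p x - p y) * β ^ (p y) := by rw [← Real.rpow_add hβ0]; ring_nf
    rw [e]
    gcongr
    have h1 : β ^ (p x - p y) ≤ β ^ (1:ℝ) := Real.rpow_le_rpow_of_exponent_le hβ (by linarith [(hp0 x).2, (hp0 y).1])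
    rw [Real.rpow_one] at h1
    have h2 : β = (β ^ (κ / 2)) ^ (2 / κ) := by
      rw [← Real.rpow_mul hβ0.le, show κ / 2 * (2 / κ) = 1 by field_simp, Real.rpow_one]
    have h3 : β ≤ D ^ (2 / κ) := by
      rw [h2]; gcongr
    linarith

lemma LH2 {n : ℕ} (p : En n → ℝ) (C pinf : ℝ) (hp : LH n p C pinf) (κ η : ℝ) (hκ : 0 < κ) (hη : 0 < η)
    (β : ℝ) (hβ : 1 ≤ β) (x y : En n) (h : ‖x - y‖ ≤ Real.exp (-(2 * C / (η * κ)))) :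
    β ^ (p x) ≤ Real.exp (2 * C / κ) * (1 + ‖x - y‖ * β ^ κ) ^ η * β ^ (p y) := by
  have hβ0 : 0 < β := by linarith
  have hC := hp.1
  have he : 1 ≤ Real.exp (2 * C / κ) := Real.one_le_exp (by positivity)
  have hpos : 0 < β ^ (p y) := by positivity
  have h1 : 1 ≤ (1 + ‖x - y‖ * β ^ κ) ^ η := Real.one_le_rpow (by
    have : 0 ≤ ‖x - y‖ * β ^ κ := by positivity
    linarith) hη.le
  rcases eq_or_ne x y with rfl | hxy
  · have : 1 ≤ Real.exp (2 * C / κ) * (1 + ‖x - x‖ * β ^ κ) ^ η := by nlinarith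
    nlinarith
  have hr : 0 < ‖x - y‖ := norm_pos_iff.2 (sub_ne_zero.2 hxy)
  by_cases hc : β ^ (κ / 2) ≤ 1 / ‖x - y‖
  · refine (LH_sub p C pinf hp κ hκ β hβ x y hxy hc).trans ?_
    gcongr
    nlinarith
  · push Not at hc
    have e : β ^ (p x) = β ^ (p x - p y) * β ^ (p y) := by rw [← Real.rpow_add hβ0]; ring_nf
    rw [e]
    gcongr
    have hlog : 2 * C / (η * κ) ≤ Real.log (Real.exp 1 + 1 / ‖x - y‖) := by
      rw [Real.le_log_iff_exp_le (by positivity)]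
      have : Real.exp (2 * C / (η * κ)) ≤ 1 / ‖x - y‖ := by
        rw [le_div_iff₀ hr]
        calc Real.exp (2 * C / (η * κ)) * ‖x - y‖ ≤ Real.exp (2 * C / (η * κ)) * Real.exp (-(2 * C / (η * κ))) := by gcongr
          _ = 1 := by rw [← Real.exp_add]; simp
      linarith [Real.exp_pos 1]
    have hd : p x - p y ≤ η * κ / 2 := by
      refine ((abs_le.1 (hp.2.1 x y)).2).trans ?_
      calc C / Real.log (Real.exp 1 + 1 / ‖x - y‖) ≤ C / (2 * C / (η * κ)) := by gcongr
        _ = _ := by field_simp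
    calc β ^ (p x - p y) ≤ β ^ (η * κ / 2) := Real.rpow_le_rpow_of_exponent_le hβ hd
      _ = (β ^ (κ / 2)) ^ η := by rw [← Real.rpow_mul hβ0.le]; ring_nf
      _ ≤ (1 + ‖x - y‖ * β ^ κ) ^ η := by
        gcongr
        have : β ^ κ = β ^ (κ / 2) * β ^ (κ / 2) := by rw [← Real.rpow_add hβ0]; ring_nf
        rw [this]
        have hb : 0 < β ^ (κ / 2) := by positivity
        rw [div_lt_iff₀ hr] at hc
        nlinarith
      _ ≤ _ := by
        conv_lhs => rw [← one_mul ((1 + ‖x - y‖ * β ^ κ) ^ η)]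
        gcongr

lemma Rk_pow_n {n : ℕ} (hn : 1 ≤ n) (p₀ : ℝ) (hp₀ : 0 < p₀) (k : ℕ) : Rk (n / p₀) k ^ n = ((2:ℝ) ^ k) ^ p₀ := by
  have : (n:ℝ) ≠ 0 := by positivity
  rw [Rk, ← Real.rpow_natCast, ← Real.rpow_mul (by positivity)]
  congr 1
  field_simp

/-- measure of level sets -/
lemma lev_meas_le {n : ℕ} (p : En n → ℝ) (A : En n → ℝ≥0∞) (hAm : Measurable A)
    (hA1 : ∫⁻ x, (A x) ^ (p x) ≤ 1) (β : ℝ) (k : ℕ) (m : ℝ≥0∞) (hp : ∀ x, 0 < p x)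
    (hm : ∀ x, m ≤ (ENNReal.ofReal β * 2 ^ (k:ℤ)) ^ (p x)) :
    m * volume (lev A β k) ≤ 1 := by
  rw [← setLIntegral_const]
  refine le_trans ?_ hA1
  refine le_trans ?_ (setLIntegral_le_lintegral (lev A β k) _)
  refine setLIntegral_mono' (measurableSet_lt measurable_const hAm) fun x hx => ?_
  exact (hm x).trans (ENNReal.rpow_le_rpow (le_of_lt hx) (hp x).le)

lemma lev_fin {n : ℕ} (p : En n → ℝ) (A : En n → ℝ≥0∞) (hAm : Measurable A)
    (hA1 : ∫⁻ x, (A x) ^ (p x) ≤ 1) (β : ℝ) (hβ : 0 < β) (k : ℕ) (hp : ∀ x, 0 < p x ∧ p x ≤ 1) :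
    volume (lev A β k) ≠ ⊤ := by
  have hc0 : ENNReal.ofReal β * 2 ^ (k:ℤ) ≠ 0 := by
    rw [zpow_natCast]; simp [hβ]
  have := lev_meas_le p A hAm hA1 β k (min 1 (ENNReal.ofReal β * 2 ^ (k:ℤ))) (fun x => (hp x).1) (fun x => by
    rcases le_total 1 (ENNReal.ofReal β * 2 ^ (k:ℤ)) with h | h
    · exact (min_le_left _ _).trans (ENNReal.one_le_rpow h (hp x).1)
    · refine (min_le_right _ _).trans ?_
      conv_lhs => rw [← ENNReal.rpow_one (ENNReal.ofReal β * 2 ^ (k:ℤ))]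
      exact ENNReal.rpow_le_rpow_of_exponent_ge h (hp x).2)
  intro hcon
  rw [hcon, ENNReal.mul_top (lt_min one_pos (pos_iff_ne_zero.2 hc0)).ne'] at this
  simp at this

lemma lev_ne {n : ℕ} (hn : 1 ≤ n) (p : En n → ℝ) (A : En n → ℝ≥0∞) (hAm : Measurable A)
    (hA1 : ∫⁻ x, (A x) ^ (p x) ≤ 1) (β : ℝ) (hβ : 0 < β) (k : ℕ) (hp : ∀ x, 0 < p x ∧ p x ≤ 1) :
    (lev A β k)ᶜ.Nonempty := by
  rw [nonempty_compl]
  intro h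
  have := lev_fin p A hAm hA1 β hβ k hp
  rw [h] at this
  have hnt : Nontrivial (En n) := by
    have : Nonempty (Fin n) := ⟨⟨0, hn⟩⟩
    infer_instance
  have : NoncompactSpace (En n) := NormedSpace.noncompactSpace ℝ (En n)
  exact absurd (measure_univ_of_isAddLeftInvariant (volume : Measure (En n))) (by assumption)


lemma ofReal_two_pow_rpow (k : ℕ) (p₀ : ℝ) : ENNReal.ofReal (((2:ℝ) ^ k) ^ p₀) = ((2:ℝ≥0∞) ^ (k:ℤ)) ^ p₀ := by
  rw [← ENNReal.ofReal_rpow_of_pos (by positivity), ENNReal.ofReal_pow (by norm_num), zpow_natCast]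
  norm_num

lemma geom_tsum_nat (β : ℝ≥0∞) (hβ : β ≠ 0) (hβ' : β ≠ ⊤) (p₀ e : ℝ) (hp₀ : 0 < p₀) (he : p₀ ≤ e)
    (a : ℝ≥0∞) :
    ∑' k : ℕ, (if β * 2 ^ (k:ℤ) < a then (β * 2 ^ (k:ℤ)) ^ e else 0) ≤ (1 - (2:ℝ≥0∞) ^ (-p₀))⁻¹ * a ^ e := by
  refine le_trans ?_ (geom_tsum_int β hβ hβ' p₀ e hp₀ he a)
  exact ENNReal.tsum_comp_le_tsum_of_injective (f := fun k : ℕ => (k:ℤ)) Nat.cast_injective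
    (fun k : ℤ => if β * 2 ^ k < a then (β * 2 ^ k) ^ e else 0)

lemma G_fin (p₀ : ℝ) (hp₀ : 0 < p₀) : (1 - (2:ℝ≥0∞) ^ (-p₀))⁻¹ ≠ ⊤ := by
  rw [ENNReal.inv_ne_top]
  have : (2:ℝ≥0∞) ^ (-p₀) < 1 := ENNReal.rpow_lt_one_of_one_lt_of_neg (by norm_num) (by linarith)
  exact (tsub_pos_of_lt this).ne'

lemma weak_small {n : ℕ} (hn : 1 ≤ n) (p : En n → ℝ) (hpm : Measurable p) (C pinf : ℝ) (hp : LH n p C pinf)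
    (p₀ : ℝ) (hp₀ : 0 < p₀) (hp₀1 : p₀ < 1) (hpb : ∀ x, p₀ ≤ p x ∧ p x ≤ 1) (hpi : p₀ ≤ pinf) :
    ∃ K : ℝ≥0∞, K ≠ ⊤ ∧ ∀ A : En n → ℝ≥0∞, LowerSemicontinuous A → (∫⁻ x, (A x) ^ (p x) ≤ 1) →
      ∀ F : ℝ → En n → ℝ≥0∞, (∀ ε y, F ε y ≠ ⊤) → (∀ ε, 0 < ε → ∀ x y, dist x y ≤ ε → F ε y ≤ A x) →
      ∀ β : ℝ, 0 < β → β ≤ 1 →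
      ∫⁻ x in {x | ((∫⁻ z : En n, Kk n (n / p₀) 1 z) + 2) * ENNReal.ofReal β < ⨆ (ε : ℝ) (_ : 0 < ε), ∫⁻ y, F ε y * Kk n (n / p₀) ε (x - y)},
        (ENNReal.ofReal β) ^ (p x) ≤ K := by
  have hn0 : (0:ℝ) < n := by exact_mod_cast hn
  set a : ℝ := n / p₀ with ha_def
  have ha : (n:ℝ) < a := by
    rw [ha_def, lt_div_iff₀ hp₀]; nlinarith
  have ha0 : 0 < a := hn0.trans ha
  set CK := ∫⁻ z : En n, Kk n a 1 z with hCK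
  have hCKt : CK ≠ ⊤ := Kk_int_fin a ha
  set N : ℝ := (n:ℝ) + 1 with hN_def
  have hN0 : 0 ≤ N := by positivity
  set H : ℝ≥0∞ := ∫⁻ x : En n, hN N x with hH
  have hHt : H ≠ ⊤ := by
    have := finite_integral_one_add_norm (E := En n) (μ := volume) (r := N) (by rw [finrank_euclideanSpace_fin]; simp [N])
    simpa [hN, H] using this.ne
  set E : ℝ≥0∞ := ENNReal.ofReal (Real.exp (N * (C / p₀))) with hE
  have hC := hp.1
  have hE1 : 1 ≤ E := by
    rw [hE, ← ENNReal.ofReal_one]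
    exact ENNReal.ofReal_le_ofReal (Real.one_le_exp (by positivity))
  have hEt : E ≠ ⊤ := ENNReal.ofReal_ne_top
  set G : ℝ≥0∞ := (1 - (2:ℝ≥0∞) ^ (-p₀))⁻¹ with hG
  have hGt : G ≠ ⊤ := G_fin p₀ hp₀
  set Ca : ℝ≥0∞ := ENNReal.ofReal (5 ^ n) with hCa
  set Cb : ℝ≥0∞ := ENNReal.ofReal (2 ^ a) * CK with hCb
  have hCbt : Cb ≠ ⊤ := ENNReal.mul_ne_top ENNReal.ofReal_ne_top hCKt
  have key1 : ∀ x, ∀ v : ℝ≥0∞, v ≤ 1 → v ^ pinf ≤ E * v ^ (p x) + hN N x ∧ v ^ (p x) ≤ E * v ^ pinf + hN N x := by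
    intro x v hv
    have e1 : v ^ pinf = (v ^ p₀) ^ (pinf / p₀) := by rw [← ENNReal.rpow_mul]; congr 1; field_simp
    have e2 : v ^ (p x) = (v ^ p₀) ^ (p x / p₀) := by rw [← ENNReal.rpow_mul]; congr 1; field_simp
    have h1 : 1 ≤ pinf / p₀ := (one_le_div hp₀).2 hpi
    have h2 : 1 ≤ p x / p₀ := (one_le_div hp₀).2 (hpb x).1
    have h3 : |p x / p₀ - pinf / p₀| ≤ C / p₀ / Real.log (Real.exp 1 + ‖x‖) := by
      rw [← sub_div, abs_div, abs_of_pos hp₀, div_right_comm]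
      gcongr
      exact hp.2.2 x
    have hv' : v ^ p₀ ≤ 1 := ENNReal.rpow_le_one hv hp₀.le
    rw [e1, e2]
    refine ⟨lemL N (C / p₀) hN0 (by positivity) x _ _ h1 h2 ?_ _ hv', lemL N (C / p₀) hN0 (by positivity) x _ _ h2 h1 h3 _ hv'⟩
    rw [abs_sub_comm]; exact h3
  refine ⟨E * ((Ca + Cb) * (G * (E + H))) + H, by finiteness, ?_⟩
  intro A hA hA1 F hFt hFA β hβ hβ1
  have hAm : Measurable A := hA.measurable
  have hpb' : ∀ x, 0 < p x ∧ p x ≤ 1 := fun x => ⟨hp₀.trans_le (hpb x).1, (hpb x).2⟩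
  set b : ℝ≥0∞ := ENNReal.ofReal β with hb
  have hb0 : b ≠ 0 := by simp [hb, hβ]
  have hbt : b ≠ ⊤ := ENNReal.ofReal_ne_top
  have hb1 : b ≤ 1 := by rw [hb, ← ENNReal.ofReal_one]; exact ENNReal.ofReal_le_ofReal hβ1
  set W : ℝ≥0∞ := b ^ pinf with hW
  have hopen : ∀ k, IsOpen (lev A β k) := fun k => hA.isOpen_preimage _
  have hdpos : ∀ k, ∀ y ∈ lev A β k, 0 < dlev A β k y := fun k y hy =>
    ((hopen k).isClosed_compl.notMem_iff_infDist_pos (lev_ne hn p A hAm hA1 β hβ k hpb')).1 (by simpa using hy)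
  have main := weak_abstract hn a ha A hA β hβ (fun k => lev_ne hn p A hAm hA1 β hβ k hpb')
    (fun k => lev_fin p A hAm hA1 β hβ k hpb') F hFt hFA (fun _ => W) measurable_const
    (fun k _ => W * ENNReal.ofReal (Rk a k ^ n)) (fun k => measurable_const) Ca Cb hCbt
    (by
      intro k y hy
      have hd := hdpos k y hy
      have hR := Rk_ge a ha0 k
      rw [setLIntegral_const, setLIntegral_const, vol_b hn, vol_cb y (by positivity), vol_cb y hd.le, hCa,
        mul_pow, mul_pow, ENNReal.ofReal_mul (by positivity), ENNReal.ofReal_mul (by positivity)]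
      apply le_of_eq; ring)
    (by
      intro k y hy
      have hd := hdpos k y hy
      have hR := Rk_ge a ha0 k
      rw [lintegral_mul_const' _ _ (by finiteness), lintegral_sub_right_eq_self (fun z => Lk n a (dlev A β k y) (Rk a k * dlev A β k y) z)]
      calc _ ≤ (ENNReal.ofReal (2 ^ a * Rk a k ^ n) * CK) * W := by
            gcongr; exact Lk_int a _ _ hd hR ha
        _ = _ := by rw [hCb, ENNReal.ofReal_mul (by positivity)]; ring)
  have hpt : ∀ y, ∑' k : ℕ, (lev A β k).indicator (fun _ => W * ENNReal.ofReal (Rk a k ^ n)) y ≤ G * (E * (A y) ^ (p y) + hN N y) := by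
    intro y
    by_cases hy : b < A y
    · have e : ∀ k : ℕ, (lev A β k).indicator (fun _ => W * ENNReal.ofReal (Rk a k ^ n)) y =
          b ^ (pinf - p₀) * (if b * 2 ^ (k:ℤ) < A y then (b * 2 ^ (k:ℤ)) ^ p₀ else 0) := by
        intro k
        by_cases hk : b * 2 ^ (k:ℤ) < A y
        · rw [indicator_of_mem (by exact hk), if_pos hk, Rk_pow_n hn p₀ hp₀, ofReal_two_pow_rpow,
            ENNReal.mul_rpow_of_nonneg _ _ hp₀.le, ← mul_assoc, ← ENNReal.rpow_add _ _ hb0 hbt, hW]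
          ring_nf
        · rw [indicator_of_notMem (by exact hk), if_neg hk, mul_zero]
      simp_rw [e]
      rw [ENNReal.tsum_mul_left]
      calc _ ≤ b ^ (pinf - p₀) * (G * (A y) ^ p₀) := by
            gcongr; exact geom_tsum_nat b hb0 hbt p₀ p₀ hp₀ le_rfl _
        _ = G * (b ^ (pinf - p₀) * (A y) ^ p₀) := by ring
        _ ≤ _ := by
          refine mul_le_mul' le_rfl ?_
          rcases le_total (A y) 1 with h1 | h1
          · have hAt : A y ≠ ⊤ := ne_top_of_le_ne_top ENNReal.one_ne_top h1
            have hA0 : A y ≠ 0 := (lt_of_le_of_lt zero_le hy).ne'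
            calc b ^ (pinf - p₀) * (A y) ^ p₀ ≤ (A y) ^ (pinf - p₀) * (A y) ^ p₀ := by
                  gcongr
              _ = (A y) ^ pinf := by rw [← ENNReal.rpow_add _ _ hA0 hAt]; ring_nf
              _ ≤ _ := (key1 y _ h1).1
          · calc b ^ (pinf - p₀) * (A y) ^ p₀ ≤ 1 * (A y) ^ (p y) := by
                  gcongr
                  · exact ENNReal.rpow_le_one hb1 (by linarith)
                  · exact (hpb y).1
              _ ≤ E * (A y) ^ (p y) := by gcongr
              _ ≤ _ := le_self_add
    · have e : ∀ k : ℕ, (lev A β k).indicator (fun _ => W * ENNReal.ofReal (Rk a k ^ n)) y = 0 := by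
        intro k
        refine indicator_of_notMem ?_ _
        intro hk
        apply hy
        refine lt_of_le_of_lt ?_ (show b * 2 ^ (k:ℤ) < A y from hk)
        rw [zpow_natCast]
        exact le_mul_of_one_le_right zero_le (one_le_pow₀ (by norm_num))
      simp [e]
  have hsum : ∑' k : ℕ, ∫⁻ y in lev A β k, W * ENNReal.ofReal (Rk a k ^ n) ≤ G * (E + H) := by
    calc _ = ∑' k : ℕ, ∫⁻ y, (lev A β k).indicator (fun _ => W * ENNReal.ofReal (Rk a k ^ n)) y := by
          congr 1; ext k; rw [lintegral_indicator (hopen k).measurableSet]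
      _ = ∫⁻ y, ∑' k : ℕ, (lev A β k).indicator (fun _ => W * ENNReal.ofReal (Rk a k ^ n)) y := by
          rw [lintegral_tsum]
          exact fun k => (measurable_const.indicator (hopen k).measurableSet).aemeasurable
      _ ≤ ∫⁻ y, G * (E * (A y) ^ (p y) + hN N y) := lintegral_mono hpt
      _ = G * (E * (∫⁻ y, (A y) ^ (p y)) + H) := by
          rw [lintegral_const_mul' _ _ hGt, lintegral_add_right _ (hN_meas N), lintegral_const_mul' _ _ hEt]
      _ ≤ G * (E * 1 + H) := by gcongr
      _ = _ := by rw [mul_one]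
  calc _ ≤ ∫⁻ x in {x | (CK + 2) * b < ⨆ (ε : ℝ) (_ : 0 < ε), ∫⁻ y, F ε y * Kk n a ε (x - y)}, (E * W + hN N x) :=
        lintegral_mono fun x => (key1 x b hb1).2
    _ = E * (∫⁻ x in {x | (CK + 2) * b < ⨆ (ε : ℝ) (_ : 0 < ε), ∫⁻ y, F ε y * Kk n a ε (x - y)}, W) + 
        ∫⁻ x in {x | (CK + 2) * b < ⨆ (ε : ℝ) (_ : 0 < ε), ∫⁻ y, F ε y * Kk n a ε (x - y)}, hN N x := by
      rw [lintegral_add_right _ (hN_meas N), lintegral_const_mul' _ _ hEt]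
    _ ≤ _ := by
      refine add_le_add (mul_le_mul' le_rfl (main.trans (mul_le_mul' le_rfl hsum))) (setLIntegral_le_lintegral _ _)


lemma large_pt {n : ℕ} (hn : 1 ≤ n) (p : En n → ℝ) (C pinf : ℝ) (hp : LH n p C pinf)
    (p₀ : ℝ) (hp₀ : 0 < p₀) (hp₀1 : p₀ < 1) (hpb : ∀ x, p₀ ≤ p x ∧ p x ≤ 1) (D : ℝ) (hD : 1 ≤ D)
    (η : ℝ) (hη : 0 < η) :
    ∃ C2 C3 : ℝ, 0 < C2 ∧ 0 < C3 ∧ ∀ β : ℝ, 1 ≤ β → ∀ d R : ℝ, 0 < d → 1 ≤ R → R * d * β ^ (p₀ / n) ≤ D →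
      ∀ x y : En n, R * d ≤ ‖x - y‖ →
      ((d ^ n)⁻¹ * (R * d / ‖x - y‖) ^ ((n:ℝ) / p₀)) * β ^ (p x) ≤
        β ^ (p y) * (C2 * ((d ^ n)⁻¹ * (R * d / ‖x - y‖) ^ ((n:ℝ) / p₀ - η)) + (R ^ n * C3) * (1 + ‖x - y‖) ^ (-((n:ℝ) / p₀))) := by
  have hn0 : (0:ℝ) < n := by exact_mod_cast hn
  have hC := hp.1
  set a : ℝ := n / p₀ with ha_def
  have ha : (n:ℝ) < a := by
    rw [ha_def, lt_div_iff₀ hp₀]; nlinarith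
  have ha0 : 0 < a := hn0.trans ha
  set κ := p₀ / n with hκ_def
  have hκ : 0 < κ := by positivity
  set r0 := Real.exp (-(2 * C / (η * κ))) with hr0
  have hr0p : 0 < r0 := Real.exp_pos _
  refine ⟨Real.exp (2 * C / κ) * (1 + D) ^ η, D ^ (a - n) * (1 + 1 / r0) ^ a, by positivity, by positivity, ?_⟩
  intro β hβ d R hd hR hρD x y hz
  set r := ‖x - y‖ with hr
  set ρ := R * d with hρ
  have hρ0 : 0 < ρ := by positivity
  have hβ0 : 0 < β := by linarith
  have hrp : 0 < r := hρ0.trans_le hz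
  have hby : 0 < β ^ (p y) := by positivity
  rcases le_or_gt r r0 with hc | hc
  · have h := LH2 p C pinf hp κ η hκ hη β hβ x y hc
    rw [← hr] at h
    have h1 : 1 + r * β ^ κ ≤ (r / ρ) * (1 + D) := by
      have e : r * β ^ κ = (r / ρ) * (ρ * β ^ κ) := by field_simp
      have h2 : 1 ≤ r / ρ := (one_le_div hρ0).2 hz
      rw [e]
      nlinarith
    have h3 : (1 + r * β ^ κ) ^ η ≤ (r / ρ) ^ η * (1 + D) ^ η := by
      rw [← Real.mul_rpow (by positivity) (by positivity)]
      gcongr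
    have h4 : (ρ / r) ^ a * (r / ρ) ^ η = (ρ / r) ^ (a - η) := by
      rw [show r / ρ = (ρ / r)⁻¹ by rw [inv_div], Real.inv_rpow (by positivity), ← Real.rpow_neg (by positivity), ← Real.rpow_add (by positivity)]
      ring_nf
    calc ((d ^ n)⁻¹ * (ρ / r) ^ a) * β ^ (p x) 
        ≤ ((d ^ n)⁻¹ * (ρ / r) ^ a) * (Real.exp (2 * C / κ) * ((r / ρ) ^ η * (1 + D) ^ η) * β ^ (p y)) := by
          gcongr
          refine h.trans ?_
          gcongr
      _ = β ^ (p y) * (Real.exp (2 * C / κ) * (1 + D) ^ η * ((d ^ n)⁻¹ * (ρ / r) ^ (a - η))) := by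
          rw [← h4]; ring
      _ ≤ _ := by
          gcongr
          exact le_add_of_nonneg_right (by positivity)
  · have h1 : β ^ (p x) ≤ β := by
      conv_rhs => rw [← Real.rpow_one β]
      exact Real.rpow_le_rpow_of_exponent_le hβ (hpb x).2
    have h2 : β ^ p₀ ≤ β ^ (p y) := Real.rpow_le_rpow_of_exponent_le hβ (hpb y).1
    have h3 : (d ^ n)⁻¹ * ρ ^ a = R ^ n * ρ ^ (a - n) := by
      rw [Real.rpow_sub hρ0, Real.rpow_natCast, hρ, mul_pow]
      field_simp
    have h4 : ρ ^ (a - n) * β ≤ D ^ (a - n) * β ^ p₀ := by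
      have : (ρ * β ^ κ) ^ (a - n) ≤ D ^ (a - n) := by
        apply Real.rpow_le_rpow (by positivity) hρD (by linarith)
      rw [Real.mul_rpow (by positivity) (by positivity), ← Real.rpow_mul hβ0.le,
        show κ * (a - n) = 1 - p₀ by rw [hκ_def, ha_def]; field_simp] at this
      calc ρ ^ (a - n) * β = (ρ ^ (a - n) * β ^ (1 - p₀)) * β ^ p₀ := by
            rw [mul_assoc, ← Real.rpow_add hβ0]; simp
        _ ≤ _ := by gcongr
    have h5 : r ^ (-a) ≤ (1 + 1 / r0) ^ a * (1 + r) ^ (-a) := by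
      rw [Real.rpow_neg hrp.le, Real.rpow_neg (by positivity), ← div_eq_mul_inv, le_div_iff₀ (by positivity),
        inv_mul_le_iff₀ (by positivity), ← Real.mul_rpow (by positivity) (by positivity)]
      gcongr
      have : 1 ≤ r / r0 := (one_le_div hr0p).2 hc.le
      calc 1 + r ≤ r / r0 + r := by linarith
        _ = _ := by ring
    calc ((d ^ n)⁻¹ * (ρ / r) ^ a) * β ^ (p x) ≤ ((d ^ n)⁻¹ * (ρ / r) ^ a) * β := by gcongr
      _ = R ^ n * (ρ ^ (a - n) * β) * r ^ (-a) := by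
        rw [Real.div_rpow hρ0.le hrp.le, Real.rpow_neg hrp.le, div_eq_mul_inv, ← mul_assoc, h3]; ring
      _ ≤ R ^ n * (D ^ (a - n) * β ^ (p y)) * ((1 + 1 / r0) ^ a * (1 + r) ^ (-a)) := by
        have h6 : ρ ^ (a - n) * β ≤ D ^ (a - n) * β ^ (p y) := h4.trans (by gcongr)
        exact mul_le_mul (mul_le_mul_of_nonneg_left h6 (by positivity)) h5 (by positivity) (by positivity)
      _ = β ^ (p y) * ((R ^ n * (D ^ (a - n) * (1 + 1 / r0) ^ a)) * (1 + r) ^ (-a)) := by ring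
      _ ≤ _ := by
        gcongr
        exact le_add_of_nonneg_left (by positivity)

lemma weak_large {n : ℕ} (hn : 1 ≤ n) (p : En n → ℝ) (hpm : Measurable p) (C pinf : ℝ) (hp : LH n p C pinf)
    (p₀ : ℝ) (hp₀ : 0 < p₀) (hp₀1 : p₀ < 1) (hpb : ∀ x, p₀ ≤ p x ∧ p x ≤ 1) :
    ∃ K : ℝ≥0∞, K ≠ ⊤ ∧ ∀ A : En n → ℝ≥0∞, LowerSemicontinuous A → (∫⁻ x, (A x) ^ (p x) ≤ 1) →
      ∀ F : ℝ → En n → ℝ≥0∞, (∀ ε y, F ε y ≠ ⊤) → (∀ ε, 0 < ε → ∀ x y, dist x y ≤ ε → F ε y ≤ A x) →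
      ∀ β : ℝ, 1 ≤ β →
      ∫⁻ x in {x | ((∫⁻ z : En n, Kk n (n / p₀) 1 z) + 2) * ENNReal.ofReal β < ⨆ (ε : ℝ) (_ : 0 < ε), ∫⁻ y, F ε y * Kk n (n / p₀) ε (x - y)},
        (ENNReal.ofReal β) ^ (p x) ≤ K := by
  have hn0 : (0:ℝ) < n := by exact_mod_cast hn
  have hpb' : ∀ x, 0 < p x ∧ p x ≤ 1 := fun x => ⟨hp₀.trans_le (hpb x).1, (hpb x).2⟩
  set a : ℝ := n / p₀ with ha_def
  have ha : (n:ℝ) < a := by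
    rw [ha_def, lt_div_iff₀ hp₀]; nlinarith
  have ha0 : 0 < a := hn0.trans ha
  set κ := p₀ / n with hκ_def
  have hκ : 0 < κ := by positivity
  set η : ℝ := (a - n) / 2 with hη_def
  have hη : 0 < η := by rw [hη_def]; linarith
  have haη : (n:ℝ) < a - η := by rw [hη_def]; linarith
  set CK := ∫⁻ z : En n, Kk n a 1 z with hCK
  have hCKt : CK ≠ ⊤ := Kk_int_fin a ha
  set CK' := ∫⁻ z : En n, Kk n (a - η) 1 z with hCK'
  have hCKt' : CK' ≠ ⊤ := Kk_int_fin _ haη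
  set G : ℝ≥0∞ := (1 - (2:ℝ≥0∞) ^ (-p₀))⁻¹ with hG
  have hGt : G ≠ ⊤ := G_fin p₀ hp₀
  set V' := volume (Metric.closedBall (0 : En n) 1) with hV'
  have hV0 : V' ≠ 0 := vol_cb_pos 0 one_pos
  have hVt : V' ≠ ⊤ := vol_cb_fin 0 1
  set V := V'.toReal with hV
  have hVp : 0 < V := ENNReal.toReal_pos hV0 hVt
  set D : ℝ := max 1 (1 / V) with hD_def
  have hD : 1 ≤ D := le_max_left _ _
  obtain ⟨C2, C3, hC2, hC3, hpt⟩ := large_pt hn p C pinf hp p₀ hp₀ hp₀1 hpb D hD η hη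
  set C1 : ℝ := Real.exp (2 * C / κ) + (6 * D) ^ (2 / κ) with hC1
  set Ca : ℝ≥0∞ := ENNReal.ofReal C1 * ENNReal.ofReal (5 ^ n) with hCa
  set Cb : ℝ≥0∞ := ENNReal.ofReal C2 * (ENNReal.ofReal (2 ^ (a - η)) * CK') + ENNReal.ofReal C3 * CK with hCb
  have hCbt : Cb ≠ ⊤ := by finiteness
  have hCat : Ca ≠ ⊤ := by finiteness
  refine ⟨(Ca + Cb) * (G * 1), by finiteness, ?_⟩
  intro A hA hA1 F hFt hFA β hβ1
  have hAm : Measurable A := hA.measurable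
  have hβ : 0 < β := by linarith
  set b : ℝ≥0∞ := ENNReal.ofReal β with hb
  have hb0 : b ≠ 0 := by simp [hb, hβ]
  have hbt : b ≠ ⊤ := ENNReal.ofReal_ne_top
  have hb1 : 1 ≤ b := by rw [hb, ← ENNReal.ofReal_one]; exact ENNReal.ofReal_le_ofReal hβ1
  have hbp : ∀ x, b ^ (p x) = ENNReal.ofReal (β ^ (p x)) := fun x => by
    rw [hb, ENNReal.ofReal_rpow_of_pos hβ]
  set w : En n → ℝ≥0∞ := fun x => b ^ (p x) with hw
  have hwm : Measurable w := measurable_const.pow hpm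
  have hopen : ∀ k, IsOpen (lev A β k) := fun k => hA.isOpen_preimage _
  have hne := fun k => lev_ne hn p A hAm hA1 β hβ k hpb'
  have hdpos : ∀ k, ∀ y ∈ lev A β k, 0 < dlev A β k y := fun k y hy =>
    ((hopen k).isClosed_compl.notMem_iff_infDist_pos (hne k)).1 (by simpa using hy)
  have hρ : ∀ k, ∀ y ∈ lev A β k, Rk a k * dlev A β k y * β ^ κ ≤ D := by
    intro k y hy
    have hd := hdpos k y hy
    have hR := Rk_ge a ha0 k
    set d := dlev A β k y with hd_def
    have hsub : Metric.ball y d ⊆ lev A β k := by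
      have := Metric.ball_infDist_compl_subset (s := lev A β k) (x := y)
      exact this
    have h1 := lev_meas_le p A hAm hA1 β k (ENNReal.ofReal ((β * 2 ^ k) ^ p₀)) (fun x => (hpb' x).1) (fun x => by
      rw [show ENNReal.ofReal β * 2 ^ (k:ℤ) = ENNReal.ofReal (β * 2 ^ k) by
        rw [ENNReal.ofReal_mul hβ.le, ENNReal.ofReal_pow (by norm_num), zpow_natCast]; norm_num,
        ENNReal.ofReal_rpow_of_pos (by positivity)]
      apply ENNReal.ofReal_le_ofReal
      apply Real.rpow_le_rpow_of_exponent_le _ (hpb x).1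
      have : (1:ℝ) ≤ 2 ^ k := one_le_pow₀ (by norm_num)
      nlinarith)
    have h2 : ENNReal.ofReal ((β * 2 ^ k) ^ p₀) * volume (Metric.ball y d) ≤ 1 :=
      (mul_le_mul' le_rfl (measure_mono hsub)).trans h1
    rw [vol_b hn, vol_cb y hd.le, ← hV', ← ENNReal.ofReal_toReal hVt, ← hV, ← ENNReal.ofReal_mul (by positivity),
      ← ENNReal.ofReal_mul (by positivity), ENNReal.ofReal_le_one] at h2
    have h3 : (Rk a k * d * β ^ κ) ^ n = (β * 2 ^ k) ^ p₀ * d ^ n := by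
      rw [mul_pow, mul_pow, ha_def, Rk_pow_n hn p₀ hp₀, ← Real.rpow_natCast (β ^ κ), ← Real.rpow_mul hβ.le,
        show κ * n = p₀ by rw [hκ_def]; field_simp, Real.mul_rpow hβ.le (by positivity)]
      ring
    by_contra hcon
    push Not at hcon
    have h4 : 1 ≤ Rk a k * d * β ^ κ := hD.trans hcon.le
    have h5 : 1 / V < (Rk a k * d * β ^ κ) ^ n :=
      (le_max_right 1 (1 / V)).trans_lt (hcon.trans_le (le_self_pow₀ h4 (by omega)))
    rw [h3, div_lt_iff₀ hVp] at h5
    nlinarith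
  have main := weak_abstract hn a ha A hA β hβ hne
    (fun k => lev_fin p A hAm hA1 β hβ k hpb') F hFt hFA w hwm
    (fun k x => ENNReal.ofReal (Rk a k ^ n) * w x) (fun k => hwm.const_mul _) Ca Cb hCbt
    (by
      intro k y hy
      have hd := hdpos k y hy
      have hR := Rk_ge a ha0 k
      have hρk := hρ k y hy
      set d := dlev A β k y with hd_def
      set R := Rk a k
      set I := ∫⁻ x in Metric.ball y d, w x with hI
      have hvb : volume (Metric.ball y d) = ENNReal.ofReal (d ^ n) * V' := by rw [vol_b hn, vol_cb y hd.le]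
      have hvb0 : volume (Metric.ball y d) ≠ 0 := by
        rw [hvb]; exact mul_ne_zero (by simp; positivity) hV0
      have hvbt : volume (Metric.ball y d) ≠ ⊤ := by rw [hvb]; finiteness
      have hx : ∀ x ∈ Metric.closedBall y (5 * (R * d)), w x ≤ ENNReal.ofReal C1 * I / volume (Metric.ball y d) := by
        intro x hx
        rw [ENNReal.le_div_iff_mul_le (Or.inl hvb0) (Or.inl hvbt), ← setLIntegral_const, hI, ← lintegral_const_mul' _ _ ENNReal.ofReal_ne_top]
        refine setLIntegral_mono' measurableSet_ball fun y' hy' => ?_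
        rw [hw]; dsimp only
        rw [hbp, hbp, ← ENNReal.ofReal_mul (by positivity)]
        apply ENNReal.ofReal_le_ofReal
        apply LH1 p C pinf hp hpb' κ hκ (6 * D) (by linarith) β hβ1
        rw [Metric.mem_closedBall] at hx
        rw [Metric.mem_ball] at hy'
        have : ‖x - y'‖ ≤ 6 * (R * d) := by
          rw [← dist_eq_norm]
          have := dist_triangle_right x y' y
          nlinarith
        calc ‖x - y'‖ * β ^ κ ≤ 6 * (R * d) * β ^ κ := by gcongr
          _ = 6 * (R * d * β ^ κ) := by ring
          _ ≤ 6 * D := by gcongr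
      calc ∫⁻ x in Metric.closedBall y (5 * (R * d)), w x ≤ ∫⁻ x in Metric.closedBall y (5 * (R * d)), ENNReal.ofReal C1 * I / volume (Metric.ball y d) :=
            setLIntegral_mono' measurableSet_closedBall hx
        _ = ENNReal.ofReal C1 * I / volume (Metric.ball y d) * ((ENNReal.ofReal (5 ^ n) * ENNReal.ofReal (R ^ n)) * volume (Metric.ball y d)) := by
            rw [setLIntegral_const, hvb, vol_cb y (by positivity), mul_pow, mul_pow, ENNReal.ofReal_mul (by positivity), ENNReal.ofReal_mul (by positivity)]
            ring
        _ = ENNReal.ofReal C1 * I / volume (Metric.ball y d) * volume (Metric.ball y d) * (ENNReal.ofReal (5 ^ n) * ENNReal.ofReal (R ^ n)) := by ring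
        _ = _ := by
            rw [ENNReal.div_mul_cancel hvb0 hvbt, lintegral_const_mul' _ _ ENNReal.ofReal_ne_top, hCa]
            ring)
    (by
      intro k y hy
      have hd := hdpos k y hy
      have hR := Rk_ge a ha0 k
      have hρk := hρ k y hy
      set d := dlev A β k y with hd_def
      set R := Rk a k
      have hx : ∀ x, Lk n a d (R * d) (x - y) * w x ≤ w y * (ENNReal.ofReal C2 * Lk n (a - η) d (R * d) (x - y) + ENNReal.ofReal (R ^ n * C3) * Kk n a 1 (x - y)) := by
        intro x
        unfold Lk Kk
        split_ifs with hz
        · rw [hw]; dsimp only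
          rw [hbp, hbp, ← ENNReal.ofReal_mul (by positivity), ← ENNReal.ofReal_mul (by positivity), ← ENNReal.ofReal_mul (by positivity),
            ← ENNReal.ofReal_add (by positivity) (by positivity), ← ENNReal.ofReal_mul (by positivity)]
          apply ENNReal.ofReal_le_ofReal
          have := hpt β hβ1 d R hd hR hρk x y hz
          simpa using this
        · simp
      have m1 : Measurable fun x => ENNReal.ofReal (R ^ n * C3) * Kk n a 1 (x - y) :=
        ((Kk_meas n a 1).comp (measurable_id.sub_const y)).const_mul _
      have hwyt : w y ≠ ⊤ := by rw [hw]; dsimp only; rw [hbp]; finiteness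
      calc _ ≤ ∫⁻ x, w y * (ENNReal.ofReal C2 * Lk n (a - η) d (R * d) (x - y) + ENNReal.ofReal (R ^ n * C3) * Kk n a 1 (x - y)) :=
            lintegral_mono hx
        _ = w y * (ENNReal.ofReal C2 * (∫⁻ z : En n, Lk n (a - η) d (R * d) z) + ENNReal.ofReal (R ^ n * C3) * CK) := by
            rw [lintegral_const_mul' _ _ hwyt, lintegral_add_right _ m1, lintegral_const_mul' _ _ ENNReal.ofReal_ne_top, lintegral_const_mul' _ _ ENNReal.ofReal_ne_top,
              lintegral_sub_right_eq_self (fun z => Lk n (a - η) d (R * d) z), lintegral_sub_right_eq_self (fun z => Kk n a 1 z)]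
        _ ≤ w y * (ENNReal.ofReal C2 * (ENNReal.ofReal (2 ^ (a - η) * R ^ n) * CK') + ENNReal.ofReal (R ^ n * C3) * CK) := by
            gcongr; exact Lk_int _ _ _ hd hR haη
        _ = _ := by
            rw [hCb, ENNReal.ofReal_mul (by positivity), ENNReal.ofReal_mul (by positivity)]; ring)
  have hpt' : ∀ y, ∑' k : ℕ, (lev A β k).indicator (fun x => ENNReal.ofReal (Rk a k ^ n) * w x) y ≤ G * (A y) ^ (p y) := by
    intro y
    refine le_trans (ENNReal.tsum_le_tsum fun k => ?_) (geom_tsum_nat b hb0 hbt p₀ (p y) hp₀ (hpb y).1 (A y))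
    by_cases hk : b * 2 ^ (k:ℤ) < A y
    · rw [indicator_of_mem (by exact hk), if_pos hk, ha_def, Rk_pow_n hn p₀ hp₀, ofReal_two_pow_rpow,
        ENNReal.mul_rpow_of_nonneg _ _ (hpb' y).1.le, mul_comm]
      refine mul_le_mul' le_rfl ?_
      apply ENNReal.rpow_le_rpow_of_exponent_le _ (hpb y).1
      rw [zpow_natCast]; exact one_le_pow₀ (by norm_num)
    · rw [indicator_of_notMem (by exact hk), if_neg hk]
  have hsum : ∑' k : ℕ, ∫⁻ y in lev A β k, ENNReal.ofReal (Rk a k ^ n) * w y ≤ G * 1 := by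
    calc _ = ∑' k : ℕ, ∫⁻ y, (lev A β k).indicator (fun x => ENNReal.ofReal (Rk a k ^ n) * w x) y := by
          congr 1; ext k; rw [lintegral_indicator (hopen k).measurableSet]
      _ = ∫⁻ y, ∑' k : ℕ, (lev A β k).indicator (fun x => ENNReal.ofReal (Rk a k ^ n) * w x) y := by
          rw [lintegral_tsum]
          exact fun k => ((hwm.const_mul _).indicator (hopen k).measurableSet).aemeasurable
      _ ≤ ∫⁻ y, G * (A y) ^ (p y) := lintegral_mono hpt'
      _ = G * (∫⁻ y, (A y) ^ (p y)) := by
          rw [lintegral_const_mul' _ _ hGt]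
      _ ≤ G * 1 := by gcongr
  exact main.trans (mul_le_mul' le_rfl hsum)


section Sch
open scoped FourierTransform SchwartzMap

/-- convolution of Schwartz functions -/
def cv {n : ℕ} (a b : SchwartzMap (En n) ℂ) : SchwartzMap (En n) ℂ :=
  SchwartzMap.convolution (ContinuousLinearMap.mul ℂ ℂ) a b

lemma cv_fourier {n : ℕ} (a b : SchwartzMap (En n) ℂ) (ξ : En n) : (𝓕 (cv a b)) ξ = (𝓕 a) ξ * (𝓕 b) ξ := by
  rw [cv, SchwartzMap.fourier_convolution, SchwartzMap.pairing_apply_apply]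
  simp

lemma cv_apply {n : ℕ} (a b : SchwartzMap (En n) ℂ) (x : En n) : cv a b x = ∫ y, a (x - y) * b y := by
  rw [cv, SchwartzMap.convolution_apply, convolution_eq_swap]
  simp

/-- dilation of Schwartz functions -/
def dl {n : ℕ} (τ : ℝ) (a : SchwartzMap (En n) ℂ) : SchwartzMap (En n) ℂ :=
  if h : τ ≠ 0 then ((τ ^ n)⁻¹ : ℝ) • SchwartzMap.compCLMOfContinuousLinearEquiv ℂ (ContinuousLinearEquiv.smulLeft (Units.mk0 τ⁻¹ (inv_ne_zero h)) : En n ≃L[ℝ] En n) a else 0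

lemma dl_apply {n : ℕ} (τ : ℝ) (hτ : 0 < τ) (a : SchwartzMap (En n) ℂ) (x : En n) :
    dl τ a x = ((τ ^ n)⁻¹ : ℝ) • a (τ⁻¹ • x) := by
  rw [dl, dif_pos hτ.ne']
  rfl

lemma integral_dil {n : ℕ} {E : Type*} [NormedAddCommGroup E] [NormedSpace ℝ E] (τ : ℝ) (hτ : 0 < τ) (g : En n → E) :
    ∫ x, ((τ ^ n)⁻¹ : ℝ) • g (τ⁻¹ • x) = ∫ x, g x := by
  rw [integral_smul, Measure.integral_comp_inv_smul, finrank_euclideanSpace_fin, smul_smul, abs_of_pos (by positivity),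
    inv_mul_cancel₀ (by positivity), one_smul]

lemma dl_fourier {n : ℕ} (τ : ℝ) (hτ : 0 < τ) (a : SchwartzMap (En n) ℂ) (ξ : En n) :
    (𝓕 (dl τ a)) ξ = (𝓕 a) (τ • ξ) := by
  rw [SchwartzMap.fourier_coe, SchwartzMap.fourier_coe, Real.fourier_eq, Real.fourier_eq]
  rw [← integral_dil τ hτ (fun v => Real.fourierChar (-inner ℝ v (τ • ξ)) • a v)]
  congr 1
  ext v
  rw [dl_apply τ hτ, smul_comm, inner_smul_left, inner_smul_right]
  congr 4
  simp
  field_simp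

lemma inv_formula {n : ℕ} (a : SchwartzMap (En n) ℂ) (y : En n) :
    a y = ∫ ξ, (Real.fourierChar (inner ℝ ξ y)) • (𝓕 a) ξ := by
  conv_lhs => rw [← FourierTransform.fourierInv_fourier_eq (E := SchwartzMap (En n) ℂ) (F := SchwartzMap (En n) ℂ) a]
  rw [SchwartzMap.fourierInv_coe, Real.fourierInv_eq]

lemma schwartz_decay {n : ℕ} (a : SchwartzMap (En n) ℂ) (N : ℝ) : ∃ C, 0 < C ∧ ∀ x, ‖a x‖ ≤ C * (1 + ‖x‖) ^ (-N) := by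
  obtain ⟨k, hk⟩ := exists_nat_ge N
  have h := SchwartzMap.one_add_le_sup_seminorm_apply (𝕜 := ℝ) (m := (k, 0)) (k := k) (n := 0) le_rfl le_rfl a
  set S := 2 ^ (k, 0).1 * ((Finset.Iic (k, 0)).sup fun m => SchwartzMap.seminorm ℝ m.1 m.2) a with hS
  have hS0 : 0 ≤ S := by rw [hS]; positivity
  refine ⟨S + 1, by linarith, fun x => ?_⟩
  have hx := h x
  rw [norm_iteratedFDeriv_zero] at hx
  have h1 : 1 ≤ 1 + ‖x‖ := by linarith [norm_nonneg x]
  rw [Real.rpow_neg (by positivity), ← div_eq_mul_inv, le_div_iff₀ (by positivity)]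
  calc ‖a x‖ * (1 + ‖x‖) ^ N ≤ ‖a x‖ * (1 + ‖x‖) ^ (k:ℝ) := by gcongr
    _ = (1 + ‖x‖) ^ k * ‖a x‖ := by rw [Real.rpow_natCast]; ring
    _ ≤ S + 1 := by linarith

lemma peetre_ineq {n : ℕ} (x y : En n) : 1 + ‖x‖ ≤ (1 + ‖x - y‖) * (1 + ‖y‖) := by
  have := norm_sub_norm_le x y
  nlinarith [norm_nonneg (x - y), norm_nonneg y]

/-- h ⋆ (dilate of g) decays uniformly. -/
lemma cv_dl_decay {n : ℕ} (h g : SchwartzMap (En n) ℂ) (N : ℝ) (hN : 0 ≤ N) : ∃ C, 0 < C ∧ ∀ τ, 0 < τ → τ ≤ 1 → ∀ x,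
    ‖cv h (dl τ g) x‖ ≤ C * (1 + ‖x‖) ^ (-N) := by
  obtain ⟨C1, hC1, h1⟩ := schwartz_decay h N
  obtain ⟨C2, hC2, h2⟩ := schwartz_decay g (N + (n + 1))
  have hIntg : Integrable (fun y : En n => (1 + ‖y‖) ^ (-((n:ℝ) + 1))) := integrable_one_add_norm (by simp)
  set I := ∫ y : En n, (1 + ‖y‖) ^ (-((n:ℝ) + 1)) with hI
  have hI0 : 0 ≤ I := integral_nonneg fun y => by positivity
  refine ⟨C1 * C2 * I + 1, by positivity, fun τ hτ hτ1 x => ?_⟩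
  have e : cv h (dl τ g) x = ∫ y, h (x - τ • y) * g y := by
    rw [cv_apply, ← integral_dil τ hτ (fun y => h (x - τ • y) * g y)]
    congr 1; ext y
    rw [dl_apply τ hτ, smul_inv_smul₀ hτ.ne', mul_smul_comm]
  rw [e]
  have hb : ∀ y, ‖h (x - τ • y) * g y‖ ≤ C1 * C2 * (1 + ‖x‖) ^ (-N) * (1 + ‖y‖) ^ (-((n:ℝ) + 1)) := by
    intro y
    rw [norm_mul]
    have p1 := peetre_ineq x (τ • y)
    have p2 : 1 + ‖τ • y‖ ≤ 1 + ‖y‖ := by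
      rw [norm_smul, Real.norm_of_nonneg hτ.le]
      have := norm_nonneg y
      nlinarith
    have p3 : (1 + ‖x - τ • y‖) ^ (-N) ≤ (1 + ‖x‖) ^ (-N) * (1 + ‖y‖) ^ N := by
      rw [Real.rpow_neg (by positivity), Real.rpow_neg (by positivity), inv_mul_eq_div, le_div_iff₀ (by positivity), inv_mul_le_iff₀ (by positivity),
        ← Real.mul_rpow (by positivity) (by positivity)]
      gcongr
      refine p1.trans (by gcongr)
    calc ‖h (x - τ • y)‖ * ‖g y‖ ≤ (C1 * ((1 + ‖x‖) ^ (-N) * (1 + ‖y‖) ^ N)) * (C2 * (1 + ‖y‖) ^ (-(N + (n + 1)))) := by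
          gcongr
          · exact (h1 _).trans (by gcongr)
          · exact h2 y
      _ = C1 * C2 * (1 + ‖x‖) ^ (-N) * ((1 + ‖y‖) ^ N * (1 + ‖y‖) ^ (-(N + (n + 1)))) := by ring
      _ = _ := by
        rw [← Real.rpow_add (by positivity)]; ring_nf
  calc _ ≤ ∫ y, C1 * C2 * (1 + ‖x‖) ^ (-N) * (1 + ‖y‖) ^ (-((n:ℝ) + 1)) :=
        norm_integral_le_of_norm_le (hIntg.const_mul _) (Filter.Eventually.of_forall hb)
    _ = C1 * C2 * I * (1 + ‖x‖) ^ (-N) := by rw [integral_const_mul]; ring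
    _ ≤ _ := by gcongr; linarith
end Sch


section Sch
open scoped FourierTransform SchwartzMap ContDiff

lemma quot_schwartz {n : ℕ} (g d : En n → ℂ) (hg : ContDiff ℝ ∞ g) (hc : HasCompactSupport g) (hd : ContDiff ℝ ∞ d)
    (hs : ∀ ξ ∈ tsupport g, d ξ ≠ 0) : ∃ q : SchwartzMap (En n) ℂ, ∀ ξ, (𝓕 q) ξ * d ξ = g ξ := by
  have h1 : HasCompactSupport (fun ξ => g ξ * (d ξ)⁻¹) := hc.mul_right
  have h2 : ContDiff ℝ ∞ (fun ξ => g ξ * (d ξ)⁻¹) := by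
    rw [contDiff_iff_contDiffAt]
    intro ξ
    by_cases hξ : ξ ∈ tsupport g
    · exact hg.contDiffAt.mul (hd.contDiffAt.inv (hs ξ hξ))
    · have : (fun ξ => g ξ * (d ξ)⁻¹) =ᶠ[nhds ξ] fun _ => 0 := by
        filter_upwards [(isClosed_tsupport g).isOpen_compl.mem_nhds hξ] with z hz
        rw [image_eq_zero_of_notMem_tsupport hz, zero_mul]
      exact contDiffAt_const.congr_of_eventuallyEq this
  refine ⟨𝓕⁻ (h1.toSchwartzMap h2), fun ξ => ?_⟩
  rw [FourierTransform.fourier_fourierInv_eq (E := SchwartzMap (En n) ℂ) (F := SchwartzMap (En n) ℂ)]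
  change g ξ * (d ξ)⁻¹ * d ξ = g ξ
  by_cases hξ : ξ ∈ tsupport g
  · rw [inv_mul_cancel_right₀ (hs ξ hξ)]
  · rw [image_eq_zero_of_notMem_tsupport hξ, zero_mul, zero_mul]

lemma exists_symbols {n : ℕ} (Φ : SchwartzMap (En n) ℂ) (hΦ : (∫ x, Φ x) ≠ 0) (M : ℕ) :
    ∃ (s : ℝ) (θ h W : SchwartzMap (En n) ℂ) (χ : En n → ℂ), 0 < s ∧ s ≤ 1 ∧ (∀ ξ, ‖ξ‖ ≤ 1 → χ ξ = 1) ∧ (∀ ξ, ‖χ ξ‖ ≤ 1) ∧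
      Continuous χ ∧ (∀ ξ, (𝓕 θ) ξ * (𝓕 Φ) (s • ξ) = χ ξ) ∧ (∀ ξ, (𝓕 h) ξ = ((‖ξ‖ ^ 2 : ℝ) : ℂ) ^ M * (𝓕 Φ) ξ) ∧
      ∀ ξ, (𝓕 W) ξ * (((‖ξ‖ ^ 2 : ℝ) : ℂ) ^ M * (𝓕 Φ) (s • ξ)) = χ ξ - χ ((2:ℝ) • ξ) := by
  have h0 : (𝓕 Φ) 0 ≠ 0 := by
    rw [SchwartzMap.fourier_coe, Real.fourier_eq]
    simpa using hΦ
  obtain ⟨r, hr, hr'⟩ := Metric.eventually_nhds_iff.1 ((𝓕 Φ).continuous.continuousAt.eventually_ne h0)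
  set s : ℝ := min 1 (r / 8) with hs
  have hs0 : 0 < s := lt_min one_pos (by positivity)
  have hs8 : s ≤ r / 8 := min_le_right _ _
  have hsne : ∀ ξ : En n, ‖ξ‖ ≤ 4 → (𝓕 Φ) (s • ξ) ≠ 0 := by
    intro ξ hξ
    apply hr'
    rw [dist_zero_right, norm_smul, Real.norm_of_nonneg hs0.le]
    nlinarith [norm_nonneg ξ]
  let b : ContDiffBump (0 : En n) := ⟨1, 2, one_pos, one_lt_two⟩
  set χ : En n → ℂ := fun ξ => ((b ξ : ℝ) : ℂ) with hχ
  have hχs : ContDiff ℝ ∞ χ := Complex.ofRealCLM.contDiff.comp b.contDiff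
  have hχ0 : ∀ ξ : En n, 2 ≤ ‖ξ‖ → χ ξ = 0 := by
    intro ξ hξ
    have : b ξ = 0 := b.zero_of_le_dist (by simpa [b] using hξ)
    simp [hχ, this]
  have hχ1 : ∀ ξ : En n, ‖ξ‖ ≤ 1 → χ ξ = 1 := by
    intro ξ hξ
    have : b ξ = 1 := b.one_of_mem_closedBall (by simpa [b] using hξ)
    simp [hχ, this]
  have hd : ContDiff ℝ ∞ (fun ξ : En n => (𝓕 Φ) (s • ξ)) := ((𝓕 Φ).smooth ⊤).comp (contDiff_const_smul s)
  have hts : tsupport χ ⊆ Metric.closedBall 0 2 := by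
    apply closure_minimal _ Metric.isClosed_closedBall
    intro ξ hξ
    rw [mem_closedBall_zero_iff]
    by_contra hcon
    push Not at hcon
    exact hξ (hχ0 ξ hcon.le)
  have hcs : HasCompactSupport χ := HasCompactSupport.of_support_subset_isCompact (isCompact_closedBall 0 2) ((subset_tsupport χ).trans hts)
  obtain ⟨θ, hθ⟩ := quot_schwartz χ _ hχs hcs hd (fun ξ hξ => hsne ξ (by
    have := mem_closedBall_zero_iff.1 (hts hξ); linarith))
  set g : En n → ℂ := fun ξ => χ ξ - χ ((2:ℝ) • ξ) with hg
  have hgs : ContDiff ℝ ∞ g := hχs.sub (hχs.comp (contDiff_const_smul (2:ℝ)))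
  have hn2 : ∀ ξ : En n, ‖(2:ℝ) • ξ‖ = 2 * ‖ξ‖ := fun ξ => by rw [norm_smul]; norm_num
  have hgsupp : Function.support g ⊆ {ξ | 1 / 2 ≤ ‖ξ‖ ∧ ‖ξ‖ ≤ 2} := by
    intro ξ hξ
    refine ⟨?_, ?_⟩
    · by_contra hcon
      push Not at hcon
      apply hξ
      simp only [hg]
      rw [hχ1 ξ (by linarith), hχ1 _ (by rw [hn2]; linarith), sub_self]
    · by_contra hcon
      push Not at hcon
      apply hξ
      simp only [hg]
      rw [hχ0 ξ (by linarith), hχ0 _ (by rw [hn2]; linarith), sub_self]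
  have hcl : IsClosed {ξ : En n | 1 / 2 ≤ ‖ξ‖ ∧ ‖ξ‖ ≤ 2} :=
    (isClosed_le continuous_const continuous_norm).inter (isClosed_le continuous_norm continuous_const)
  have htg : tsupport g ⊆ {ξ : En n | 1 / 2 ≤ ‖ξ‖ ∧ ‖ξ‖ ≤ 2} := closure_minimal hgsupp hcl
  have hcg : HasCompactSupport g := HasCompactSupport.of_support_subset_isCompact (isCompact_closedBall 0 2)
    (fun ξ hξ => mem_closedBall_zero_iff.2 (hgsupp hξ).2)
  have hns : ContDiff ℝ ∞ (fun ξ : En n => ((‖ξ‖ ^ 2 : ℝ) : ℂ) ^ M) :=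
    (Complex.ofRealCLM.contDiff.comp (contDiff_norm_sq ℝ)).pow M
  obtain ⟨W, hW⟩ := quot_schwartz g _ hgs hcg (hns.mul hd) (fun ξ hξ => by
    have := htg hξ
    refine mul_ne_zero (pow_ne_zero _ ?_) (hsne ξ (by linarith [this.2]))
    have h3 : 0 < ‖ξ‖ := by linarith [this.1]
    exact_mod_cast (by positivity : ‖ξ‖ ^ 2 ≠ 0))
  have htg : (fun ξ : En n => ((‖ξ‖ ^ 2 : ℝ) : ℂ) ^ M).HasTemperateGrowth := by
    have h1 : (fun ξ : En n => ((‖ξ‖ ^ 2 : ℝ) : ℂ)).HasTemperateGrowth :=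
      Function.HasTemperateGrowth.comp (Complex.ofRealCLM.hasTemperateGrowth) (Function.hasTemperateGrowth_norm_sq (En n))
    exact h1.pow M
  refine ⟨s, θ, 𝓕⁻ (SchwartzMap.smulLeftCLM ℂ (fun ξ : En n => ((‖ξ‖ ^ 2 : ℝ) : ℂ) ^ M) (𝓕 Φ)), W, χ, hs0, min_le_left _ _, hχ1, ?_,
    hχs.continuous, hθ, ?_, hW⟩
  · intro ξ
    simp only [hχ, Complex.norm_real, Real.norm_eq_abs]
    rw [abs_of_nonneg b.nonneg]
    exact b.le_one
  · intro ξ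
    rw [FourierTransform.fourier_fourierInv_eq (E := SchwartzMap (En n) ℂ) (F := SchwartzMap (En n) ℂ),
      SchwartzMap.smulLeftCLM_apply_apply htg]
    rfl
end Sch


section Sch
open scoped FourierTransform SchwartzMap ContDiff

lemma cv_enorm_le {n : ℕ} (a b : SchwartzMap (En n) ℂ) (C N : ℝ) (hC : 0 < C) (h : ∀ x, ‖a x‖ ≤ C * (1 + ‖x‖) ^ (-N)) (y : En n) :
    ‖cv a b y‖ₑ ≤ ENNReal.ofReal C * ∫⁻ z, ENNReal.ofReal ((1 + ‖y - z‖) ^ (-N)) * ‖b z‖ₑ := by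
  rw [cv_apply, ← lintegral_const_mul' _ _ ENNReal.ofReal_ne_top]
  refine (enorm_integral_le_lintegral_enorm _).trans (lintegral_mono fun z => ?_)
  rw [enorm_mul, ← mul_assoc, ← ENNReal.ofReal_mul hC.le]
  gcongr
  rw [← ofReal_norm]
  exact ENNReal.ofReal_le_ofReal (h _)

lemma fourier_sum {n : ℕ} (T : ℕ → SchwartzMap (En n) ℂ) (J : ℕ) (ξ : En n) : 
    (𝓕 (∑ j ∈ Finset.range J, T j)) ξ = ∑ j ∈ Finset.range J, (𝓕 (T j)) ξ := by
  induction J with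
  | zero => simp
  | succ J ih => rw [Finset.sum_range_succ, Finset.sum_range_succ, FourierTransform.fourier_add, add_apply, ih]

lemma fourier_smul' {n : ℕ} (c : ℂ) (T : SchwartzMap (En n) ℂ) (ξ : En n) : 
    (𝓕 (c • T)) ξ = c * (𝓕 T) ξ := by
  rw [FourierTransform.fourier_smul]; rfl

lemma rychkov_one {n : ℕ} (Φ : SchwartzMap (En n) ℂ) (M : ℕ) (s : ℝ) (θ h W : SchwartzMap (En n) ℂ) (χ : En n → ℂ)
    (hs0 : 0 < s) (hs1 : s ≤ 1) (hχ1 : ∀ ξ, ‖ξ‖ ≤ 1 → χ ξ = 1) (hχb : ∀ ξ, ‖χ ξ‖ ≤ 1) (hχc : Continuous χ)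
    (hθ : ∀ ξ, (𝓕 θ) ξ * (𝓕 Φ) (s • ξ) = χ ξ) (hh : ∀ ξ, (𝓕 h) ξ = ((‖ξ‖ ^ 2 : ℝ) : ℂ) ^ M * (𝓕 Φ) ξ)
    (hW : ∀ ξ, (𝓕 W) ξ * (((‖ξ‖ ^ 2 : ℝ) : ℂ) ^ M * (𝓕 Φ) (s • ξ)) = χ ξ - χ ((2:ℝ) • ξ)) :
    ∃ C : ℝ, 0 < C ∧ ∀ (g : SchwartzMap (En n) ℂ) (y : En n),
      ‖cv Φ g y‖ₑ ≤ ∑' j : ℕ, ENNReal.ofReal (C * ((2:ℝ) ^ j) ^ (-(2 * M : ℝ))) * 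
        ∫⁻ z, ENNReal.ofReal ((1 + ‖y - z‖) ^ (-(2 * M : ℝ))) * ‖cv (dl (s * ((2:ℝ) ^ j)⁻¹) Φ) g z‖ₑ := by
  obtain ⟨C1, hC1, h1⟩ := cv_dl_decay Φ θ (2 * M) (by positivity)
  obtain ⟨C2, hC2, h2⟩ := cv_dl_decay h W (2 * M) (by positivity)
  refine ⟨max C1 C2, lt_max_of_lt_left hC1, fun g y => ?_⟩
  set τ : ℕ → ℝ := fun j => ((2:ℝ) ^ j)⁻¹ with hτ
  have hτ0 : ∀ j, 0 < τ j := fun j => by positivity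
  have hτ1 : ∀ j, τ j ≤ 1 := fun j => inv_le_one_of_one_le₀ (one_le_pow₀ (by norm_num))
  set T : ℕ → SchwartzMap (En n) ℂ := fun j => if j = 0 then cv (cv Φ (dl 1 θ)) (cv (dl (s * τ j) Φ) g)
    else (((τ j ^ 2 : ℝ) : ℂ) ^ M) • cv (cv h (dl (τ j) W)) (cv (dl (s * τ j) Φ) g) with hT
  set bd : ℕ → ℝ≥0∞ := fun j => ENNReal.ofReal (max C1 C2 * ((2:ℝ) ^ j) ^ (-(2 * M : ℝ))) * 
        ∫⁻ z, ENNReal.ofReal ((1 + ‖y - z‖) ^ (-(2 * M : ℝ))) * ‖cv (dl (s * τ j) Φ) g z‖ₑ with hbd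
  have hTb : ∀ j, ‖T j y‖ₑ ≤ bd j := by
    intro j
    simp only [hT, hbd]
    split_ifs with hj
    · refine (cv_enorm_le _ _ C1 (2 * M) hC1 (h1 1 one_pos le_rfl) y).trans ?_
      gcongr
      rw [hj]; simp
    · rw [smul_apply, enorm_smul]
      have := cv_enorm_le _ (cv (dl (s * τ j) Φ) g) C2 (2 * M) hC2 (h2 (τ j) (hτ0 j) (hτ1 j)) y
      calc _ ≤ ‖((τ j ^ 2 : ℝ) : ℂ) ^ M‖ₑ * (ENNReal.ofReal C2 * ∫⁻ z, ENNReal.ofReal ((1 + ‖y - z‖) ^ (-(2 * M : ℝ))) * ‖cv (dl (s * τ j) Φ) g z‖ₑ) := by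
            gcongr
        _ = ENNReal.ofReal (C2 * ((2:ℝ) ^ j) ^ (-(2 * M : ℝ))) * ∫⁻ z, ENNReal.ofReal ((1 + ‖y - z‖) ^ (-(2 * M : ℝ))) * ‖cv (dl (s * τ j) Φ) g z‖ₑ := by
            rw [ENNReal.ofReal_mul hC2.le]
            have : ‖((τ j ^ 2 : ℝ) : ℂ) ^ M‖ₑ = ENNReal.ofReal (((2:ℝ) ^ j) ^ (-(2 * M : ℝ))) := by
              rw [← ofReal_norm, norm_pow, Complex.norm_real, Real.norm_of_nonneg (by positivity), ← pow_mul]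
              congr 1
              rw [Real.rpow_neg (by positivity), hτ]
              have : (2 * M : ℝ) = ((2 * M : ℕ) : ℝ) := by push_cast; ring
              rw [this, Real.rpow_natCast, inv_pow]
            rw [this]; ring
        _ ≤ _ := by gcongr; exact le_max_right _ _
  have hFT : ∀ J ξ, (𝓕 (∑ j ∈ Finset.range (J + 1), T j)) ξ = (𝓕 Φ) ξ * (𝓕 g) ξ * χ (τ J • ξ) := by
    intro J ξ
    rw [fourier_sum]
    induction J with
    | zero =>
      simp only [zero_add, Finset.sum_range_one, hT, if_true]
      rw [cv_fourier, cv_fourier, cv_fourier, dl_fourier 1 one_pos, dl_fourier _ (mul_pos hs0 (hτ0 0))]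
      simp only [hτ, pow_zero, inv_one, one_smul, mul_one]
      rw [← hθ]; ring
    | succ J ih =>
      rw [Finset.sum_range_succ, ih]
      simp only [hT, Nat.succ_ne_zero, if_false]
      rw [fourier_smul', cv_fourier, cv_fourier, cv_fourier, dl_fourier _ (hτ0 _), dl_fourier _ (mul_pos hs0 (hτ0 _)), hh]
      have e := hW (τ (J + 1) • ξ)
      have e2 : (2:ℝ) • τ (J + 1) • ξ = τ J • ξ := by
        rw [smul_smul]; congr 1; simp only [hτ]; rw [pow_succ]; field_simp
      rw [e2, norm_smul, Real.norm_of_nonneg (hτ0 _).le, mul_pow, Complex.ofReal_mul, mul_pow, smul_smul] at e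
      linear_combination (𝓕 Φ) ξ * (𝓕 g) ξ * e
  have hlim : Filter.Tendsto (fun J => (∑ j ∈ Finset.range (J + 1), T j) y) Filter.atTop (nhds (cv Φ g y)) := by
    have e1 : ∀ J, (∑ j ∈ Finset.range (J + 1), T j) y = ∫ ξ, (Real.fourierChar (inner ℝ ξ y)) • ((𝓕 (cv Φ g)) ξ * χ (τ J • ξ)) := by
      intro J
      rw [inv_formula]
      congr 1; ext ξ
      rw [hFT, cv_fourier]
    simp_rw [e1]
    rw [inv_formula (cv Φ g) y]
    refine tendsto_integral_of_dominated_convergence (fun ξ => ‖(𝓕 (cv Φ g)) ξ‖) ?_ (𝓕 (cv Φ g)).integrable.norm ?_ ?_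
    · intro J
      have hc := (𝓕 (cv Φ g)).continuous
      have hc2 : Continuous fun ξ : En n => Real.fourierChar (inner ℝ ξ y) := Real.continuous_fourierChar.comp (by fun_prop)
      exact (hc2.smul (hc.mul (hχc.comp (continuous_const_smul _)))).aestronglyMeasurable
    · intro J
      refine Filter.Eventually.of_forall fun ξ => ?_
      rw [Circle.norm_smul, norm_mul]
      exact mul_le_of_le_one_right (norm_nonneg _) (hχb _)
    · refine Filter.Eventually.of_forall fun ξ => ?_
      apply Filter.Tendsto.congr' (f₁ := fun _ => Real.fourierChar (inner ℝ ξ y) • (𝓕 (cv Φ g)) ξ) _ tendsto_const_nhds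
      have ht : Filter.Tendsto (fun J : ℕ => τ J * ‖ξ‖) Filter.atTop (nhds (0 * ‖ξ‖)) := by
        apply Filter.Tendsto.mul_const
        exact tendsto_inv_atTop_zero.comp (tendsto_pow_atTop_atTop_of_one_lt (by norm_num))
      rw [zero_mul] at ht
      filter_upwards [ht.eventually (Iic_mem_nhds one_pos)] with J hJ
      rw [hχ1 _ (by rw [norm_smul, Real.norm_of_nonneg (hτ0 J).le]; exact hJ), mul_one]
  refine le_of_tendsto hlim.enorm (Filter.Eventually.of_forall fun J => ?_)
  rw [sum_apply]
  calc _ ≤ ∑ j ∈ Finset.range (J + 1), ‖T j y‖ₑ := enorm_sum_le _ _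
    _ ≤ ∑ j ∈ Finset.range (J + 1), bd j := Finset.sum_le_sum fun j _ => hTb j
    _ ≤ ∑' j, bd j := ENNReal.sum_le_tsum _
end Sch


section Sch
open scoped FourierTransform SchwartzMap ContDiff

lemma fourier_inj {n : ℕ} (a b : SchwartzMap (En n) ℂ) (h : ∀ ξ, (𝓕 a) ξ = (𝓕 b) ξ) : a = b := by
  ext y
  rw [inv_formula a, inv_formula b]
  simp_rw [h]

lemma cv_dl_scale {n : ℕ} (Φ f : SchwartzMap (En n) ℂ) (t τ : ℝ) (ht : 0 < t) (hτ : 0 < τ) :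
    cv (dl τ Φ) (dl t⁻¹ f) = dl t⁻¹ (cv (dl (t * τ) Φ) f) := by
  apply fourier_inj
  intro ξ
  rw [cv_fourier, dl_fourier _ hτ, dl_fourier _ (inv_pos.2 ht), dl_fourier _ (inv_pos.2 ht), cv_fourier, dl_fourier _ (mul_pos ht hτ),
    smul_smul, show t * τ * t⁻¹ = τ by field_simp]

lemma dl_one {n : ℕ} (Φ : SchwartzMap (En n) ℂ) : dl 1 Φ = Φ := by
  ext x; rw [dl_apply 1 one_pos]; simp

lemma dl_inv_enorm {n : ℕ} (a : SchwartzMap (En n) ℂ) (t : ℝ) (ht : 0 < t) (z : En n) :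
    ‖dl t⁻¹ a z‖ₑ = ENNReal.ofReal (t ^ n) * ‖a (t • z)‖ₑ := by
  rw [dl_apply _ (inv_pos.2 ht), enorm_smul, inv_inv, inv_pow, inv_inv, Real.enorm_of_nonneg (by positivity)]

lemma rychkov_t {n : ℕ} (Φ : SchwartzMap (En n) ℂ) (N s C : ℝ) (hs : 0 < s)
    (h : ∀ (g : SchwartzMap (En n) ℂ) (y : En n),
      ‖cv Φ g y‖ₑ ≤ ∑' j : ℕ, ENNReal.ofReal (C * ((2:ℝ) ^ j) ^ (-N)) * 
        ∫⁻ z, ENNReal.ofReal ((1 + ‖y - z‖) ^ (-N)) * ‖cv (dl (s * ((2:ℝ) ^ j)⁻¹) Φ) g z‖ₑ)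
    (f : SchwartzMap (En n) ℂ) (t : ℝ) (ht : 0 < t) (y : En n) :
    ‖cv (dl t Φ) f y‖ₑ ≤ ∑' j : ℕ, ENNReal.ofReal (C * ((2:ℝ) ^ j) ^ (-N)) * 
        ∫⁻ z, Kk n N t (y - z) * ‖cv (dl (t * (s * ((2:ℝ) ^ j)⁻¹)) Φ) f z‖ₑ := by
  have h1 := h (dl t⁻¹ f) (t⁻¹ • y)
  have e0 : cv Φ (dl t⁻¹ f) = dl t⁻¹ (cv (dl t Φ) f) := by
    have := cv_dl_scale Φ f t 1 ht one_pos
    rwa [dl_one, mul_one] at this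
  rw [e0, dl_inv_enorm _ t ht, smul_inv_smul₀ ht.ne'] at h1
  have htn : ENNReal.ofReal (t ^ n) ≠ 0 := by simp; positivity
  rw [← ENNReal.mul_le_mul_iff_right htn ENNReal.ofReal_ne_top]
  refine h1.trans (le_of_eq ?_)
  rw [← ENNReal.tsum_mul_left]
  congr 1; ext j
  have hτ : 0 < s * ((2:ℝ) ^ j)⁻¹ := by positivity
  rw [cv_dl_scale Φ f t _ ht hτ]
  set b := cv (dl (t * (s * ((2:ℝ) ^ j)⁻¹)) Φ) f with hb
  have e1 : ∀ z, ENNReal.ofReal ((1 + ‖t⁻¹ • y - z‖) ^ (-N)) * ‖dl t⁻¹ b z‖ₑ = 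
      ENNReal.ofReal (t ^ n) * (fun z => ENNReal.ofReal ((1 + ‖y - z‖ / t) ^ (-N)) * ‖b z‖ₑ) (t • z) := by
    intro z
    rw [dl_inv_enorm _ t ht]
    dsimp only
    have : ‖t⁻¹ • y - z‖ = ‖y - t • z‖ / t := by
      rw [show t⁻¹ • y - z = t⁻¹ • (y - t • z) by rw [smul_sub, inv_smul_smul₀ ht.ne'], norm_smul, norm_inv, Real.norm_of_nonneg ht.le]
      field_simp
    rw [this]; ring
  simp_rw [e1]
  rw [lintegral_const_mul' _ _ ENNReal.ofReal_ne_top, lintegral_comp_smul' (fun z => ENNReal.ofReal ((1 + ‖y - z‖ / t) ^ (-N)) * ‖b z‖ₑ) _ t ht]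
  · have e2 : ∀ z, Kk n N t (y - z) * ‖b z‖ₑ = ENNReal.ofReal |(t ^ n)⁻¹| * (ENNReal.ofReal ((1 + ‖y - z‖ / t) ^ (-N)) * ‖b z‖ₑ) := by
      intro z
      rw [Kk, abs_of_pos (by positivity), ENNReal.ofReal_mul (by positivity)]; ring
    simp_rw [e2]
    rw [lintegral_const_mul' _ _ ENNReal.ofReal_ne_top]
    ring
  · have hbm : Measurable b := b.continuous.measurable
    fun_prop

lemma Kk_hlM {n : ℕ} (a : ℝ) (ha : (n:ℝ) < a) : ∃ C : ℝ≥0∞, C ≠ ⊤ ∧ ∀ (F : En n → ℝ≥0∞), Measurable F → ∀ t, 0 < t → ∀ x,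
    ∫⁻ z, Kk n a t (x - z) * F z ≤ C * hlM F x := by
  set V := volume (Metric.closedBall (0 : En n) 1) with hV
  have hVt : V ≠ ⊤ := vol_cb_fin 0 1
  have ha0 : 0 < a := lt_of_le_of_lt (by positivity) ha
  set q : ℝ := (2:ℝ) ^ (-(a - n)) with hq
  have hq0 : 0 < q := by positivity
  have hq1 : q < 1 := Real.rpow_lt_one_of_one_lt_of_neg (by norm_num) (by linarith)
  refine ⟨ENNReal.ofReal (2 ^ a) * V * (1 - ENNReal.ofReal q)⁻¹, ?_, ?_⟩
  · have : 1 - ENNReal.ofReal q ≠ 0 := by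
      apply (tsub_pos_of_lt _).ne'
      rw [ENNReal.ofReal_lt_one]; exact hq1
    finiteness
  intro F hF t ht x
  have hpt : ∀ z, Kk n a t (x - z) * F z ≤ ∑' i : ℕ, ENNReal.ofReal ((t ^ n)⁻¹ * (2 ^ a * ((2:ℝ) ^ i) ^ (-a))) * (Metric.closedBall x (2 ^ i * t)).indicator F z := by
    intro z
    have hex : ∃ i : ℕ, ‖x - z‖ ≤ 2 ^ i * t := by
      obtain ⟨i, hi⟩ := pow_unbounded_of_one_lt (‖x - z‖ / t) (one_lt_two)
      exact ⟨i, by rw [div_lt_iff₀ ht] at hi; exact hi.le⟩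
    classical
    set i := Nat.find hex with hi
    have hi1 : ‖x - z‖ ≤ 2 ^ i * t := Nat.find_spec hex
    refine le_trans ?_ (ENNReal.le_tsum i)
    rw [indicator_of_mem (by rw [Metric.mem_closedBall, dist_comm, dist_eq_norm]; exact hi1), Kk]
    gcongr
    rw [Real.rpow_neg (by positivity), Real.rpow_neg (by positivity), ← div_eq_mul_inv, le_div_iff₀ (by positivity), inv_mul_le_iff₀ (by positivity),
      ← Real.mul_rpow (by positivity) (by positivity)]
    gcongr
    have hz : 0 ≤ ‖x - z‖ / t := by positivity
    rcases Nat.eq_zero_or_pos i with h0 | h0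
    · rw [h0]; linarith
    · have h2 : ¬ (‖x - z‖ ≤ 2 ^ (i - 1) * t) := Nat.find_min hex (by omega)
      push Not at h2
      rw [← lt_div_iff₀ ht] at h2
      have : (2:ℝ) ^ i = 2 ^ (i - 1) * 2 := by rw [← pow_succ]; congr 1; omega
      rw [this]; linarith
  calc ∫⁻ z, Kk n a t (x - z) * F z ≤ ∫⁻ z, ∑' i : ℕ, ENNReal.ofReal ((t ^ n)⁻¹ * (2 ^ a * ((2:ℝ) ^ i) ^ (-a))) * (Metric.closedBall x (2 ^ i * t)).indicator F z :=
        lintegral_mono hpt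
    _ = ∑' i : ℕ, ENNReal.ofReal ((t ^ n)⁻¹ * (2 ^ a * ((2:ℝ) ^ i) ^ (-a))) * ∫⁻ z in Metric.closedBall x (2 ^ i * t), F z := by
        rw [lintegral_tsum]
        · congr 1; ext i
          rw [lintegral_const_mul' _ _ ENNReal.ofReal_ne_top, lintegral_indicator measurableSet_closedBall]
        · exact fun i => ((hF.indicator measurableSet_closedBall).const_mul _).aemeasurable
    _ ≤ ∑' i : ℕ, (ENNReal.ofReal (2 ^ a) * V * hlM F x) * (ENNReal.ofReal q) ^ i := by
        refine ENNReal.tsum_le_tsum fun i => ?_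
        have hR : 0 < (2:ℝ) ^ i * t := by positivity
        have h1 := le_hlM F x _ hR
        rw [ENNReal.div_le_iff (vol_cb_pos x hR) (vol_cb_fin x _), vol_cb x hR.le] at h1
        calc _ ≤ ENNReal.ofReal ((t ^ n)⁻¹ * (2 ^ a * ((2:ℝ) ^ i) ^ (-a))) * (hlM F x * (ENNReal.ofReal ((2 ^ i * t) ^ n) * V)) := by gcongr
          _ = (ENNReal.ofReal ((t ^ n)⁻¹ * (2 ^ a * ((2:ℝ) ^ i) ^ (-a))) * ENNReal.ofReal ((2 ^ i * t) ^ n)) * (V * hlM F x) := by ring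
          _ = (ENNReal.ofReal (2 ^ a) * (ENNReal.ofReal q) ^ i) * (V * hlM F x) := by
            congr 1
            rw [← ENNReal.ofReal_mul (by positivity), ← ENNReal.ofReal_pow hq0.le, ← ENNReal.ofReal_mul (by positivity)]
            congr 1
            have : q ^ i = ((2:ℝ) ^ i) ^ (-a) * ((2:ℝ) ^ i) ^ n := by
              rw [hq, ← Real.rpow_natCast, ← Real.rpow_mul (by norm_num), ← Real.rpow_natCast 2 i, ← Real.rpow_mul (by norm_num), ← Real.rpow_natCast _ n, ← Real.rpow_mul (by norm_num),
                ← Real.rpow_add (by norm_num)]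
              ring_nf
            rw [this, mul_pow]
            field_simp
          _ = _ := by ring
    _ = _ := by
        rw [ENNReal.tsum_mul_left, ENNReal.tsum_geometric]; ring
end Sch


section Sch
open scoped FourierTransform SchwartzMap ContDiff

lemma radMax_eq {n : ℕ} (Φ f : SchwartzMap (En n) ℂ) (x : En n) :
    radMax n (⇑Φ) (⇑f) x = ⨆ (t : ℝ) (_ : 0 < t), ‖cv (dl t Φ) f x‖ₑ := by
  rw [radMax]
  refine iSup_congr fun t => iSup_congr fun ht => ?_
  rw [cv_apply]
  simp_rw [dl_apply t ht]
  rfl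

lemma le_radMax {n : ℕ} (Φ f : SchwartzMap (En n) ℂ) (x : En n) (t : ℝ) (ht : 0 < t) :
    ‖cv (dl t Φ) f x‖ₑ ≤ radMax n (⇑Φ) (⇑f) x := by
  rw [radMax_eq]
  exact le_iSup₂_of_le t ht le_rfl

lemma radMax_lsc {n : ℕ} (Φ f : SchwartzMap (En n) ℂ) : LowerSemicontinuous (radMax n (⇑Φ) (⇑f)) := by
  have : radMax n (⇑Φ) (⇑f) = fun x => ⨆ (t : ℝ) (_ : 0 < t), ‖cv (dl t Φ) f x‖ₑ := funext (radMax_eq Φ f)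
  rw [this]
  exact lowerSemicontinuous_iSup fun t => lowerSemicontinuous_iSup fun ht => (SchwartzMap.continuous _).enorm.lowerSemicontinuous

/-- Peetre type maximal function -/
def PA {n : ℕ} (N : ℝ) (Φ f : SchwartzMap (En n) ℂ) (x : En n) : ℝ≥0∞ :=
  ⨆ (t : ℝ) (_ : 0 < t) (y : En n), ‖cv (dl t Φ) f y‖ₑ * ENNReal.ofReal ((1 + ‖x - y‖ / t) ^ (-N))

lemma le_PA {n : ℕ} (N : ℝ) (Φ f : SchwartzMap (En n) ℂ) (x : En n) (t : ℝ) (ht : 0 < t) (y : En n) :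
    ‖cv (dl t Φ) f y‖ₑ ≤ PA N Φ f x * ENNReal.ofReal ((1 + ‖x - y‖ / t) ^ N) := by
  have h : ‖cv (dl t Φ) f y‖ₑ * ENNReal.ofReal ((1 + ‖x - y‖ / t) ^ (-N)) ≤ PA N Φ f x :=
    le_iSup₂_of_le t ht (le_iSup_of_le y le_rfl)
  have h1 : (0:ℝ) < 1 + ‖x - y‖ / t := by positivity
  calc ‖cv (dl t Φ) f y‖ₑ = ‖cv (dl t Φ) f y‖ₑ * ENNReal.ofReal ((1 + ‖x - y‖ / t) ^ (-N)) * ENNReal.ofReal ((1 + ‖x - y‖ / t) ^ N) := by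
        rw [mul_assoc, ← ENNReal.ofReal_mul (by positivity), ← Real.rpow_add h1]
        simp
    _ ≤ _ := by gcongr

lemma PA_lsc {n : ℕ} (N : ℝ) (Φ f : SchwartzMap (En n) ℂ) : LowerSemicontinuous (PA N Φ f) := by
  refine lowerSemicontinuous_iSup fun t => lowerSemicontinuous_iSup fun ht => lowerSemicontinuous_iSup fun y => ?_
  apply Continuous.lowerSemicontinuous
  refine ENNReal.continuous_const_mul (by finiteness) |>.comp ?_
  refine ENNReal.continuous_ofReal.comp ?_
  refine Continuous.rpow_const (by fun_prop) fun x => Or.inl ?_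
  have : (0:ℝ) < 1 + ‖x - y‖ / t := by positivity
  exact this.ne'

lemma PA_ne_top {n : ℕ} (N : ℝ) (hN : 0 ≤ N) (Φ f : SchwartzMap (En n) ℂ) (x : En n) : PA N Φ f x ≠ ⊤ := by
  obtain ⟨B, hB, hfB⟩ := schwartz_decay f 0
  have hI : ∫⁻ z, ‖Φ z‖ₑ ≠ ⊤ := (SchwartzMap.integrable Φ).2.ne
  refine ne_top_of_le_ne_top (b := (∫⁻ z, ‖Φ z‖ₑ) * ENNReal.ofReal B) (by finiteness) ?_
  refine iSup₂_le fun t ht => iSup_le fun y => ?_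
  have e : ∫⁻ z, ‖dl t Φ z‖ₑ = ∫⁻ z, ‖Φ z‖ₑ := by
    have := lintegral_comp_smul' (fun z => ‖Φ z‖ₑ) (by fun_prop) t⁻¹ (by positivity)
    simp_rw [dl_apply t ht, enorm_smul]
    rw [lintegral_const_mul' _ _ (by finiteness), this, ← mul_assoc, Real.enorm_of_nonneg (by positivity), ← ENNReal.ofReal_mul (by positivity)]
    have : ((t ^ n)⁻¹ * |(t⁻¹ ^ n)⁻¹|) = 1 := by
      rw [abs_of_pos (by positivity), inv_pow, inv_inv, inv_mul_cancel₀ (by positivity)]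
    rw [this]; simp
  have h1 : ENNReal.ofReal ((1 + ‖x - y‖ / t) ^ (-N)) ≤ 1 := by
    rw [ENNReal.ofReal_le_one]
    apply Real.rpow_le_one_of_one_le_of_nonpos
    · have : 0 ≤ ‖x - y‖ / t := by positivity
      linarith
    · linarith
  have h2 : ‖cv (dl t Φ) f y‖ₑ ≤ (∫⁻ z, ‖Φ z‖ₑ) * ENNReal.ofReal B := by
    rw [cv_apply, ← e, ← lintegral_sub_left_eq_self (fun z => ‖dl t Φ z‖ₑ) y, ← lintegral_mul_const' _ _ (by finiteness)]
    refine (enorm_integral_le_lintegral_enorm _).trans (lintegral_mono fun z => ?_)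
    rw [enorm_mul]
    gcongr
    rw [← ofReal_norm]
    apply ENNReal.ofReal_le_ofReal
    simpa using hfB z
  calc _ ≤ ‖cv (dl t Φ) f y‖ₑ * 1 := by gcongr
    _ ≤ _ := by rw [mul_one]; exact h2

lemma PA_hlM {n : ℕ} (Φ : SchwartzMap (En n) ℂ) (N s C r : ℝ) (hs : 0 < s) (hs1 : s ≤ 1) (hC : 0 < C) (hr : 0 < r) (hr1 : r < 1)
    (hN : (n:ℝ) < N * r) 
    (h : ∀ (g : SchwartzMap (En n) ℂ) (y : En n),
      ‖cv Φ g y‖ₑ ≤ ∑' j : ℕ, ENNReal.ofReal (C * ((2:ℝ) ^ j) ^ (-N)) * 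
        ∫⁻ z, ENNReal.ofReal ((1 + ‖y - z‖) ^ (-N)) * ‖cv (dl (s * ((2:ℝ) ^ j)⁻¹) Φ) g z‖ₑ) :
    ∃ D : ℝ≥0∞, D ≠ ⊤ ∧ ∀ (f : SchwartzMap (En n) ℂ) (x : En n),
      (PA N Φ f x) ^ r ≤ D * hlM (fun z => (radMax n (⇑Φ) (⇑f) z) ^ r) x := by
  have hNr : 0 < N * r := lt_of_le_of_lt (by positivity) hN
  have hN0 : 0 < N := pos_of_mul_pos_left hNr hr.le
  obtain ⟨Ck, hCk, hK⟩ := Kk_hlM (n := n) (N * r) hN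
  set q : ℝ := (2:ℝ) ^ (-(N * r)) with hq
  have hq0 : 0 < q := by positivity
  have hq1 : q < 1 := Real.rpow_lt_one_of_one_lt_of_neg (by norm_num) (by linarith)
  set E : ℝ≥0∞ := ENNReal.ofReal (C * (s⁻¹) ^ (N * (1 - r))) with hE
  refine ⟨E * (1 - ENNReal.ofReal q)⁻¹ * Ck, ?_, fun f x => ?_⟩
  · have : 1 - ENNReal.ofReal q ≠ 0 := by
      apply (tsub_pos_of_lt _).ne'
      rw [ENNReal.ofReal_lt_one]; exact hq1
    finiteness
  set m : En n → ℝ≥0∞ := radMax n (⇑Φ) (⇑f) with hm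
  have hmm : Measurable m := (radMax_lsc Φ f).measurable
  set A := PA N Φ f x with hA
  have hAt : A ≠ ⊤ := PA_ne_top N hN0.le Φ f x
  set H := hlM (fun z => m z ^ r) x with hH
  have key : A ≤ A ^ (1 - r) * (E * (1 - ENNReal.ofReal q)⁻¹ * Ck * H) := by
    refine iSup₂_le fun t ht => iSup_le fun y => ?_
    have hterm : ∀ (j : ℕ) (z : En n), ENNReal.ofReal ((1 + ‖x - y‖ / t) ^ (-N)) * (Kk n N t (y - z) * ‖cv (dl (t * (s * ((2:ℝ) ^ j)⁻¹)) Φ) f z‖ₑ)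
        ≤ (ENNReal.ofReal ((s⁻¹ * 2 ^ j) ^ (N * (1 - r))) * A ^ (1 - r)) * (Kk n (N * r) t (x - z) * m z ^ r) := by
      intro j z
      set τ := t * (s * ((2:ℝ) ^ j)⁻¹) with hτ
      have hτ0 : 0 < τ := by positivity
      set u := ‖cv (dl τ Φ) f z‖ₑ with hu
      have hw : (0:ℝ) < 1 + ‖x - z‖ / t := by positivity
      have h1 : u ≤ m z ^ r * (A * ENNReal.ofReal ((s⁻¹ * 2 ^ j * (1 + ‖x - z‖ / t)) ^ N)) ^ (1 - r) := by
        have e : u = u ^ r * u ^ (1 - r) := by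
          rw [← ENNReal.rpow_add_of_nonneg _ _ hr.le (by linarith)]
          simp
        rw [e]
        refine mul_le_mul' (ENNReal.rpow_le_rpow (le_radMax Φ f z τ hτ0) hr.le) (ENNReal.rpow_le_rpow ?_ (by linarith))
        refine (le_PA N Φ f x τ hτ0 z).trans ?_
        refine mul_le_mul' le_rfl (ENNReal.ofReal_le_ofReal (Real.rpow_le_rpow (by positivity) ?_ hN0.le))
        have e2 : ‖x - z‖ / τ = s⁻¹ * 2 ^ j * (‖x - z‖ / t) := by rw [hτ]; field_simp
        have e3 : 1 ≤ s⁻¹ * 2 ^ j := one_le_mul_of_one_le_of_one_le ((one_le_inv₀ hs).2 hs1) (one_le_pow₀ (by norm_num))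
        rw [e2]; linarith
      have h2 : ENNReal.ofReal ((1 + ‖x - y‖ / t) ^ (-N)) * Kk n N t (y - z) ≤ Kk n N t (x - z) := by
        rw [Kk, Kk, ← ENNReal.ofReal_mul (by positivity)]
        apply ENNReal.ofReal_le_ofReal
        rw [mul_left_comm]
        refine mul_le_mul_of_nonneg_left ?_ (by positivity)
        rw [← Real.mul_rpow (by positivity) (by positivity)]
        refine Real.rpow_le_rpow_of_nonpos hw ?_ (by linarith)
        have h3 : ‖x - z‖ ≤ ‖x - y‖ + ‖y - z‖ := norm_sub_le_norm_sub_add_norm_sub x y z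
        have h4 : ‖x - z‖ / t ≤ ‖x - y‖ / t + ‖y - z‖ / t := by rw [← add_div]; gcongr
        have h5 : 0 ≤ ‖x - y‖ / t * (‖y - z‖ / t) := by positivity
        nlinarith
      have h3 : Kk n N t (x - z) * ENNReal.ofReal ((s⁻¹ * 2 ^ j * (1 + ‖x - z‖ / t)) ^ N) ^ (1 - r) =
          ENNReal.ofReal ((s⁻¹ * 2 ^ j) ^ (N * (1 - r))) * Kk n (N * r) t (x - z) := by
        rw [ENNReal.ofReal_rpow_of_nonneg (by positivity) (by linarith), ← Real.rpow_mul (by positivity), Kk, Kk,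
          ← ENNReal.ofReal_mul (by positivity), ← ENNReal.ofReal_mul (by positivity), Real.mul_rpow (by positivity) (by positivity)]
        congr 1
        have : (1 + ‖x - z‖ / t) ^ (-(N * r)) = (1 + ‖x - z‖ / t) ^ (-N) * (1 + ‖x - z‖ / t) ^ (N * (1 - r)) := by
          rw [← Real.rpow_add hw]; ring_nf
        rw [this]; ring
      calc _ = (ENNReal.ofReal ((1 + ‖x - y‖ / t) ^ (-N)) * Kk n N t (y - z)) * u := by ring
        _ ≤ Kk n N t (x - z) * (m z ^ r * (A * ENNReal.ofReal ((s⁻¹ * 2 ^ j * (1 + ‖x - z‖ / t)) ^ N)) ^ (1 - r)) := mul_le_mul' h2 h1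
        _ = (Kk n N t (x - z) * ENNReal.ofReal ((s⁻¹ * 2 ^ j * (1 + ‖x - z‖ / t)) ^ N) ^ (1 - r)) * (m z ^ r * A ^ (1 - r)) := by
          rw [ENNReal.mul_rpow_of_nonneg _ _ (by linarith : (0:ℝ) ≤ 1 - r)]; ring
        _ = _ := by rw [h3]; ring
    calc _ = ENNReal.ofReal ((1 + ‖x - y‖ / t) ^ (-N)) * ‖cv (dl t Φ) f y‖ₑ := mul_comm _ _
      _ ≤ ENNReal.ofReal ((1 + ‖x - y‖ / t) ^ (-N)) * ∑' j : ℕ, ENNReal.ofReal (C * ((2:ℝ) ^ j) ^ (-N)) * 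
        ∫⁻ z, Kk n N t (y - z) * ‖cv (dl (t * (s * ((2:ℝ) ^ j)⁻¹)) Φ) f z‖ₑ := mul_le_mul' le_rfl (rychkov_t Φ N s C hs h f t ht y)
      _ = ∑' j : ℕ, ENNReal.ofReal (C * ((2:ℝ) ^ j) ^ (-N)) * ∫⁻ z, ENNReal.ofReal ((1 + ‖x - y‖ / t) ^ (-N)) * (Kk n N t (y - z) * ‖cv (dl (t * (s * ((2:ℝ) ^ j)⁻¹)) Φ) f z‖ₑ) := by
        rw [← ENNReal.tsum_mul_left]
        congr 1; ext j
        rw [lintegral_const_mul' _ _ (by finiteness)]; ring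
      _ ≤ ∑' j : ℕ, ENNReal.ofReal (C * ((2:ℝ) ^ j) ^ (-N)) * ((ENNReal.ofReal ((s⁻¹ * 2 ^ j) ^ (N * (1 - r))) * A ^ (1 - r)) * (Ck * H)) := by
        refine ENNReal.tsum_le_tsum fun j => mul_le_mul' le_rfl ?_
        refine (lintegral_mono (hterm j)).trans ?_
        rw [lintegral_const_mul' _ _ (ENNReal.mul_ne_top (by finiteness) (ENNReal.rpow_ne_top_of_nonneg (by linarith) hAt))]
        exact mul_le_mul' le_rfl (hK _ (hmm.pow_const r) t ht x)
      _ = ∑' j : ℕ, (A ^ (1 - r) * (E * Ck * H)) * (ENNReal.ofReal q) ^ j := by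
        congr 1; ext j
        have : ENNReal.ofReal (C * ((2:ℝ) ^ j) ^ (-N)) * ENNReal.ofReal ((s⁻¹ * 2 ^ j) ^ (N * (1 - r))) = E * ENNReal.ofReal q ^ j := by
          rw [hE, ← ENNReal.ofReal_pow hq0.le, ← ENNReal.ofReal_mul (by positivity), ← ENNReal.ofReal_mul (by positivity), Real.mul_rpow (by positivity) (by positivity)]
          congr 1
          have : q ^ j = ((2:ℝ) ^ j) ^ (-N) * ((2:ℝ) ^ j) ^ (N * (1 - r)) := by
            rw [← Real.rpow_add (by positivity), hq, ← Real.rpow_natCast, ← Real.rpow_mul (by norm_num), ← Real.rpow_natCast 2 j, ← Real.rpow_mul (by norm_num)]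
            ring_nf
          rw [this]; ring
        rw [show ENNReal.ofReal (C * ((2:ℝ) ^ j) ^ (-N)) * ((ENNReal.ofReal ((s⁻¹ * 2 ^ j) ^ (N * (1 - r))) * A ^ (1 - r)) * (Ck * H)) = (ENNReal.ofReal (C * ((2:ℝ) ^ j) ^ (-N)) * ENNReal.ofReal ((s⁻¹ * 2 ^ j) ^ (N * (1 - r)))) * (A ^ (1 - r) * (Ck * H)) by ring, this]; ring
      _ = _ := by
        rw [ENNReal.tsum_mul_left, ENNReal.tsum_geometric]; ring
  rcases eq_or_ne A 0 with h0 | h0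
  · rw [h0, ENNReal.zero_rpow_of_pos hr]; exact zero_le
  have e : A = A ^ (1 - r) * A ^ r := by
    rw [← ENNReal.rpow_add_of_nonneg _ _ (by linarith) hr.le]; simp
  conv_lhs at key => rw [e]
  rwa [ENNReal.mul_le_mul_iff_right] at key
  · exact (ENNReal.rpow_pos (pos_iff_ne_zero.2 h0) hAt).ne'
  · exact ENNReal.rpow_ne_top_of_nonneg (by linarith) hAt

lemma F_le_PA {n : ℕ} (Φ θ : SchwartzMap (En n) ℂ) (N s : ℝ) (hs : 0 < s) (hs1 : s ≤ 1) (hN : 0 ≤ N) :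
    ∃ c : ℝ≥0∞, c ≠ ⊤ ∧ ∀ (f : SchwartzMap (En n) ℂ) (ε : ℝ), 0 < ε → ∀ x y, dist x y ≤ ε →
      ‖cv (dl ε (cv θ (dl s Φ))) f y‖ₑ ≤ c * PA N Φ f x := by
  obtain ⟨C, hC, hθ⟩ := schwartz_decay θ (N + (n + 1))
  have hfin : ∫⁻ z : En n, Kk n ((n:ℝ) + 1) 1 z ≠ ⊤ := Kk_int_fin _ (by linarith)
  set c : ℝ≥0∞ := ENNReal.ofReal (C * (2 / s) ^ N) * ∫⁻ z : En n, Kk n ((n:ℝ) + 1) 1 z with hc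
  refine ⟨c, by finiteness, fun f ε hε x y hxy => ?_⟩
  have e : cv (dl ε (cv θ (dl s Φ))) f = cv (dl ε θ) (cv (dl (ε * s) Φ) f) := by
    apply fourier_inj
    intro ξ
    rw [cv_fourier, cv_fourier, cv_fourier, dl_fourier _ hε, dl_fourier _ hε, cv_fourier, dl_fourier _ hs, dl_fourier _ (by positivity), smul_smul, mul_comm s ε, mul_assoc]
  rw [e, cv_apply]
  have hpt : ∀ z, ‖dl ε θ (y - z) * cv (dl (ε * s) Φ) f z‖ₑ ≤ (ENNReal.ofReal (C * (2 / s) ^ N) * PA N Φ f x) * Kk n ((n:ℝ) + 1) ε (y - z) := by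
    intro z
    rw [enorm_mul]
    set w := 1 + ‖y - z‖ / ε with hw
    have hw0 : 0 < w := by positivity
    have h1 : ‖dl ε θ (y - z)‖ₑ ≤ ENNReal.ofReal ((ε ^ n)⁻¹ * (C * w ^ (-(N + (n + 1))))) := by
      rw [← ofReal_norm, dl_apply ε hε, norm_smul, Real.norm_of_nonneg (by positivity)]
      apply ENNReal.ofReal_le_ofReal
      refine mul_le_mul_of_nonneg_left ((hθ _).trans_eq ?_) (by positivity)
      rw [norm_smul, Real.norm_of_nonneg (by positivity), hw, inv_mul_eq_div]
    have h2 : ‖cv (dl (ε * s) Φ) f z‖ₑ ≤ PA N Φ f x * ENNReal.ofReal ((2 / s * w) ^ N) := by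
      refine (le_PA N Φ f x (ε * s) (by positivity) z).trans ?_
      refine mul_le_mul' le_rfl (ENNReal.ofReal_le_ofReal (Real.rpow_le_rpow (by positivity) ?_ hN))
      have h3 : ‖x - z‖ ≤ ε + ‖y - z‖ := by
        refine (norm_sub_le_norm_sub_add_norm_sub x y z).trans ?_
        rw [dist_eq_norm] at hxy; linarith
      rw [hw, div_mul_eq_mul_div, le_div_iff₀ hs, add_mul, ← div_div, div_mul_cancel₀ _ hs.ne']
      have h4 : ‖x - z‖ / ε ≤ 1 + ‖y - z‖ / ε := by
        rw [div_le_iff₀ hε, add_mul, div_mul_cancel₀ _ hε.ne']; linarith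
      have : 0 ≤ ‖y - z‖ / ε := by positivity
      first
      | nlinarith
      | (rw [mul_one]; nlinarith)
    refine (mul_le_mul' h1 h2).trans_eq ?_
    rw [Kk, Real.mul_rpow (by positivity) (by positivity)]
    have : w ^ (-((n:ℝ) + 1)) = w ^ (-(N + (n + 1))) * w ^ N := by
      rw [← Real.rpow_add hw0]; ring_nf
    rw [← hw, this, mul_left_comm, ← ENNReal.ofReal_mul (by positivity), mul_comm (ENNReal.ofReal _) (PA N Φ f x), mul_assoc (PA N Φ f x), ← ENNReal.ofReal_mul (by positivity)]
    congr 2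
    ring
  refine (enorm_integral_le_lintegral_enorm _).trans ((lintegral_mono hpt).trans ?_)
  have hm : Measurable (fun z => Kk n ((n:ℝ) + 1) ε (y - z)) := (Kk_meas n _ ε).comp (by fun_prop)
  rw [lintegral_const_mul _ hm, lintegral_sub_left_eq_self (fun z => Kk n ((n:ℝ)+1) ε z) y, Kk_int _ ε hε, hc]
  exact le_of_eq (by ring)
end Sch


section Sch
open scoped FourierTransform SchwartzMap ContDiff

lemma exp_norm_one (a : ℝ) : ‖Complex.exp (-(2 * Real.pi) * Complex.I * (a : ℂ))‖ = 1 := by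
  have : -(2 * (Real.pi:ℂ)) * Complex.I * (a : ℂ) = ((-(2 * Real.pi) * a : ℝ) : ℂ) * Complex.I := by push_cast; ring
  rw [this, Complex.norm_exp_ofReal_mul_I]

lemma brMeans_fourier {n : ℕ} (δ : ℝ) (hδ : 0 < δ) (ε : ℝ) (g : SchwartzMap (En n) ℂ) (x : En n) :
    brMeans n δ ε (⇑g) x = ((ε ^ n)⁻¹ : ℝ) • ∫ ξ : En n, (((max (1 - ‖ξ‖ ^ 2) 0) ^ δ : ℝ) : ℂ) *
      (Complex.exp (-(2 * Real.pi) * Complex.I * ((∑ i, (ε⁻¹ • x) i * ξ i : ℝ) : ℂ)) * (𝓕 g) (-(ε⁻¹ • ξ))) := by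
  set M : En n → ℂ := fun ξ => (((max (1 - ‖ξ‖ ^ 2) 0) ^ δ : ℝ) : ℂ) with hM
  have hMi : Integrable M := br_mult_integrable n δ hδ
  set P : En n → En n → ℂ := fun y ξ => Complex.exp (-(2 * Real.pi) * Complex.I * ((∑ i, (ε⁻¹ • (x - y)) i * ξ i : ℝ) : ℂ)) with hP
  have hPn : ∀ y ξ, ‖P y ξ‖ = 1 := fun y ξ => exp_norm_one _
  have hPc : Continuous (Function.uncurry P) := by
    unfold Function.uncurry
    simp only [hP]
    fun_prop
  have hIntg : Integrable (Function.uncurry fun y ξ => g y * (M ξ * P y ξ)) (volume.prod volume) := by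
    have h1 : Integrable (fun z : En n × En n => g z.1 * M z.2) (volume.prod volume) := (SchwartzMap.integrable g).mul_prod hMi
    have h2 := h1.mul_bdd (g := Function.uncurry P) (c := 1) hPc.aestronglyMeasurable (Filter.Eventually.of_forall fun z => (hPn z.1 z.2).le)
    refine h2.congr (Filter.Eventually.of_forall fun z => ?_)
    simp only [Function.uncurry]
    ring
  have e1 : brMeans n δ ε (⇑g) x = ((ε ^ n)⁻¹ : ℝ) • ∫ y, ∫ ξ, g y * (M ξ * P y ξ) := by
    rw [brMeans, ← integral_smul]
    congr 1; ext y
    rw [brKernelDil, brKernel, integral_const_mul, mul_smul_comm]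
  rw [e1, integral_integral_swap hIntg]
  congr 2
  ext ξ
  have : ∀ y, g y * (M ξ * P y ξ) = M ξ * (Complex.exp (-(2 * Real.pi) * Complex.I * ((∑ i, (ε⁻¹ • x) i * ξ i : ℝ) : ℂ)) * (Real.fourierChar (-inner ℝ y (-(ε⁻¹ • ξ))) • g y)) := by
    intro y
    have : P y ξ = Complex.exp (-(2 * Real.pi) * Complex.I * ((∑ i, (ε⁻¹ • x) i * ξ i : ℝ) : ℂ)) * (Real.fourierChar (-inner ℝ y (-(ε⁻¹ • ξ))) : ℂ) := by
      rw [Real.fourierChar_apply, ← Complex.exp_add]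
      simp only [hP]
      congr 1
      have e : (∑ i, (ε⁻¹ • (x - y)) i * ξ i : ℝ) = (∑ i, (ε⁻¹ • x) i * ξ i : ℝ) - inner ℝ y (ε⁻¹ • ξ) := by
        rw [PiLp.inner_apply, ← Finset.sum_sub_distrib]
        refine Finset.sum_congr rfl fun i _ => ?_
        simp
        ring
      rw [e, inner_neg_right, neg_neg]
      push_cast
      ring
    rw [this, Circle.smul_def, smul_eq_mul]
    ring
  simp_rw [this]
  rw [integral_const_mul, integral_const_mul, SchwartzMap.fourier_coe, Real.fourier_eq]

lemma brMeans_repr {n : ℕ} (δ : ℝ) (hδ : 0 < δ) (ε : ℝ) (hε : 0 < ε) (Ψ f : SchwartzMap (En n) ℂ)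
    (hΨ : ∀ ξ, ‖ξ‖ ≤ 1 → (𝓕 Ψ) ξ = 1) (x : En n) :
    brMeans n δ ε (⇑f) x = brMeans n δ ε (⇑(cv (dl ε Ψ) f)) x := by
  rw [brMeans_fourier δ hδ, brMeans_fourier δ hδ]
  congr 2
  ext ξ
  rcases le_or_gt ‖ξ‖ 1 with h | h
  · rw [cv_fourier, dl_fourier _ hε, hΨ, one_mul]
    rw [smul_neg, smul_smul, mul_inv_cancel₀ hε.ne', one_smul, norm_neg]; exact h
  · have : max (1 - ‖ξ‖ ^ 2) 0 = 0 := max_eq_right (by nlinarith)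
    rw [this, Real.zero_rpow hδ.ne']; simp

lemma brMeans_le {n : ℕ} (hn : 1 ≤ n) (δ : ℝ) (hδ : 0 < δ) : ∃ C : ℝ, 0 < C ∧ ∀ (Ψ f : SchwartzMap (En n) ℂ),
    (∀ ξ, ‖ξ‖ ≤ 1 → (𝓕 Ψ) ξ = 1) → ∀ (ε : ℝ), 0 < ε → ∀ x, 
    ‖brMeans n δ ε (⇑f) x‖ₑ ≤ ENNReal.ofReal C * ∫⁻ y, ‖cv (dl ε Ψ) f y‖ₑ * Kk n (((n:ℝ) + 1) / 2 + δ) ε (x - y) := by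
  obtain ⟨C, hC, hd⟩ := brKernel_decay n hn δ hδ
  refine ⟨C, hC, fun Ψ f hΨ ε hε x => ?_⟩
  rw [brMeans_repr δ hδ ε hε Ψ f hΨ, brMeans, ← lintegral_const_mul' _ _ ENNReal.ofReal_ne_top]
  refine (enorm_integral_le_lintegral_enorm _).trans (lintegral_mono fun y => ?_)
  rw [enorm_mul, mul_left_comm]
  refine mul_le_mul' le_rfl ?_
  rw [brKernelDil, ← ofReal_norm, norm_smul, Kk, ← ENNReal.ofReal_mul hC.le, Real.norm_of_nonneg (by positivity), mul_left_comm]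
  apply ENNReal.ofReal_le_ofReal
  refine mul_le_mul_of_nonneg_left ((hd _).trans_eq ?_) (by positivity)
  rw [norm_smul, Real.norm_of_nonneg (by positivity), inv_mul_eq_div]
end Sch


lemma hlM_const_mul_le {n : ℕ} (c : ℝ≥0∞) (hc : c ≠ ⊤) (g : En n → ℝ≥0∞) (x : En n) :
    hlM (fun y => c * g y) x ≤ c * hlM g x := by
  refine iSup₂_le fun R hR => ?_
  rw [lintegral_const_mul' _ _ hc, mul_div_assoc]
  exact mul_le_mul' le_rfl (le_hlM g x R hR)

lemma LH_small {C η d : ℝ} (hC : 0 < C) (hη : 0 < η) (hd : Real.exp (C / η) ≤ d) : C / Real.log (Real.exp 1 + d) < η := by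
  have h1 : C / η < Real.log (Real.exp 1 + d) := by
    rw [Real.lt_log_iff_exp_lt (by positivity [hd.trans' (Real.exp_pos (C/η)).le])]
    linarith [Real.exp_pos 1]
  have h2 : 0 < C / η := by positivity
  rw [div_lt_iff₀ (h2.trans h1)]
  rw [div_lt_iff₀ hη] at h1
  linarith

lemma p_lower {n : ℕ} (p : En n → ℝ) (C pinf : ℝ) (hp : LH n p C pinf) (h0 : ∀ x, 0 < p x) (p₀ : ℝ)
    (hlow : p₀ ≤ essInf p volume) (x : En n) : p₀ ≤ p x := by
  by_contra hx
  push Not at hx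
  have hae : ∀ᵐ y, essInf p volume ≤ p y := by
    apply ae_essInf_le
    exact ⟨0, Filter.eventually_map.2 (Filter.Eventually.of_forall fun y => (h0 y).le)⟩
  set η := p₀ - p x with hη
  have hη0 : 0 < η := by linarith
  set ρ := (Real.exp (C / η))⁻¹ with hρ
  have hρ0 : 0 < ρ := by positivity
  have hsub : ∀ y ∈ Metric.ball x ρ, ¬ (essInf p volume ≤ p y) := by
    intro y hy hle
    rcases eq_or_ne y x with rfl | hne
    · linarith
    have h1 := hp.2.1 y x
    have hd : 0 < ‖y - x‖ := norm_pos_iff.2 (sub_ne_zero.2 hne)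
    rw [Metric.mem_ball, dist_eq_norm] at hy
    have h2 : Real.exp (C / η) ≤ 1 / ‖y - x‖ := by
      rw [le_div_iff₀ hd]
      calc Real.exp (C / η) * ‖y - x‖ ≤ Real.exp (C / η) * ρ := by gcongr
        _ = 1 := mul_inv_cancel₀ (Real.exp_pos _).ne'
    have h3 := LH_small hp.1 hη0 h2
    have := abs_lt.1 (h1.trans_lt h3)
    linarith [this.2]
  have hz : volume (Metric.ball x ρ) = 0 := measure_mono_null hsub hae
  exact (Metric.measure_ball_pos volume x hρ0).ne' hz

lemma pinf_lower {n : ℕ} (hn : 1 ≤ n) (p : En n → ℝ) (C pinf : ℝ) (hp : LH n p C pinf) (p₀ : ℝ)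
    (h : ∀ x, p₀ ≤ p x) : p₀ ≤ pinf := by
  by_contra hx
  push Not at hx
  have hη0 : 0 < p₀ - pinf := by linarith
  have h1 := hp.2.2 (EuclideanSpace.single (⟨0, hn⟩ : Fin n) (Real.exp (C / (p₀ - pinf))))
  have h2 := LH_small hp.1 hη0 (d := ‖(EuclideanSpace.single (⟨0, hn⟩ : Fin n) (Real.exp (C / (p₀ - pinf))) : En n)‖) (by
    rw [EuclideanSpace.norm_single, Real.norm_of_nonneg (Real.exp_pos _).le])
  have := abs_lt.1 (h1.trans_lt h2)
  linarith [this.2, h (EuclideanSpace.single (⟨0, hn⟩ : Fin n) (Real.exp (C / (p₀ - pinf))))]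

/-- rescaling of a modular bound -/
lemma rescale_pt (K : ℝ≥0∞) (hK : K ≠ ⊤) (hK1 : 1 ≤ K) (p₀ e : ℝ) (hp₀ : 0 < p₀) (he : p₀ ≤ e) (u : ℝ≥0∞) :
    (u / K ^ (1 / p₀)) ^ e ≤ u ^ e * K⁻¹ := by
  rw [div_eq_mul_inv, ENNReal.mul_rpow_of_nonneg _ _ (by linarith), ENNReal.inv_rpow, ← ENNReal.rpow_mul]
  gcongr
  conv_lhs => rw [← ENNReal.rpow_one K]
  apply ENNReal.rpow_le_rpow_of_exponent_le hK1
  rw [one_div_mul_eq_div, le_div_iff₀ hp₀]; linarith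

lemma PA_modular {n : ℕ} (hn : 1 ≤ n) (p : En n → ℝ) (hpm : Measurable p) (C pinf : ℝ) (hp : LH n p C pinf)
    (p₀ : ℝ) (hp₀ : 0 < p₀) (hpb : ∀ x, p₀ ≤ p x ∧ p x ≤ 1) (hpi : p₀ ≤ pinf) (D : ℝ≥0∞) (hD : D ≠ ⊤) :
    ∃ K : ℝ≥0∞, K ≠ ⊤ ∧ 1 ≤ K ∧ ∀ (A m : En n → ℝ≥0∞) (lam : ℝ≥0∞), 0 < lam → lam < ⊤ → Measurable m →
      (∀ x, A x ^ (p₀ / 2) ≤ D * hlM (fun z => m z ^ (p₀ / 2)) x) → (∫⁻ x, (m x / lam) ^ (p x)) ≤ 1 →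
      ∫⁻ x, (A x / lam) ^ (p x) ≤ K := by
  have hs : LH n (fun x => p x / p₀) (C / p₀) (pinf / p₀) := by
    refine ⟨div_pos hp.1 hp₀, fun x y => ?_, fun x => ?_⟩
    · rw [← sub_div, abs_div, abs_of_pos hp₀, div_right_comm]
      exact div_le_div_of_nonneg_right (hp.2.1 x y) hp₀.le
    · rw [← sub_div, abs_div, abs_of_pos hp₀, div_right_comm]
      exact div_le_div_of_nonneg_right (hp.2.2 x) hp₀.le
  obtain ⟨Kd, hKd⟩ := diening hn (fun x => p x / p₀) (hpm.div_const p₀) (C / p₀) (pinf / p₀) (1 / p₀) hs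
    (fun x => by rw [le_div_iff₀ hp₀]; linarith [(hpb x).1])
    (fun x => by gcongr; exact (hpb x).2)
    (by rw [le_div_iff₀ hp₀]; linarith)
  have hD1 : max 1 D ≠ ⊤ := by simp [hD]
  refine ⟨max 1 ((max 1 D) ^ (2 * (1 / p₀)) * Kd), ?_, le_max_left _ _, ?_⟩
  · have : (max 1 D) ^ (2 * (1 / p₀)) ≠ ⊤ := ENNReal.rpow_ne_top_of_nonneg (by positivity) hD1
    have h2 : (max 1 D) ^ (2 * (1 / p₀)) * Kd ≠ ⊤ := by finiteness
    exact (max_lt ENNReal.one_lt_top h2.lt_top).ne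
  intro A m lam hl0 hl1 hm hA hml
  refine le_trans ?_ (le_max_right _ _)
  set r := p₀ / 2 with hr
  have hr0 : 0 < r := by positivity
  set g : En n → ℝ≥0∞ := fun z => (m z / lam) ^ r with hg
  have hgm : Measurable g := (hm.div_const lam).pow_const r
  have he : ∀ (u : ℝ≥0∞) (x : En n), (u ^ r) ^ (2 * (p x / p₀)) = u ^ (p x) := by
    intro u x
    rw [← ENNReal.rpow_mul]; congr 1; rw [hr]; field_simp
  have h1 : ∫⁻ y, (g y) ^ (2 * (p y / p₀)) ≤ 1 := by
    simp only [hg, he]; exact hml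
  have h2 := hKd g hgm h1
  have hpt : ∀ x, (A x / lam) ^ r ≤ D * hlM g x := by
    intro x
    have e : (fun z => m z ^ r) = fun z => lam ^ r * g z := by
      ext z
      rw [hg, ← ENNReal.mul_rpow_of_nonneg _ _ hr0.le, ENNReal.mul_div_cancel hl0.ne' hl1.ne]
    have h3 := hA x
    rw [e] at h3
    have hlt : lam ^ r ≠ ⊤ := ENNReal.rpow_ne_top_of_nonneg hr0.le hl1.ne
    have hl0' : lam ^ r ≠ 0 := (ENNReal.rpow_pos hl0 hl1.ne).ne'
    rw [ENNReal.div_rpow_of_nonneg _ _ hr0.le, ENNReal.div_le_iff hl0' hlt]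
    refine h3.trans ((mul_le_mul' le_rfl (hlM_const_mul_le _ hlt g x)).trans_eq (by ring))
  calc ∫⁻ x, (A x / lam) ^ (p x) ≤ ∫⁻ x, (max 1 D) ^ (2 * (1 / p₀)) * (hlM g x) ^ (2 * (p x / p₀)) := by
        refine lintegral_mono fun x => ?_
        have hpx : 0 ≤ p x := hp₀.le.trans (hpb x).1
        have hpx' : 0 ≤ 2 * (p x / p₀) := by positivity
        rw [← he]
        refine (ENNReal.rpow_le_rpow (hpt x) hpx').trans ?_
        rw [ENNReal.mul_rpow_of_nonneg _ _ hpx']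
        refine mul_le_mul' ?_ le_rfl
        refine (ENNReal.rpow_le_rpow (le_max_right 1 D) hpx').trans ?_
        apply ENNReal.rpow_le_rpow_of_exponent_le (le_max_left _ _)
        gcongr
        exact (hpb x).2
    _ = (max 1 D) ^ (2 * (1 / p₀)) * ∫⁻ x, (hlM g x) ^ (2 * (p x / p₀)) := by
        rw [lintegral_const_mul' _ _ (ENNReal.rpow_ne_top_of_nonneg (by positivity) hD1)]
    _ ≤ _ := by gcongr

section Sch
open scoped FourierTransform SchwartzMap ContDiff

lemma core_weak {n : ℕ} (hn : 1 ≤ n) (δ : ℝ) (hδ : 0 < δ) (p : En n → ℝ) (hpm : Measurable p) (C pinf : ℝ) (hp : LH n p C pinf)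
    (p₀ : ℝ) (hp₀ : 0 < p₀) (hp₀1 : p₀ < 1) (hpb : ∀ x, p₀ ≤ p x ∧ p x ≤ 1) (hpi : p₀ ≤ pinf) 
    (ha : (n:ℝ) / p₀ = ((n:ℝ) + 1) / 2 + δ)
    (Φ : SchwartzMap (En n) ℂ) (hΦ : (∫ x, Φ x) ≠ 0) :
    ∃ c K : ℝ≥0∞, c ≠ 0 ∧ c ≠ ⊤ ∧ K ≠ ⊤ ∧ 1 ≤ K ∧ ∀ (f : SchwartzMap (En n) ℂ) (lam : ℝ≥0∞), 0 < lam → lam < ⊤ →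
      (∫⁻ x, (radMax n (⇑Φ) (⇑f) x / lam) ^ (p x)) ≤ 1 → ∀ β : ℝ, 0 < β →
      ∫⁻ x in {x | c * lam * ENNReal.ofReal β < brMax n δ (⇑f) x}, (ENNReal.ofReal β) ^ (p x) ≤ K := by
  have hn0 : (0:ℝ) < n := by exact_mod_cast hn
  obtain ⟨M, hM⟩ := exists_nat_gt ((n:ℝ) / p₀)
  have hN : (n:ℝ) < (2 * M : ℝ) * (p₀ / 2) := by
    rw [div_lt_iff₀ hp₀] at hM; linarith
  obtain ⟨s, θ, h, W, χ, hs0, hs1, hχ1, hχb, hχc, hθ, hh, hW⟩ := exists_symbols Φ hΦ M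
  obtain ⟨Cr, hCr, hry⟩ := rychkov_one Φ M s θ h W χ hs0 hs1 hχ1 hχb hχc hθ hh hW
  obtain ⟨D, hD, hPA⟩ := PA_hlM Φ (2 * M) s Cr (p₀ / 2) hs0 hs1 hCr (by positivity) (by linarith) hN hry
  obtain ⟨cF, hcF, hF⟩ := F_le_PA Φ θ (2 * M) s hs0 hs1 (by positivity)
  obtain ⟨K1, hK1, hK11, hmod⟩ := PA_modular hn p hpm C pinf hp p₀ hp₀ hpb hpi D hD
  obtain ⟨Cb, hCb, hbr⟩ := brMeans_le hn δ hδ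
  obtain ⟨Ks, hKs, hsmall⟩ := weak_small hn p hpm C pinf hp p₀ hp₀ hp₀1 hpb hpi
  obtain ⟨Kl, hKl, hlarge⟩ := weak_large hn p hpm C pinf hp p₀ hp₀ hp₀1 hpb
  set I : ℝ≥0∞ := ∫⁻ z : En n, Kk n (n / p₀) 1 z with hI
  have hIt : I ≠ ⊤ := Kk_int_fin _ (by rw [lt_div_iff₀ hp₀]; nlinarith)
  set L : ℝ≥0∞ := K1 ^ (1 / p₀) with hL
  have hLt : L ≠ ⊤ := ENNReal.rpow_ne_top_of_nonneg (by positivity) hK1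
  have hL0 : L ≠ 0 := (ENNReal.rpow_pos (by exact lt_of_lt_of_le one_pos hK11) hK1).ne'
  set c := max 1 cF with hc
  have hct : c ≠ ⊤ := by simp [hc, hcF]
  have hc0 : c ≠ 0 := (lt_of_lt_of_le one_pos (le_max_left 1 cF)).ne'
  have hCb0 : ENNReal.ofReal Cb ≠ 0 := by simpa using hCb
  refine ⟨ENNReal.ofReal Cb * (c * L) * (I + 2), max 1 (max Ks Kl), ?_, by finiteness, ?_, le_max_left _ _, ?_⟩
  · exact mul_ne_zero (mul_ne_zero hCb0 (mul_ne_zero hc0 hL0)) (by simp)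
  · simp [hKs, hKl]
  intro f lam hl0 hl1 hml β hβ
  have hA1 := hmod (PA (2 * M) Φ f) (radMax n (⇑Φ) (⇑f)) lam hl0 hl1 (radMax_lsc Φ f).measurable (hPA f) hml
  set A : En n → ℝ≥0∞ := fun x => PA (2 * M) Φ f x / lam / L with hA
  have hAl : LowerSemicontinuous A := by
    have : Continuous fun u : ℝ≥0∞ => u / lam / L := by
      simp only [div_eq_mul_inv]
      exact (ENNReal.continuous_mul_const (by simp [hL0])).comp (ENNReal.continuous_mul_const (by simp [hl0.ne']))
    refine this.comp_lowerSemicontinuous (PA_lsc _ Φ f) ?_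
    intro a b hab
    simp only
    gcongr
  have hAm : ∫⁻ x, (A x) ^ (p x) ≤ 1 := by
    calc ∫⁻ x, (A x) ^ (p x) ≤ ∫⁻ x, (PA (2 * M) Φ f x / lam) ^ (p x) * K1⁻¹ :=
          lintegral_mono fun x => rescale_pt K1 hK1 hK11 p₀ (p x) hp₀ (hpb x).1 _
      _ = (∫⁻ x, (PA (2 * M) Φ f x / lam) ^ (p x)) * K1⁻¹ := by
          rw [lintegral_mul_const' _ _ (by simp [(lt_of_lt_of_le one_pos hK11).ne'])]
      _ ≤ K1 * K1⁻¹ := by gcongr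
      _ ≤ 1 := ENNReal.mul_inv_le_one K1
  set Ψ := cv θ (dl s Φ) with hΨ
  have hΨ1 : ∀ ξ, ‖ξ‖ ≤ 1 → (𝓕 Ψ) ξ = 1 := by
    intro ξ hξ
    rw [hΨ, cv_fourier, dl_fourier _ hs0, hθ, hχ1 ξ hξ]
  set b := c * (lam * L) with hb
  have hb0 : b ≠ 0 := mul_ne_zero hc0 (mul_ne_zero hl0.ne' hL0)
  have hlt : lam ≠ ⊤ := hl1.ne
  have hbt : b ≠ ⊤ := by finiteness
  set F : ℝ → En n → ℝ≥0∞ := fun ε y => ‖cv (dl ε Ψ) f y‖ₑ / b with hFd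
  have hFt : ∀ ε y, F ε y ≠ ⊤ := fun ε y => ENNReal.div_ne_top (by finiteness) hb0
  have hFA : ∀ ε, 0 < ε → ∀ x y, dist x y ≤ ε → F ε y ≤ A x := by
    intro ε hε x y hxy
    have h1 := hF f ε hε x y hxy
    have h2 : ‖cv (dl ε Ψ) f y‖ₑ ≤ c * PA (2 * M) Φ f x := h1.trans (mul_le_mul' (le_max_right _ _) le_rfl)
    calc F ε y ≤ (c * PA (2 * M) Φ f x) / b := ENNReal.div_le_div_right h2 _
      _ = PA (2 * M) Φ f x / (lam * L) := ENNReal.mul_div_mul_left _ _ hc0 hct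
      _ = A x := by
        rw [hA]
        simp only [div_eq_mul_inv]
        rw [ENNReal.mul_inv (Or.inl hl0.ne') (Or.inl hlt), mul_assoc]
  have hsub : {x | ENNReal.ofReal Cb * (c * L) * (I + 2) * lam * ENNReal.ofReal β < brMax n δ (⇑f) x} ⊆
      {x | (I + 2) * ENNReal.ofReal β < ⨆ (ε : ℝ) (_ : 0 < ε), ∫⁻ y, F ε y * Kk n (n / p₀) ε (x - y)} := by
    intro x hx
    have hx' : ENNReal.ofReal Cb * (c * L) * (I + 2) * lam * ENNReal.ofReal β < brMax n δ (⇑f) x := hx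
    have h1 : brMax n δ (⇑f) x ≤ (ENNReal.ofReal Cb * b) * ⨆ (ε : ℝ) (_ : 0 < ε), ∫⁻ y, F ε y * Kk n (n / p₀) ε (x - y) := by
      refine iSup₂_le fun ε hε => ?_
      refine (hbr Ψ f hΨ1 ε hε x).trans ?_
      rw [mul_assoc]
      refine mul_le_mul' le_rfl ?_
      rw [← ha]
      have e : ∫⁻ y, ‖cv (dl ε Ψ) f y‖ₑ * Kk n (n / p₀) ε (x - y) = b * ∫⁻ y, F ε y * Kk n (n / p₀) ε (x - y) := by
        rw [← lintegral_const_mul' _ _ hbt]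
        congr 1; ext y
        rw [← mul_assoc, hFd, ENNReal.mul_div_cancel hb0 hbt]
      rw [e]
      exact mul_le_mul' le_rfl (le_iSup₂_of_le ε hε le_rfl)
    have h2 := hx'.trans_le h1
    have e2 : ENNReal.ofReal Cb * (c * L) * (I + 2) * lam * ENNReal.ofReal β = (ENNReal.ofReal Cb * b) * ((I + 2) * ENNReal.ofReal β) := by
      rw [hb]; ring
    rw [e2] at h2
    exact lt_of_mul_lt_mul_left' h2
  refine (lintegral_mono_set hsub).trans ?_
  rcases le_total β 1 with h1 | h1
  · exact (hsmall A hAl hAm F hFt hFA β hβ h1).trans ((le_max_left _ _).trans (le_max_right _ _))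
  · exact (hlarge A hAl hAm F hFt hFA β h1).trans ((le_max_right _ _).trans (le_max_right _ _))
end Sch

theorem main' {n : ℕ} (hn : 1 ≤ n) (δ : ℝ)
    (hδ : ((n : ℝ) - 1) / 2 < δ)
    (p : En n → ℝ) (hpmeas : Measurable p)
    (hp : ∀ x, 0 < p x ∧ p x ≤ 1)
    (hlogH : GlobalLogHolder n p)
    (hlow : 2 * (n : ℝ) / ((n : ℝ) + 1 + 2 * δ) ≤ essInf p volume)
    (Φ : SchwartzMap (En n) ℂ) (hΦ : (∫ x, Φ x) ≠ 0) :
    ∃ C : ℝ≥0, 0 < C ∧ ∀ f : SchwartzMap (En n) ℂ,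
      vlWQ n p (brMax n δ (⇑f)) ≤
        (C : ℝ≥0∞) * vlQ n p (radMax n (⇑Φ) (⇑f)) := by
  have hn1 : (1:ℝ) ≤ n := by exact_mod_cast hn
  have hδ0 : 0 < δ := by linarith
  set p₀ : ℝ := 2 * (n : ℝ) / ((n : ℝ) + 1 + 2 * δ) with hp₀d
  have hp₀ : 0 < p₀ := by positivity
  have hp₀1 : p₀ < 1 := by rw [hp₀d, div_lt_one (by positivity)]; linarith
  have ha : (n:ℝ) / p₀ = ((n:ℝ) + 1) / 2 + δ := by rw [hp₀d]; field_simp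
  obtain ⟨C₀, pinf, hC₀, hL1, hL2⟩ := hlogH
  have hLH : LH n p C₀ pinf := by
    refine ⟨hC₀, fun x y => ?_, hL2⟩
    rcases eq_or_ne x y with rfl | hne
    · simp only [sub_self, abs_zero, norm_zero, div_zero, add_zero, Real.log_exp, div_one]; exact hC₀.le
    · exact hL1 x y hne
  have hpl : ∀ x, p₀ ≤ p x := p_lower p C₀ pinf hLH (fun x => (hp x).1) p₀ hlow
  have hpi : p₀ ≤ pinf := pinf_lower hn p C₀ pinf hLH p₀ hpl
  obtain ⟨c, K, hc0, hct, hKt, hK1, hcore⟩ := core_weak hn δ hδ0 p hpmeas C₀ pinf hLH p₀ hp₀ hp₀1 (fun x => ⟨hpl x, (hp x).2⟩) hpi ha Φ hΦ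
  set L : ℝ≥0∞ := K ^ (1 / p₀) with hL
  have hLt : L ≠ ⊤ := ENNReal.rpow_ne_top_of_nonneg (by positivity) hKt
  have hL0 : L ≠ 0 := (ENNReal.rpow_pos (by exact lt_of_lt_of_le one_pos hK1) hKt).ne'
  have hLct : L * c ≠ ⊤ := by finiteness
  have hLc0 : L * c ≠ 0 := mul_ne_zero hL0 hc0
  refine ⟨(L * c).toNNReal, ENNReal.toNNReal_pos hLc0 hLct, fun f => ?_⟩
  rw [ENNReal.coe_toNNReal hLct, mul_comm, ← ENNReal.div_le_iff hLc0 hLct]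
  refine le_sInf ?_
  rintro lam ⟨hl0, hl1, hml⟩
  rw [ENNReal.div_le_iff hLc0 hLct]
  refine iSup₂_le fun β hβ => ?_
  have hlt : lam ≠ ⊤ := hl1.ne
  have hcl0 : c * lam ≠ 0 := mul_ne_zero hc0 hl0.ne'
  have hclt : c * lam ≠ ⊤ := by finiteness
  have hβ0 : (β : ℝ≥0∞) ≠ 0 := by exact_mod_cast hβ.ne'
  set b : ℝ≥0∞ := β / (c * lam) with hb
  have hb0 : b ≠ 0 := ENNReal.div_ne_zero.2 ⟨hβ0, hclt⟩
  have hbt : b ≠ ⊤ := ENNReal.div_ne_top (by simp) hcl0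
  have hbr : ENNReal.ofReal b.toReal = b := ENNReal.ofReal_toReal hbt
  have h1 := hcore f lam hl0 hl1 hml b.toReal (ENNReal.toReal_pos hb0 hbt)
  rw [hbr, hb, ENNReal.mul_div_cancel hcl0 hclt, ← hb] at h1
  have hmem : vlQ n p ({x | (β : ℝ≥0∞) < brMax n δ (⇑f) x}.indicator 1) ≤ L / b := by
    apply sInf_le
    refine ⟨ENNReal.div_pos hL0 hbt, ENNReal.div_lt_top hLt hb0, ?_⟩
    calc ∫⁻ x, ({x | (β : ℝ≥0∞) < brMax n δ (⇑f) x}.indicator 1 x / (L / b)) ^ (p x)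
        ≤ ∫⁻ x, {x | (β : ℝ≥0∞) < brMax n δ (⇑f) x}.indicator (fun x => b ^ (p x) * K⁻¹) x := by
          refine lintegral_mono fun x => ?_
          by_cases hx : x ∈ {x | (β : ℝ≥0∞) < brMax n δ (⇑f) x}
          · rw [indicator_of_mem hx, indicator_of_mem hx, Pi.one_apply, one_div, ENNReal.inv_div (Or.inl hbt) (Or.inl hb0)]
            exact rescale_pt K hKt hK1 p₀ (p x) hp₀ (hpl x) b
          · rw [indicator_of_notMem hx, indicator_of_notMem hx, ENNReal.zero_div, ENNReal.zero_rpow_of_pos (hp x).1]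
      _ ≤ ∫⁻ x in {x | (β : ℝ≥0∞) < brMax n δ (⇑f) x}, b ^ (p x) * K⁻¹ := lintegral_indicator_le _ _
      _ = (∫⁻ x in {x | (β : ℝ≥0∞) < brMax n δ (⇑f) x}, b ^ (p x)) * K⁻¹ := by
          rw [lintegral_mul_const' _ _ (by simp [(lt_of_lt_of_le one_pos hK1).ne'])]
      _ ≤ K * K⁻¹ := by gcongr
      _ ≤ 1 := ENNReal.mul_inv_le_one K
  refine (mul_le_mul' le_rfl hmem).trans_eq ?_
  rw [hb, div_eq_mul_inv L, ENNReal.inv_div (Or.inl hclt) (Or.inl hcl0), mul_left_comm, ENNReal.mul_div_cancel hβ0 (by simp)]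
  ring

theorem maximalBochnerRiesz_variableHardy_to_weakVariableLebesgue {n : ℕ} (hn : 1 ≤ n) (δ : ℝ)
    (hδ : ((n : ℝ) - 1) / 2 < δ)
    (p : En n → ℝ) (hpmeas : Measurable p)
    (hp : ∀ x, 0 < p x ∧ p x ≤ 1)
    (hlogH : GlobalLogHolder n p)
    (hlow : 2 * (n : ℝ) / ((n : ℝ) + 1 + 2 * δ) ≤ essInf p volume)
    (Φ : SchwartzMap (En n) ℂ) (hΦ : (∫ x, Φ x) ≠ 0) :
    ∃ C : ℝ≥0, 0 < C ∧ ∀ f : SchwartzMap (En n) ℂ,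
      vlWQ n p (brMax n δ (⇑f)) ≤
        (C : ℝ≥0∞) * vlQ n p (radMax n (⇑Φ) (⇑f)) := by
  exact main' hn δ hδ p hpmeas hp hlogH hlow Φ hΦ
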